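/- For every planar graph H and all positive integers Δ and N_0, there exists a positive integer N such that for every H-minor free graph G with maximum degree at most Δ, every 2-list-assignment L of G, and every pre-L-coloring c_0 of G with weak diameter in G at most N_0, c_0 can be extended to an L-coloring of G with clustering at most N. -/

import Mathlib

open SimpleGraph

universe u v

/-- `a` and `b` lie in a common monochromatic component of the coloring `c`
restricted to the set `S` of colored vertices. -/
def MonoReach {β : Type*} {α : Type*} (G : SimpleGraph β) (S : Set β) (c : β → α)
    (a b : β) : Prop :=
  ∃ w : G.Walk a b, ∀ v ∈ w.support, v ∈ S ∧ c v = c a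

/-- The coloring `c` (with domain `S`) has weak diameter in `G` at most `N`. -/
def HasWeakDiamLE {β : Type*} {α : Type*} (G : SimpleGraph β) (S : Set β) (c : β → α)
    (N : ℕ) : Prop :=
  ∀ a b : β, MonoReach G S c a b → G.dist a b ≤ N

/-- The coloring `c` (with domain `S`) has clustering at most `N`:
every monochromatic component has at most `N` vertices. -/
def HasClusteringLE {β : Type*} {α : Type*} (G : SimpleGraph β) (S : Set β) (c : β → α)
    (N : ℕ) : Prop :=
  ∀ a : β, {b | MonoReach G S c a b}.ncard ≤ N

/-- `G` has maximum degree at most `Δ`. -/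
def MaxDegreeLE {V : Type*} (G : SimpleGraph V) (Δ : ℕ) : Prop :=
  ∀ v, (G.neighborSet v).ncard ≤ Δ

/-- `H` is a minor of `G`. -/
def IsMinor {W : Type*} {V : Type*} (H : SimpleGraph W) (G : SimpleGraph V) : Prop :=
  ∃ B : W → Set V,
    (∀ w, (B w).Nonempty) ∧
    (∀ w, (G.induce (B w)).Connected) ∧
    (∀ w₁ w₂, w₁ ≠ w₂ → Disjoint (B w₁) (B w₂)) ∧
    (∀ ⦃w₁ w₂⦄, H.Adj w₁ w₂ → ∃ x ∈ B w₁, ∃ y ∈ B w₂, G.Adj x y)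

/-- A graph is planar iff it has no `K₅` minor and no `K₃,₃` minor
(Wagner's characterization of planarity). -/
def IsPlanar {W : Type*} (H : SimpleGraph W) : Prop :=
  ¬ IsMinor (⊤ : SimpleGraph (Fin 5)) H ∧
    ¬ IsMinor (completeBipartiteGraph (Fin 3) (Fin 3)) H

namespace ClusterExt

open SimpleGraph Set

section Foundations

variable {V : Type*} {W : Type*} {X : Type*} {G G' : SimpleGraph V} {B C : Set V}

/-- `B` is a nonempty set that is connected in `G`, phrased through cuts. -/
def Conn (G : SimpleGraph V) (B : Set V) : Prop :=
  B.Nonempty ∧ ∀ P ⊆ B, P.Nonempty → (∀ x ∈ P, ∀ y ∈ B, G.Adj x y → y ∈ P) → P = B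

/-- The set of vertices that can be reached from `x` inside `B`. -/
def reachIn (G : SimpleGraph V) (B : Set V) (x : V) : Set V :=
  {y | ∃ w : G.Walk x y, ∀ v ∈ w.support, v ∈ B}

lemma reachIn_subset (x : V) : reachIn G B x ⊆ B := by
  rintro y ⟨w, hw⟩
  exact hw _ w.end_mem_support

lemma mem_reachIn_self {x : V} (hx : x ∈ B) : x ∈ reachIn G B x :=
  ⟨Walk.nil, by simpa using hx⟩

lemma reachIn_closed {x y z : V} (hy : y ∈ reachIn G B x) (hz : z ∈ B) (h : G.Adj y z) :
    z ∈ reachIn G B x := by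
  obtain ⟨w, hw⟩ := hy
  refine ⟨w.concat h, fun v hv => ?_⟩
  rw [Walk.support_concat] at hv
  simp only [List.mem_append, List.mem_singleton] at hv
  rcases hv with hv | rfl
  · exact hw v hv
  · exact hz

lemma walk_support_subset_of_closed {P : Set V} {x y : V} (w : G.Walk x y)
    (hw : ∀ v ∈ w.support, v ∈ B) (hx : x ∈ P)
    (hP : ∀ x ∈ P, ∀ y ∈ B, G.Adj x y → y ∈ P) : ∀ v ∈ w.support, v ∈ P := by
  induction w with
  | nil => simpa using hx
  | cons h p ih =>
    intro v hv
    rw [Walk.support_cons, List.mem_cons] at hv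
    rcases hv with rfl | hv
    · exact hx
    · refine ih (fun v hv => hw v (by simp [hv])) (hP _ hx _ (hw _ (by simp)) h) v hv

lemma Conn.nonempty (h : Conn G B) : B.Nonempty := h.1

lemma Conn.subset_of_closed (h : Conn G B) {P : Set V} (hne : (B ∩ P).Nonempty)
    (hP : ∀ x ∈ B, x ∈ P → ∀ y ∈ B, G.Adj x y → y ∈ P) : B ⊆ P := by
  have := h.2 (B ∩ P) inter_subset_left hne
    (fun x hx y hy hxy => ⟨hy, hP x hx.1 hx.2 y hy hxy⟩)
  exact this ▸ inter_subset_right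

lemma conn_of_closed (hB : B.Nonempty)
    (h : ∀ P : Set V, (B ∩ P).Nonempty → (∀ x ∈ B, x ∈ P → ∀ y ∈ B, G.Adj x y → y ∈ P) → B ⊆ P) :
    Conn G B :=
  ⟨hB, fun P hPB hne hP => subset_antisymm hPB
    (h P (by rwa [inter_eq_self_of_subset_right hPB]) fun x _ hx y hy hxy => hP x hx y hy hxy)⟩

lemma Conn.exists_adj (h : Conn G B) (P : Set V) (h1 : (B ∩ P).Nonempty) (h2 : (B \ P).Nonempty) :
    ∃ x ∈ B, x ∈ P ∧ ∃ y ∈ B, y ∉ P ∧ G.Adj x y := by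
  by_contra hc
  push Not at hc
  obtain ⟨z, hzB, hzP⟩ := h2
  refine hzP (h.subset_of_closed h1 ?_ hzB)
  intro x hx hxP y hy hxy
  by_contra hyP
  exact hc x hx hxP y hy hyP hxy

lemma conn_singleton (x : V) : Conn G {x} :=
  conn_of_closed (singleton_nonempty x) (by
    rintro P ⟨y, rfl, hy⟩ _ z rfl
    exact hy)

lemma Conn.mono_adj (h : Conn G B) (hG : ∀ x ∈ B, ∀ y ∈ B, G.Adj x y → G'.Adj x y) :
    Conn G' B :=
  conn_of_closed h.1 fun _ hne hP => h.subset_of_closed hne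
    fun x hx hxP y hy hxy => hP x hx hxP y hy (hG x hx y hy hxy)

lemma Conn.mono (h : Conn G B) (hG : G ≤ G') : Conn G' B :=
  h.mono_adj fun _ _ _ _ hxy => hG hxy

lemma Conn.union (hB : Conn G B) (hC : Conn G C) (h : (B ∩ C).Nonempty) : Conn G (B ∪ C) := by
  obtain ⟨z, hzB, hzC⟩ := h
  refine conn_of_closed (hB.1.mono subset_union_left) fun P hne hP => ?_
  have hB' : (B ∩ P).Nonempty → B ⊆ P := fun hne => hB.subset_of_closed hne
    fun x hx hxP y hy hxy => hP x (Or.inl hx) hxP y (Or.inl hy) hxy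
  have hC' : (C ∩ P).Nonempty → C ⊆ P := fun hne => hC.subset_of_closed hne
    fun x hx hxP y hy hxy => hP x (Or.inr hx) hxP y (Or.inr hy) hxy
  obtain ⟨y, hy | hy, hyP⟩ := hne
  · have h1 := hB' ⟨y, hy, hyP⟩
    exact union_subset h1 (hC' ⟨z, hzC, h1 hzB⟩)
  · have h1 := hC' ⟨y, hy, hyP⟩
    exact union_subset (hB' ⟨z, hzB, h1 hzC⟩) h1

lemma conn_pair {x y : V} (h : G.Adj x y) : Conn G {x, y} := by
  refine conn_of_closed ⟨x, by simp⟩ fun P hne hP => ?_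
  rintro z hz
  obtain ⟨u, hu, huP⟩ := hne
  rcases hu with rfl | rfl <;> rcases hz with rfl | rfl
  · exact huP
  · exact hP _ (by simp) huP _ (by simp) h
  · exact hP _ (by simp) huP _ (by simp) h.symm
  · exact huP

lemma Conn.union_adj (hB : Conn G B) (hC : Conn G C) {x y : V} (hx : x ∈ B) (hy : y ∈ C)
    (h : G.Adj x y) : Conn G (B ∪ C) := by
  have h1 := hB.union (conn_pair h) ⟨x, hx, by simp⟩
  have h2 := h1.union hC ⟨y, by simp, hy⟩
  convert h2 using 1
  ext z
  simp only [mem_union, mem_insert_iff, mem_singleton_iff]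
  constructor
  · tauto
  · rintro ((h | rfl | rfl) | h) <;> tauto

lemma Conn.union_iUnion {ι : Sort*} (hB : Conn G B) {D : ι → Set V} (hD : ∀ i, Conn G (B ∪ D i)) :
    Conn G (B ∪ ⋃ i, D i) := by
  refine conn_of_closed (hB.1.mono subset_union_left) fun P hne hP => ?_
  have key : ∀ i, ((B ∪ D i) ∩ P).Nonempty → B ∪ D i ⊆ P := fun i hne =>
    (hD i).subset_of_closed hne fun x hx hxP y hy hxy =>
      hP x (union_subset_union_right B (subset_iUnion D i) hx) hxP y
        (union_subset_union_right B (subset_iUnion D i) hy) hxy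
  have hBP : B ⊆ P := by
    obtain ⟨x, hx | hx, hxP⟩ := hne
    · exact hB.subset_of_closed ⟨x, hx, hxP⟩
        fun x hx hxP y hy hxy => hP x (Or.inl hx) hxP y (Or.inl hy) hxy
    · obtain ⟨i, hi⟩ := mem_iUnion.1 hx
      exact subset_union_left.trans (key i ⟨x, Or.inr hi, hxP⟩)
  refine union_subset hBP (iUnion_subset fun i => ?_)
  obtain ⟨b, hb⟩ := hB.1
  exact subset_union_right.trans (key i ⟨b, Or.inl hb, hBP hb⟩)

lemma conn_support {x y : V} (w : G.Walk x y) : Conn G {v | v ∈ w.support} := by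
  induction w with
  | nil => simpa using conn_singleton _
  | cons h p ih =>
    have := (conn_singleton (G := G) _).union_adj ih rfl (by simp) h
    convert this using 1
    ext z
    simp

lemma conn_reachIn {x : V} (hx : x ∈ B) : Conn G (reachIn G B x) := by
  refine conn_of_closed ⟨x, mem_reachIn_self hx⟩ fun P hne hP => ?_
  obtain ⟨y, ⟨w, hw⟩, hyP⟩ := hne
  rintro z ⟨w', hw'⟩
  have hs : ∀ {y : V} (w : G.Walk x y), (∀ v ∈ w.support, v ∈ B) →
      ∀ v ∈ w.support, v ∈ reachIn G B x := fun w hw =>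
    walk_support_subset_of_closed w hw (mem_reachIn_self hx)
      fun _ hu _ hv huv => reachIn_closed hu hv huv
  have hc := (conn_support w).union (conn_support w') ⟨x, by simp, by simp⟩
  refine hc.subset_of_closed ⟨y, Or.inl (by simp), hyP⟩ ?_ (Or.inr (by simp))
  have hsub : ∀ v, v ∈ {v | v ∈ w.support} ∪ {v | v ∈ w'.support} → v ∈ reachIn G B x := by
    rintro v (h | h)
    · exact hs w hw v h
    · exact hs w' hw' v h
  exact fun u hu huP v hv huv => hP u (hsub u hu) huP v (hsub v hv) huv

lemma Conn.exists_walk (h : Conn G B) {a b : V} (ha : a ∈ B) (hb : b ∈ B) :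
    ∃ w : G.Walk a b, w.IsPath ∧ ∀ v ∈ w.support, v ∈ B := by
  classical
  have : B ⊆ reachIn G B a := h.subset_of_closed ⟨a, ha, mem_reachIn_self ha⟩
    fun x _ hxP y hy hxy => reachIn_closed hxP hy hxy
  obtain ⟨w, hw⟩ := this hb
  exact ⟨w.bypass, w.bypass_isPath, fun v hv => hw v (w.support_bypass_subset_support hv)⟩

lemma Conn.subset_reachIn (h : Conn G C) (hCB : C ⊆ B) {x : V} (hx : x ∈ C) : C ⊆ reachIn G B x :=
  h.subset_of_closed ⟨x, hx, mem_reachIn_self (hCB hx)⟩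
    fun _ _ hyP _ hz hyz => reachIn_closed hyP (hCB hz) hyz

lemma conn_iff_induce : Conn G B ↔ (G.induce B).Connected := by
  constructor
  · intro h
    have : Nonempty B := h.1.to_subtype
    refine ⟨fun a b => ?_⟩
    obtain ⟨w, -, hw⟩ := h.exists_walk a.2 b.2
    exact ⟨w.induce B hw⟩
  · intro h
    have := h.nonempty
    refine conn_of_closed (nonempty_coe_sort.1 h.nonempty) fun P hne hP => ?_
    obtain ⟨x, hxB, hxP⟩ := hne
    intro y hy
    obtain ⟨w⟩ := h.preconnected ⟨x, hxB⟩ ⟨y, hy⟩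
    have := walk_support_subset_of_closed (B := univ) (P := {z : B | (z : V) ∈ P}) w (by simp) hxP
      (fun u hu v _ huv => hP u u.2 hu v v.2 huv) ⟨y, hy⟩ (by simp)
    exact this

lemma conn_biUnion {H : SimpleGraph W} {C : Set W} (hC : Conn H C) {D : W → Set V}
    (hD : ∀ w ∈ C, Conn G (D w))
    (h : ∀ w ∈ C, ∀ w' ∈ C, H.Adj w w' → Conn G (D w ∪ D w')) :
    Conn G (⋃ w ∈ C, D w) := by
  obtain ⟨w₀, hw₀⟩ := hC.1
  obtain ⟨x₀, hx₀⟩ := (hD w₀ hw₀).1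
  refine conn_of_closed ⟨x₀, mem_biUnion hw₀ hx₀⟩ fun P hne hP => ?_
  have key : ∀ S : Set V, Conn G S → S ⊆ (⋃ w ∈ C, D w) → (S ∩ P).Nonempty → S ⊆ P :=
    fun S hS hsub hne => hS.subset_of_closed hne
      fun x hx hxP y hy hxy => hP x (hsub hx) hxP y (hsub hy) hxy
  obtain ⟨x, hx, hxP⟩ := hne
  obtain ⟨w, hw, hxw⟩ := mem_iUnion₂.1 hx
  have : C ⊆ {w | D w ⊆ P} := by
    refine hC.subset_of_closed ⟨w, hw, key _ (hD w hw) (subset_biUnion_of_mem hw) ⟨x, hxw, hxP⟩⟩ ?_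
    intro u hu huP v hv huv
    refine subset_union_right.trans (key _ (h u hu v hv huv)
      (union_subset (subset_biUnion_of_mem hu) (subset_biUnion_of_mem hv)) ?_)
    obtain ⟨z, hz⟩ := (hD u hu).1
    exact ⟨z, Or.inl hz, huP hz⟩
  exact iUnion₂_subset this

lemma isMinor_iff {H : SimpleGraph W} : IsMinor H G ↔ ∃ D : W → Set V, (∀ w, Conn G (D w)) ∧
    (∀ w w', w ≠ w' → Disjoint (D w) (D w')) ∧
    ∀ w w', H.Adj w w' → ∃ x ∈ D w, ∃ y ∈ D w', G.Adj x y := by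
  constructor
  · rintro ⟨D, -, h1, h2, h3⟩
    exact ⟨D, fun w => conn_iff_induce.2 (h1 w), h2, fun w w' h => h3 h⟩
  · rintro ⟨D, h1, h2, h3⟩
    exact ⟨D, fun w => (h1 w).1, fun w => conn_iff_induce.1 (h1 w), h2, fun w w' h => h3 w w' h⟩

lemma isMinor_trans {K : SimpleGraph X} {H : SimpleGraph W} (h1 : IsMinor K H)
    (h2 : IsMinor H G) : IsMinor K G := by
  rw [isMinor_iff] at *
  obtain ⟨D, hD, hd, ha⟩ := h1
  obtain ⟨E, hE, he, hb⟩ := h2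
  refine ⟨fun x => ⋃ w ∈ D x, E w, fun x => conn_biUnion (hD x) (fun w _ => hE w) ?_, ?_, ?_⟩
  · intro w _ w' _ hww
    obtain ⟨a, ha, b, hb, hab⟩ := hb w w' hww
    exact (hE w).union_adj (hE w') ha hb hab
  · intro x x' hxx
    simp only [disjoint_iUnion_left, disjoint_iUnion_right]
    intro w hw w' hw'
    refine he _ _ ?_
    rintro rfl
    exact (disjoint_left.1 (hd x x' hxx)) hw' hw
  · intro x x' hxx
    obtain ⟨w, hw, w', hw', hww⟩ := ha x x' hxx
    obtain ⟨a, ha, b, hb, hab⟩ := hb w w' hww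
    exact ⟨a, mem_biUnion hw ha, b, mem_biUnion hw' hb, hab⟩

lemma isMinor_mono_right {H : SimpleGraph W} (hG : G ≤ G') (h : IsMinor H G) : IsMinor H G' := by
  rw [isMinor_iff] at *
  obtain ⟨D, h1, h2, h3⟩ := h
  refine ⟨D, fun w => (h1 w).mono hG, h2, fun w w' hw => ?_⟩
  obtain ⟨x, hx, y, hy, hxy⟩ := h3 w w' hw
  exact ⟨x, hx, y, hy, hG hxy⟩

lemma isMinor_of_embedding {H : SimpleGraph W} (f : W → V) (hf : Function.Injective f)
    (h : ∀ w w', H.Adj w w' → G.Adj (f w) (f w')) : IsMinor H G := by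
  rw [isMinor_iff]
  refine ⟨fun w => {f w}, fun w => conn_singleton _, ?_, ?_⟩
  · intro w w' hne
    simpa using fun h => hne (hf h)
  · intro w w' hw
    exact ⟨_, rfl, _, rfl, h w w' hw⟩

end Foundations

section Menger

variable {V : Type*} {G G' J : SimpleGraph V} {A B D X : Set V}

/-- There are `s` pairwise disjoint connected sets meeting both `A` and `B`. -/
def Linked (G : SimpleGraph V) (A B : Set V) (s : ℕ) : Prop :=
  ∃ D : Fin s → Set V, (∀ i, Conn G (D i)) ∧ (∀ i, (D i ∩ A).Nonempty) ∧
    (∀ i, (D i ∩ B).Nonempty) ∧ ∀ i j, i ≠ j → Disjoint (D i) (D j)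

/-- `X` meets every connected set that meets both `A` and `B`. -/
def Separates (G : SimpleGraph V) (A B X : Set V) : Prop :=
  ∀ D, Conn G D → (D ∩ A).Nonempty → (D ∩ B).Nonempty → (D ∩ X).Nonempty

lemma Separates.symm (h : Separates G A B X) : Separates G B A X :=
  fun D hD hB hA => h D hD hA hB

lemma Linked.mono {s t : ℕ} (h : Linked G A B s) (hts : t ≤ s) : Linked G A B t := by
  obtain ⟨D, h1, h2, h3, h4⟩ := h
  exact ⟨fun i => D (Fin.castLE hts i), fun i => h1 _, fun i => h2 _, fun i => h3 _,
    fun i j hij => h4 _ _ fun h => hij (by simpa using h)⟩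

lemma Linked.mono_graph {s : ℕ} (h : Linked G A B s) (hG : G ≤ G') : Linked G' A B s := by
  obtain ⟨D, h1, h2, h3, h4⟩ := h
  exact ⟨D, fun i => (h1 i).mono hG, h2, h3, h4⟩

lemma Conn.exists_trim (hD : Conn G D) {a p : V} (ha : a ∈ D) (hp : p ∈ D) :
    ∃ E ⊆ D, Conn G E ∧ a ∈ E ∧ p ∈ E ∧ ∀ v ∈ E, v ≠ p → v ∈ reachIn G (D \ {p}) a := by
  classical
  obtain ⟨w, hw, hwD⟩ := hD.exists_walk ha hp
  refine ⟨{v | v ∈ w.support}, hwD, conn_support w, by simp, by simp, fun v hv hvp => ?_⟩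
  refine ⟨w.takeUntil v hv, fun u hu => ⟨hwD u (w.support_takeUntil_subset_support hv hu), ?_⟩⟩
  rintro rfl
  exact Walk.endpoint_notMem_support_takeUntil hw hv hvp.symm hu

lemma reachIn_symm {x y : V} (h : y ∈ reachIn G B x) : x ∈ reachIn G B y := by
  obtain ⟨w, hw⟩ := h
  exact ⟨w.reverse, by simpa using hw⟩

lemma reachIn_trans {x y z : V} (h : y ∈ reachIn G B x) (h' : z ∈ reachIn G B y) :
    z ∈ reachIn G B x := by
  obtain ⟨w, hw⟩ := h
  obtain ⟨w', hw'⟩ := h'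
  refine ⟨w.append w', fun v hv => ?_⟩
  rcases (Walk.mem_support_append_iff _ _).1 hv with hv | hv
  · exact hw v hv
  · exact hw' v hv

lemma reachIn_mono {C : Set V} (hBC : B ⊆ C) {x y : V} (h : y ∈ reachIn G B x) :
    y ∈ reachIn G C x := by
  obtain ⟨w, hw⟩ := h
  exact ⟨w, fun v hv => hBC (hw v hv)⟩

lemma left_mem_of_mem_reachIn {x y : V} (h : y ∈ reachIn G B x) : x ∈ B := by
  obtain ⟨w, hw⟩ := h
  exact hw x (by simp)

lemma Separates.not_reach (h : Separates G A B X) {a b : V} (ha : a ∈ A) (hb : b ∈ B) :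
    b ∉ reachIn G Xᶜ a := fun hr => by
  have hx := left_mem_of_mem_reachIn hr
  obtain ⟨z, hz, hzX⟩ := h _ (conn_reachIn hx) ⟨a, mem_reachIn_self hx, ha⟩ ⟨b, hr, hb⟩
  exact reachIn_subset _ hz hzX

/-- Deleting one edge from a connected set leaves two pieces, reached from the ends. -/
lemma Conn.subset_union_reachIn (hD : Conn G D) {x y : V} (hx : x ∈ D) (hy : y ∈ D)
    (hG : ∀ u v, G.Adj u v → J.Adj u v ∨ (u = x ∧ v = y) ∨ (u = y ∧ v = x)) :
    D ⊆ reachIn J D x ∪ reachIn J D y := by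
  refine hD.subset_of_closed ⟨x, hx, Or.inl (mem_reachIn_self hx)⟩ ?_
  intro u _ hur v hv huv
  rcases hG u v huv with h | ⟨-, rfl⟩ | ⟨-, rfl⟩
  · exact hur.imp (fun hu => reachIn_closed hu hv h) (fun hu => reachIn_closed hu hv h)
  · exact Or.inr (mem_reachIn_self hy)
  · exact Or.inl (mem_reachIn_self hx)

lemma Conn.of_notMem (hD : Conn G D) {x y : V} (h : x ∉ D ∨ y ∉ D)
    (hG : ∀ u v, G.Adj u v → J.Adj u v ∨ (u = x ∧ v = y) ∨ (u = y ∧ v = x)) : Conn J D := by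
  refine hD.mono_adj fun u hu v hv huv => ?_
  rcases hG u v huv with h1 | ⟨rfl, rfl⟩ | ⟨rfl, rfl⟩
  · exact h1
  · tauto
  · tauto

lemma Separates.lift {Z : Set V} {x y b₀ : V}
    (hG : ∀ u v, G.Adj u v → J.Adj u v ∨ (u = x ∧ v = y) ∨ (u = y ∧ v = x))
    (hX : Separates J A B X) (hb₀ : b₀ ∈ B) (hyb : b₀ ∈ reachIn J Xᶜ y)
    (hZ : Separates J A (insert x X) Z) : Separates G A B Z := by
  rintro D hD ⟨a, ha, haA⟩ hDB
  by_cases hxy : x ∉ D ∨ y ∉ D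
  · have hDJ := hD.of_notMem hxy hG
    obtain ⟨z, hz, hzX⟩ := hX D hDJ ⟨a, ha, haA⟩ hDB
    exact hZ D hDJ ⟨a, ha, haA⟩ ⟨z, hz, Or.inr hzX⟩
  push Not at hxy
  obtain ⟨hx, hy⟩ := hxy
  rcases hD.subset_union_reachIn hx hy hG ha with har | har
  · obtain ⟨z, hz, hzZ⟩ := hZ _ (conn_reachIn hx) ⟨a, har, haA⟩
      ⟨x, mem_reachIn_self hx, Or.inl rfl⟩
    exact ⟨z, reachIn_subset _ hz, hzZ⟩
  · by_cases hm : (reachIn J D y ∩ X).Nonempty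
    · obtain ⟨z, hz, hzX⟩ := hm
      obtain ⟨z, hz, hzZ⟩ := hZ _ (conn_reachIn hy) ⟨a, har, haA⟩ ⟨z, hz, Or.inr hzX⟩
      exact ⟨z, reachIn_subset _ hz, hzZ⟩
    · exfalso
      have : a ∈ reachIn J Xᶜ y := (conn_reachIn hy).subset_reachIn
        (fun v hv hvX => hm ⟨v, hv, hvX⟩) (mem_reachIn_self hy) har
      exact hX.not_reach haA hb₀ (reachIn_trans (reachIn_symm this) hyb)

lemma exists_trimmed_linkage [Finite V] {P : Set V} {s : ℕ} (h : Linked J A P s)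
    (hP : P.ncard = s) :
    ∃ (E : Fin s → Set V) (p a : Fin s → V), (∀ i, Conn J (E i)) ∧ (∀ i, p i ∈ E i) ∧
      (∀ i, a i ∈ E i) ∧ (∀ i, a i ∈ A) ∧ (∀ i j, i ≠ j → Disjoint (E i) (E j)) ∧
      range p = P ∧ ∀ i, ∀ v ∈ E i, v ≠ p i → v ∈ reachIn J Pᶜ (a i) := by
  obtain ⟨D, h1, h2, h3, h4⟩ := h
  choose a ha haA using h2
  choose p hp hpP using h3
  have hinj : Function.Injective p := by
    intro i j hij
    by_contra hne
    exact disjoint_left.1 (h4 i j hne) (hp i) (hij ▸ hp j)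
  have hrange : range p = P := by
    refine eq_of_subset_of_ncard_le (range_subset_iff.2 hpP) ?_ (toFinite _)
    rw [← image_univ, ncard_image_of_injective _ hinj, hP, ncard_univ]
    simp
  have huniq : ∀ i, ∀ v ∈ D i, v ∈ P → v = p i := by
    intro i v hv hvP
    obtain ⟨j, rfl⟩ := hrange ▸ hvP
    by_contra hne
    exact disjoint_left.1 (h4 j i fun h => hne (h ▸ rfl)) (hp j) hv
  choose E hED hE haE hpE hr using fun i => (h1 i).exists_trim (ha i) (hp i)
  refine ⟨E, p, a, hE, hpE, haE, haA, fun i j hij => (h4 i j hij).mono (hED i) (hED j), hrange,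
    fun i v hv hvp => reachIn_mono ?_ (hr i v hv hvp)⟩
  rintro u ⟨hu, hup⟩ huP
  exact hup (huniq i u hu huP)

lemma linked_glue [Finite V] {x y a₀ b₀ : V} {s : ℕ} (hJG : J ≤ G) (hxy : G.Adj x y)
    (hX : Separates J A B X) (hx : x ∉ X) (hy : y ∉ X)
    (ha₀ : a₀ ∈ A) (hxa : a₀ ∈ reachIn J Xᶜ x) (hb₀ : b₀ ∈ B) (hyb : b₀ ∈ reachIn J Xᶜ y)
    (hP : (insert x X).ncard = s) (hQ : (insert y X).ncard = s)
    (hA : Linked J A (insert x X) s) (hB : Linked J B (insert y X) s) : Linked G A B s := by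
  obtain ⟨E, p, a, hE, hpE, haE, haA, hEd, hpr, hEr⟩ := exists_trimmed_linkage hA hP
  obtain ⟨F, q, b, hF, hqF, hbF, hbB, hFd, hqr, hFr⟩ := exists_trimmed_linkage hB hQ
  have hpinj : Function.Injective p := by
    intro i j hij
    by_contra hne
    exact disjoint_left.1 (hEd i j hne) (hpE i) (hij ▸ hpE j)
  have key : ∀ i j v, v ∈ E i → v ∈ F j → v = p i ∧ v = q j ∧ v ∈ X := by
    intro i j v hvE hvF
    have hsub : ∀ {z : V}, (insert z X)ᶜ ⊆ Xᶜ := fun {z} => compl_subset_compl.2 (subset_insert z X)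
    have h1 : v ≠ p i → v ∈ reachIn J Xᶜ (a i) := fun h => reachIn_mono hsub (hEr i v hvE h)
    have h2 : v ≠ q j → v ∈ reachIn J Xᶜ (b j) := fun h => reachIn_mono hsub (hFr j v hvF h)
    by_cases hvX : v ∈ X
    · refine ⟨?_, ?_, hvX⟩
      · by_contra h
        exact reachIn_subset _ (h1 h) hvX
      · by_contra h
        exact reachIn_subset _ (h2 h) hvX
    exfalso
    have hpx : v = p i → v = x := fun h => by
      have : v ∈ insert x X := hpr ▸ ⟨i, h.symm⟩
      exact this.resolve_right hvX
    have hqy : v = q j → v = y := fun h => by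
      have : v ∈ insert y X := hqr ▸ ⟨j, h.symm⟩
      exact this.resolve_right hvX
    by_cases hvp : v = p i <;> by_cases hvq : v = q j
    · exact hxy.ne ((hpx hvp).symm.trans (hqy hvq))
    · have := hpx hvp
      subst this
      exact hX.not_reach ha₀ (hbB j) (reachIn_trans (reachIn_symm hxa) (reachIn_symm (h2 hvq)))
    · have := hqy hvq
      subst this
      exact hX.not_reach (haA i) hb₀ (reachIn_trans (h1 hvp) hyb)
    · exact hX.not_reach (haA i) (hbB j) (reachIn_trans (h1 hvp) (reachIn_symm (h2 hvq)))
  have hex : ∀ i, ∃ j, (p i = x ∧ q j = y) ∨ (p i ∈ X ∧ q j = p i) := by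
    intro i
    have : p i ∈ insert x X := hpr ▸ ⟨i, rfl⟩
    rcases this with h | h
    · obtain ⟨j, hj⟩ : y ∈ range q := hqr ▸ Or.inl rfl
      exact ⟨j, Or.inl ⟨h, hj⟩⟩
    · obtain ⟨j, hj⟩ : p i ∈ range q := hqr ▸ Or.inr h
      exact ⟨j, Or.inr ⟨h, hj⟩⟩
  choose f hf using hex
  have hfinj : Function.Injective f := by
    intro i i' h
    apply hpinj
    rcases hf i with ⟨h1, h2⟩ | ⟨h1, h2⟩ <;> rcases hf i' with ⟨h3, h4⟩ | ⟨h3, h4⟩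
    · rw [h1, h3]
    · rw [← h, h2] at h4
      exact absurd (h4 ▸ h3) hy
    · rw [← h, h2] at h4
      exact absurd (h4 ▸ h1) hy
    · rw [← h2, ← h4, h]
  refine ⟨fun i => E i ∪ F (f i), fun i => ?_, fun i => ⟨a i, Or.inl (haE i), haA i⟩,
    fun i => ⟨b (f i), Or.inr (hbF _), hbB _⟩, fun i j hij => ?_⟩
  · have hE' := (hE i).mono hJG
    have hF' := (hF (f i)).mono hJG
    rcases hf i with ⟨h1, h2⟩ | ⟨h1, h2⟩
    · exact hE'.union_adj hF' (hpE i) (hqF _) (by rw [h1, h2]; exact hxy)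
    · exact hE'.union hF' ⟨p i, hpE i, h2 ▸ hqF _⟩
  · have hcross : ∀ i j, i ≠ j → Disjoint (E i) (F (f j)) := by
      intro i j hij
      rw [Set.disjoint_left]
      intro v hv hv'
      obtain ⟨h1, h2, h3⟩ := key _ _ v hv hv'
      apply hij
      apply hpinj
      rcases hf j with ⟨h4, h5⟩ | ⟨h4, h5⟩
      · rw [h5] at h2
        exact absurd (h2 ▸ h3) hy
      · rw [← h1, h2, h5]
    rw [disjoint_union_left, disjoint_union_right, disjoint_union_right]
    exact ⟨⟨hEd i j hij, hcross i j hij⟩, (hcross j i hij.symm).symm,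
      hFd _ _ fun h => hij (hfinj h)⟩

theorem menger [Finite V] (s : ℕ) (G : SimpleGraph V) (A B : Set V) :
    Linked G A B s ∨ ∃ X : Set V, X.ncard < s ∧ Separates G A B X := by
  induction G using WellFoundedLT.induction generalizing A B with
  | ind G ih =>
  by_cases hG : G = ⊥
  · subst hG
    by_cases hs : s ≤ (A ∩ B).ncard
    · left
      obtain ⟨f, hf⟩ : ∃ f : Fin s → V, Function.Injective f ∧ ∀ i, f i ∈ A ∩ B := by
        obtain ⟨T, hT, hTs⟩ := exists_subset_card_eq hs
        have e := Finite.equivFinOfCardEq (α := T) (n := s) hTs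
        exact ⟨fun i => e.symm i, fun i j h => e.symm.injective (Subtype.ext h),
          fun i => hT (e.symm i).2⟩
      refine ⟨fun i => {f i}, fun i => conn_singleton _, fun i => ⟨f i, rfl, (hf.2 i).1⟩,
        fun i => ⟨f i, rfl, (hf.2 i).2⟩, fun i j hij => ?_⟩
      simpa using fun h => hij (hf.1 h)
    · right
      refine ⟨A ∩ B, not_le.1 hs, ?_⟩
      rintro D hD ⟨a, ha, haA⟩ ⟨b, hb, hbB⟩
      have : D ⊆ {a} := hD.subset_of_closed ⟨a, ha, rfl⟩
        fun _ _ _ _ _ h => absurd h (by simp)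
      exact ⟨a, ha, haA, this hb ▸ hbB⟩
  obtain ⟨x', y', hxy'⟩ := SimpleGraph.ne_bot_iff_exists_adj.1 hG
  set J := G.deleteEdges {s(x', y')} with hJ
  have hJG : J ≤ G := deleteEdges_le _
  have hlt : J < G := by
    refine lt_of_le_of_ne hJG fun h => ?_
    have : J.Adj x' y' := h ▸ hxy'
    simp [hJ] at this
  rcases ih J hlt A B with h | ⟨X, hXs, hX⟩
  · exact Or.inl (h.mono_graph hJG)
  by_cases hXG : Separates G A B X
  · exact Or.inr ⟨X, hXs, hXG⟩
  have hG' : ∀ u v, G.Adj u v → J.Adj u v ∨ (u = x' ∧ v = y') ∨ (u = y' ∧ v = x') := by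
    intro u v huv
    by_cases h : s(u, v) = s(x', y')
    · right
      simpa using h
    · left
      simp only [hJ, deleteEdges_adj, huv, true_and]
      exact h
  obtain ⟨x, y, hxy, hGJ, hx, hy, a₀, ha₀, hxa, b₀, hb₀, hyb⟩ : ∃ x y, G.Adj x y ∧
      (∀ u v, G.Adj u v → J.Adj u v ∨ (u = x ∧ v = y) ∨ (u = y ∧ v = x)) ∧ x ∉ X ∧ y ∉ X ∧
      ∃ a₀ ∈ A, a₀ ∈ reachIn J Xᶜ x ∧ ∃ b₀ ∈ B, b₀ ∈ reachIn J Xᶜ y := by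
    unfold Separates at hXG
    push Not at hXG
    obtain ⟨D, hD, ⟨a, ha, haA⟩, ⟨b, hb, hbB⟩, hDX⟩ := hXG
    have hDX' : D ⊆ Xᶜ := fun v hv hvX => by
      have : v ∈ D ∩ X := ⟨hv, hvX⟩
      simp [hDX] at this
    by_cases hxy : x' ∉ D ∨ y' ∉ D
    · obtain ⟨z, hz, hzX⟩ := hX D (hD.of_notMem hxy hG') ⟨a, ha, haA⟩ ⟨b, hb, hbB⟩
      exact absurd hzX (hDX' hz)
    push Not at hxy
    obtain ⟨hx, hy⟩ := hxy
    have hsub := hD.subset_union_reachIn hx hy hG'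
    have hno := hX.not_reach haA hbB
    rcases hsub ha with har | har <;> rcases hsub hb with hbr | hbr
    · exact absurd (reachIn_mono hDX' (reachIn_trans (reachIn_symm har) hbr)) hno
    · exact ⟨x', y', hxy', hG', hDX' hx, hDX' hy, a, haA, reachIn_mono hDX' har, b, hbB,
        reachIn_mono hDX' hbr⟩
    · exact ⟨y', x', hxy'.symm, fun u v huv => (hG' u v huv).imp_right Or.symm, hDX' hy, hDX' hx,
        a, haA, reachIn_mono hDX' har, b, hbB, reachIn_mono hDX' hbr⟩
    · exact absurd (reachIn_mono hDX' (reachIn_trans (reachIn_symm har) hbr)) hno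
  have hGJ' : ∀ u v, G.Adj u v → J.Adj u v ∨ (u = y ∧ v = x) ∨ (u = x ∧ v = y) :=
    fun u v huv => (hGJ u v huv).imp_right Or.symm
  have hsep : ∀ z, z = x ∨ z = y → Separates G A B (insert z X) := by
    intro z hz D hD hDA hDB
    by_cases hzD : z ∈ D
    · exact ⟨z, hzD, Or.inl rfl⟩
    · have : Conn J D := by
        rcases hz with rfl | rfl
        · exact hD.of_notMem (Or.inl hzD) hGJ
        · exact hD.of_notMem (Or.inr hzD) hGJ
      obtain ⟨v, hv, hvX⟩ := hX D this hDA hDB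
      exact ⟨v, hv, Or.inr hvX⟩
  by_cases hcard : X.ncard + 1 < s
  · exact Or.inr ⟨insert x X, by rwa [ncard_insert_of_notMem hx], hsep x (Or.inl rfl)⟩
  have hPs : (insert x X).ncard = s := by rw [ncard_insert_of_notMem hx]; omega
  have hQs : (insert y X).ncard = s := by rw [ncard_insert_of_notMem hy]; omega
  rcases ih J hlt A (insert x X) with h1 | ⟨Z, hZs, hZ⟩
  swap
  · exact Or.inr ⟨Z, hZs, Separates.lift hGJ hX hb₀ hyb hZ⟩
  rcases ih J hlt B (insert y X) with h2 | ⟨Z, hZs, hZ⟩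
  swap
  · exact Or.inr ⟨Z, hZs, (Separates.lift hGJ' hX.symm ha₀ hxa hZ).symm⟩
  exact Or.inl (linked_glue hJG hxy hX hx hy ha₀ hxa hb₀ hyb hPs hQs h1 h2)

end Menger

section Crossing

variable {V : Type*} {G G' J M : SimpleGraph V} {A B C : Set V} {s : ℕ}

/-- `s` pairwise disjoint paths from `A` to `B`; the `j`-th one visits `q j 0, …, q j (l j)`. -/
structure IsPathFamily (G : SimpleGraph V) (A B : Set V) {s : ℕ} (q : Fin s → ℕ → V)
    (l : Fin s → ℕ) : Prop where
  adj : ∀ j t, t < l j → G.Adj (q j t) (q j (t + 1))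
  left : ∀ j, q j 0 ∈ A
  right : ∀ j, q j (l j) ∈ B
  inj : ∀ j j' t t', t ≤ l j → t' ≤ l j' → q j t = q j' t' → j = j' ∧ t = t'

lemma Linked.exists_isPathFamily (h : Linked G A B s) :
    ∃ q l, IsPathFamily G A B (s := s) q l := by
  obtain ⟨D, h1, h2, h3, h4⟩ := h
  choose a ha haA using h2
  choose b hb hbB using h3
  choose w hw hwD using fun i => (h1 i).exists_walk (ha i) (hb i)
  refine ⟨fun j t => (w j).getVert t, fun j => (w j).length, fun j t ht => ?_, fun j => ?_,
    fun j => ?_, fun j j' t t' ht ht' heq => ?_⟩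
  · exact (w j).adj_getVert_succ ht
  · simpa using haA j
  · simpa using hbB j
  · have h5 : (w j).getVert t ∈ D j := hwD j _ (Walk.getVert_mem_support _ _)
    have h6 : (w j').getVert t' ∈ D j' := hwD j' _ (Walk.getVert_mem_support _ _)
    have : j = j' := by
      by_contra hne
      exact Set.disjoint_left.1 (h4 j j' hne) h5 (heq ▸ h6)
    subst this
    exact ⟨rfl, (hw j).getVert_injOn ht ht' heq⟩

lemma mem_reachIn_of_path {q : ℕ → V} {a b : ℕ} (hab : a ≤ b) (hC : ∀ t, a ≤ t → t ≤ b → q t ∈ C)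
    (hadj : ∀ t, a ≤ t → t < b → G.Adj (q t) (q (t + 1))) : q b ∈ reachIn G C (q a) := by
  induction b, hab using Nat.le_induction with
  | base => exact mem_reachIn_self (hC a le_rfl le_rfl)
  | succ b hab ih =>
    exact reachIn_closed (ih (fun t h1 h2 => hC t h1 (by omega))
      fun t h1 h2 => hadj t h1 (by omega))
      (hC _ (by omega) le_rfl) (hadj b hab (by omega))

lemma conn_image_Icc {q : ℕ → V} {a b : ℕ} (hab : a ≤ b)
    (hadj : ∀ t, a ≤ t → t < b → G.Adj (q t) (q (t + 1))) : Conn G (q '' Icc a b) := by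
  refine conn_of_closed ⟨q a, a, ⟨le_rfl, hab⟩, rfl⟩ fun P hne hP => ?_
  have hP' : ∀ t t', a ≤ t → t ≤ b → a ≤ t' → t' ≤ b → G.Adj (q t) (q t') → q t ∈ P → q t' ∈ P :=
    fun t t' h1 h2 h3 h4 h h' => hP _ ⟨t, ⟨h1, h2⟩, rfl⟩ h' _ ⟨t', ⟨h3, h4⟩, rfl⟩ h
  obtain ⟨_, ⟨t₀, ⟨h1, h2⟩, rfl⟩, ht₀⟩ := hne
  have ha : q a ∈ P := by
    induction t₀, h1 using Nat.le_induction with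
    | base => exact ht₀
    | succ t h ih =>
      exact ih (by omega) (hP' (t + 1) t (by omega) (by omega) h (by omega)
        (hadj t h (by omega)).symm ht₀)
  rintro _ ⟨t, ⟨h3, h4⟩, rfl⟩
  induction t, h3 using Nat.le_induction with
  | base => exact ha
  | succ t h ih =>
    exact hP' t (t + 1) h (by omega) (by omega) h4 (hadj t h (by omega)) (ih (by omega))

/-- `n` horizontal paths, each cut into `d` consecutive segments, and `d` connected sets such that
the `i`-th one meets every horizontal path, and only within its `i`-th segment. -/
structure IsCrossbar (J : SimpleGraph V) {n d : ℕ} (q : Fin n → ℕ → Set V) (P : ℕ → Set V) :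
    Prop where
  conn_seg : ∀ j, ∀ i < d, Conn J (q j i)
  conn_vert : ∀ i < d, Conn J (P i)
  adj : ∀ j i, i + 1 < d → ∃ x ∈ q j i, ∃ y ∈ q j (i + 1), J.Adj x y
  disj_seg : ∀ j j' i i', i < d → i' < d → (j, i) ≠ (j', i') → Disjoint (q j i) (q j' i')
  disj_vert : ∀ i i', i < d → i' < d → i ≠ i' → Disjoint (P i) (P i')
  meet : ∀ j, ∀ i < d, (P i ∩ q j i).Nonempty
  avoid : ∀ j i i', i < d → i' < d → i ≠ i' → Disjoint (P i) (q j i')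

def HasCrossbar (J : SimpleGraph V) (n d : ℕ) : Prop :=
  ∃ (q : Fin n → ℕ → Set V) (P : ℕ → Set V), IsCrossbar J (d := d) q P

/-- The edges of `J` inside the members of a family of sets. -/
def insideGraph {ι : Type*} (J : SimpleGraph V) (P : ι → Set V) : SimpleGraph V where
  Adj u v := J.Adj u v ∧ ∃ i, u ∈ P i ∧ v ∈ P i
  symm := ⟨fun _ _ h => ⟨h.1.symm, h.2.imp fun _ h => h.symm⟩⟩
  loopless := ⟨fun _ h => h.1.ne rfl⟩

lemma exists_cut [Finite V] {H : SimpleGraph V} {q : Fin s → ℕ → V} {l : Fin s → ℕ}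
    (hHM : H ≤ M) (hmin : ∀ N < M, H ≤ N → ¬ Linked N A B s) (hq : IsPathFamily M A B q l)
    (j₀ : Fin s) (m : ℕ) (hm : m < l j₀) (hH : ¬ H.Adj (q j₀ m) (q j₀ (m + 1))) :
    ∃ X F : Set V, X.ncard < s ∧
      (∀ C, Conn H C → Disjoint C X → (C ∩ F).Nonempty → C ⊆ F) ∧
      (∀ t ≤ m, q j₀ t ∈ F) ∧ (∀ t, m < t → t ≤ l j₀ → q j₀ t ∉ F) ∧
      ∀ j ≠ j₀, ∃ c ≤ l j, (∀ t < c, q j t ∈ F) ∧ ∀ t, c ≤ t → t ≤ l j → q j t ∉ F := by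
  classical
  set N := M.deleteEdges {s(q j₀ m, q j₀ (m + 1))} with hN
  have hNM : N ≤ M := deleteEdges_le _
  have hlt : N < M := by
    refine lt_of_le_of_ne hNM fun h => ?_
    have : N.Adj (q j₀ m) (q j₀ (m + 1)) := h ▸ hq.adj j₀ m hm
    simp [hN] at this
  have hHN : H ≤ N := by
    intro u v huv
    simp only [hN, deleteEdges_adj, mem_singleton_iff]
    refine ⟨hHM huv, fun h => ?_⟩
    rcases Sym2.eq_iff.1 h with ⟨rfl, rfl⟩ | ⟨rfl, rfl⟩
    · exact hH huv
    · exact hH huv.symm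
  have hadj : ∀ j t, t < l j → (j, t) ≠ (j₀, m) → N.Adj (q j t) (q j (t + 1)) := by
    intro j t ht hne
    simp only [hN, deleteEdges_adj, mem_singleton_iff]
    refine ⟨hq.adj j t ht, fun h => ?_⟩
    rcases Sym2.eq_iff.1 h with ⟨h1, h2⟩ | ⟨h1, h2⟩
    · obtain ⟨rfl, rfl⟩ := hq.inj _ _ _ _ ht.le hm.le h1
      exact hne rfl
    · have h3 := hq.inj _ _ _ _ ht.le hm h1
      have h4 := hq.inj _ _ _ _ ht hm.le h2
      omega
  obtain ⟨X, hXs, hX⟩ := (menger s N A B).resolve_left (hmin N hlt hHN)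
  have hhit : ∀ j, j ≠ j₀ → ∃ c ≤ l j, q j c ∈ X := by
    intro j hj
    obtain ⟨_, ⟨t, ht, rfl⟩, htX⟩ := hX (q j '' Icc 0 (l j))
      (conn_image_Icc (Nat.zero_le _) fun t _ ht => hadj j t ht (by simp [hj]))
      ⟨q j 0, ⟨0, by simp, rfl⟩, hq.left j⟩ ⟨q j (l j), ⟨l j, by simp, rfl⟩, hq.right j⟩
    exact ⟨t, ht.2, htX⟩
  choose! c hcl hcX using hhit
  have hXeq : (fun j => q j (c j)) '' {j₀}ᶜ = X := by
    refine eq_of_subset_of_ncard_le ?_ ?_ (toFinite _)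
    · rintro _ ⟨j, hj, rfl⟩
      exact hcX j hj
    · rw [InjOn.ncard_image]
      · rw [ncard_compl]
        simp
        omega
      · intro j hj j' hj' h
        exact (hq.inj _ _ _ _ (hcl j hj) (hcl j' hj') h).1
  have huniq : ∀ j t, t ≤ l j → q j t ∈ X → j ≠ j₀ ∧ t = c j := by
    intro j t ht htX
    rw [← hXeq] at htX
    obtain ⟨j', hj', h⟩ := htX
    obtain ⟨rfl, rfl⟩ := hq.inj _ _ _ _ (hcl j' hj') ht h
    exact ⟨hj', rfl⟩
  refine ⟨X, {v | ∃ a ∈ A, v ∈ reachIn N Xᶜ a}, hXs, ?_, ?_, ?_,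
    fun j hj => ⟨c j, hcl j hj, ?_, ?_⟩⟩
  · rintro C hC hCX ⟨z, hz, a, ha, hza⟩ y hy
    refine ⟨a, ha, reachIn_trans hza ?_⟩
    exact (hC.mono hHN).subset_reachIn (fun v hv => Set.disjoint_left.1 hCX hv) hz hy
  · intro t ht
    refine ⟨_, hq.left j₀, mem_reachIn_of_path (Nat.zero_le t) (fun u _ hu huX => ?_) ?_⟩
    · exact (huniq j₀ u (by omega) huX).1 rfl
    · intro u _ hu
      exact hadj _ _ (by omega) (by simp; omega)
  · rintro t ht1 ht2 ⟨a, ha, hta⟩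
    refine hX.not_reach ha (hq.right j₀) (reachIn_trans hta
      (mem_reachIn_of_path ht2 (fun u _ hu huX => ?_) ?_))
    · exact (huniq j₀ u (by omega) huX).1 rfl
    · intro u _ hu
      exact hadj _ _ (by omega) (by simp; omega)
  · intro t ht
    have := hcl j hj
    refine ⟨_, hq.left j, mem_reachIn_of_path (Nat.zero_le t) (fun u _ hu huX => ?_) ?_⟩
    · have := (huniq j u (by omega) huX).2
      omega
    · intro u _ hu
      exact hadj _ _ (by omega) (by simp [hj])
  · rintro t ht1 ht2 ⟨a, ha, hta⟩
    rcases eq_or_lt_of_le ht1 with rfl | ht1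
    · exact reachIn_subset _ hta (hcX j hj)
    refine hX.not_reach ha (hq.right j) (reachIn_trans hta
      (mem_reachIn_of_path ht2 (fun u _ hu huX => ?_) ?_))
    · have := (huniq j u (by omega) huX).2
      omega
    · intro u _ hu
      exact hadj _ _ (by omega) (by simp [hj])

lemma conn_insideGraph {ι : Type*} {P : ι → Set V} (hP : ∀ i, Conn J (P i)) (i : ι) :
    Conn (insideGraph J P) (P i) :=
  (hP i).mono_adj fun _ hu _ hv huv => ⟨huv, i, hu, hv⟩

lemma exists_first_hits {ι : Type*} {P : ι → Set V} (hPd : ∀ i j, i ≠ j → Disjoint (P i) (P j))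
    {q : ℕ → V} {l N : ℕ} (T : Finset ι) (hT : ∀ i ∈ T, ∃ t ≤ l, q t ∈ P i) (hN : N ≤ T.card) :
    ∃ (θ : Fin N ↪o ℕ) (f : Fin N → ι), Function.Injective f ∧ (∀ x, f x ∈ T) ∧
      (∀ x, θ x ≤ l) ∧ (∀ x, q (θ x) ∈ P (f x)) ∧ ∀ x, ∀ t < θ x, q t ∉ P (f x) := by
  classical
  have hex : ∀ i, ∃ t, i ∈ T → t ≤ l ∧ q t ∈ P i ∧ ∀ t' < t, q t' ∉ P i := by
    intro i
    by_cases hi : i ∈ T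
    · obtain ⟨t, htl, ht⟩ := hT i hi
      have hx : ∃ t, q t ∈ P i := ⟨t, ht⟩
      exact ⟨Nat.find hx, fun _ => ⟨(Nat.find_min' hx ht).trans htl, Nat.find_spec hx,
        fun t' ht' => Nat.find_min hx ht'⟩⟩
    · exact ⟨0, fun h => absurd h hi⟩
  choose τ hτ using hex
  have hinj : InjOn τ T := by
    intro i hi j hj hij
    by_contra hne
    exact Set.disjoint_left.1 (hPd i j hne) (hτ i hi).2.1 (hij ▸ (hτ j hj).2.1)
  have hcard : N ≤ (T.image τ).card := by rwa [Finset.card_image_of_injOn hinj]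
  set θ := Finset.orderEmbOfCardLe (T.image τ) hcard
  have hθ : ∀ x, ∃ i ∈ T, τ i = θ x := fun x =>
    Finset.mem_image.1 (Finset.orderEmbOfCardLe_mem (T.image τ) hcard x)
  choose f hfT hfτ using hθ
  refine ⟨θ, f, fun x y hxy => θ.injective (by rw [← hfτ, ← hfτ, hxy]), hfT, fun x => ?_,
    fun x => ?_, fun x => ?_⟩
  · rw [← hfτ]
    exact (hτ _ (hfT x)).1
  · rw [← hfτ]
    exact (hτ _ (hfT x)).2.1
  · rw [← hfτ]
    exact (hτ _ (hfT x)).2.2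

lemma exists_disjoint_of_card_lt [Finite V] {ι : Type*} {P : ι → Set V}
    (hPd : ∀ i j, i ≠ j → Disjoint (P i) (P j)) {K d s : ℕ} (hK : d * s ≤ K) (hd : 0 < d)
    {f : Fin K → ι} (hf : Function.Injective f) (X : ℕ → Set V) (hX : ∀ g, (X g).ncard < s) :
    ∃ r, ∀ g < d, Disjoint (P (f r)) (X g) := by
  classical
  by_contra hno
  push Not at hno
  choose g hg hne using hno
  simp only [Set.not_disjoint_iff] at hne
  choose y hy hyX using hne
  have hyinj : Function.Injective y := by
    intro r r' h
    by_contra hne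
    exact Set.disjoint_left.1 (hPd _ _ fun h => hne (hf h)) (hy r) (h ▸ hy r')
  have h1 : (Finset.univ.image y).card = K := by
    rw [Finset.card_image_of_injective _ hyinj]
    simp
  have h2 : Finset.univ.image y ⊆
      (Finset.range d).biUnion fun g => (X g).toFinite.toFinset := by
    intro v hv
    obtain ⟨r, -, rfl⟩ := Finset.mem_image.1 hv
    simp only [Finset.mem_biUnion, Finset.mem_range, Finite.mem_toFinset]
    exact ⟨g r, hg r, hyX r⟩
  have h3 := Finset.card_le_card h2
  have h4 : ((Finset.range d).biUnion fun g => (X g).toFinite.toFinset).card ≤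
      (Finset.range d).card * (s - 1) := by
    refine Finset.card_biUnion_le_card_mul _ _ _ fun g _ => ?_
    have := hX g
    rw [ncard_eq_toFinset_card _ (toFinite _)] at this
    omega
  rw [Finset.card_range] at h4
  have h5 : d * (s - 1) < d * s := Nat.mul_lt_mul_of_pos_left (by have := hX 0; omega) hd
  omega

lemma hasCrossbar_of_hits [Finite V] {ι : Type*} {P : ι → Set V} (hP : ∀ i, Conn J (P i))
    (hPd : ∀ i j, i ≠ j → Disjoint (P i) (P j)) {q : Fin s → ℕ → V} {l : Fin s → ℕ}
    (hHM : insideGraph J P ≤ M) (hMJ : M ≤ J)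
    (hmin : ∀ N < M, insideGraph J P ≤ N → ¬ Linked N A B s) (hq : IsPathFamily M A B q l)
    {n d k : ℕ} (hd : 0 < d) (hs : 1 + d * k + n ≤ s) (T : Finset ι)
    (hT : ∀ i ∈ T, {j | ∀ t ≤ l j, q j t ∉ P i}.ncard ≤ k)
    (hcard : s * (d * (d * s)) ≤ T.card) : HasCrossbar J n d := by
  classical
  have hk : k < s := by nlinarith
  have hhit : ∀ i, ∃ j, i ∈ T → ∃ t ≤ l j, q j t ∈ P i := by
    intro i
    by_cases hi : i ∈ T
    · by_contra hno
      push Not at hno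
      have : {j | ∀ t ≤ l j, q j t ∉ P i} = univ := eq_univ_of_forall fun j => (hno j).2
      have h2 := hT i hi
      rw [this, ncard_univ] at h2
      simp at h2
      omega
    · exact ⟨⟨0, by omega⟩, fun h => absurd h hi⟩
  choose f hf using hhit
  obtain ⟨j₀, -, hj₀⟩ := Finset.exists_le_card_fiber_of_mul_le_card_of_maps_to
    (s := T) (t := Finset.univ) (f := f) (n := d * (d * s)) (fun _ _ => Finset.mem_univ _)
    ⟨⟨0, by omega⟩, Finset.mem_univ _⟩ (by simpa using hcard)
  set K := d * s with hK
  obtain ⟨θ, e, heinj, heT, hθl, hθP, hθmin⟩ := exists_first_hits hPd (q := q j₀) (l := l j₀)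
    (T.filter fun i => f i = j₀) (by
      intro i hi
      rw [Finset.mem_filter] at hi
      exact hi.2 ▸ hf i hi.1) hj₀
  have hidx : ∀ g r, g < d → r < K → g * K + r < d * K := by
    intro g r hg hr
    calc g * K + r < (g + 1) * K := by rw [add_mul]; omega
      _ ≤ d * K := Nat.mul_le_mul_right K hg
  have hKpos : 0 < K := Nat.mul_pos hd (by omega)
  have hcut : ∀ g, ∃ X F : Set V, X.ncard < s ∧ ∀ (h1 : 1 ≤ g) (h2 : g < d),
      (∀ C, Conn (insideGraph J P) C → Disjoint C X → (C ∩ F).Nonempty → C ⊆ F) ∧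
      (∀ t < θ ⟨g * K + 0, hidx g 0 h2 hKpos⟩, q j₀ t ∈ F) ∧
      (∀ t, θ ⟨g * K + 0, hidx g 0 h2 hKpos⟩ ≤ t → t ≤ l j₀ → q j₀ t ∉ F) ∧
      ∀ j ≠ j₀, ∃ c ≤ l j, (∀ t < c, q j t ∈ F) ∧ ∀ t, c ≤ t → t ≤ l j → q j t ∉ F := by
    intro g
    by_cases hg : 1 ≤ g ∧ g < d
    swap
    · exact ⟨∅, ∅, by simp; omega, fun h1 h2 => absurd ⟨h1, h2⟩ hg⟩
    obtain ⟨h1, h2⟩ := hg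
    set x : Fin (d * K) := ⟨g * K + 0, hidx g 0 h2 hKpos⟩ with hx
    have hpos : 0 < θ x := by
      have : θ ⟨0, by positivity⟩ < θ x := θ.lt_iff_lt.2 (by
        rw [hx, Fin.lt_def]
        have : 0 < g * K := Nat.mul_pos h1 hKpos
        simpa using this)
      omega
    have hθ1 : θ x - 1 + 1 = θ x := by omega
    obtain ⟨X, F, h3, h4, h5, h6, h7⟩ := exists_cut hHM hmin hq j₀ (θ x - 1)
      (by have := hθl x; omega) (by
        rintro ⟨-, i, hi1, hi2⟩
        rw [hθ1] at hi2
        have : i = e x := by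
          by_contra hne
          exact Set.disjoint_left.1 (hPd _ _ hne) hi2 (hθP x)
        subst this
        exact hθmin x _ (by omega) hi1)
    exact ⟨X, F, h3, fun _ _ => ⟨h4, fun t ht => h5 t (by change t < θ x at ht; omega),
      fun t ht => h6 t (by change θ x ≤ t at ht; omega), h7⟩⟩
  choose X F hXs hXF using hcut
  have hr : ∀ g, ∃ i, g < d → i ∈ T ∧ (∀ g' < d, Disjoint (P i) (X g')) ∧
      (∀ g', 1 ≤ g' → g' ≤ g → Disjoint (P i) (F g')) ∧
      ∀ g', g < g' → g' < d → P i ⊆ F g' := by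
    intro g
    by_cases hg : g < d
    swap
    · exact ⟨e ⟨0, by positivity⟩, fun h => absurd h hg⟩
    obtain ⟨r, hr⟩ := exists_disjoint_of_card_lt hPd (K := K) (d := d) (s := s) le_rfl hd
      (f := fun r => e ⟨g * K + r, hidx g r hg r.2⟩) (by
        intro r r' h
        have := heinj h
        simp only [Fin.mk.injEq] at this
        exact Fin.ext (by omega)) X hXs
    set x : Fin (d * K) := ⟨g * K + r, hidx g r hg r.2⟩ with hx
    refine ⟨e x, fun _ => ⟨(Finset.mem_filter.1 (heT x)).1, hr, fun g' h1 h2 => ?_,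
      fun g' h1 h2 => ?_⟩⟩
    · rw [Set.disjoint_iff_inter_eq_empty, ← Set.not_nonempty_iff_eq_empty]
      intro hne
      obtain ⟨h4, h5, h6, h7⟩ := hXF g' h1 (by omega)
      refine h6 (θ x) (θ.le_iff_le.2 ?_) (hθl x)
        (h4 _ (conn_insideGraph hP (e x)) (hr g' (by omega)) hne (hθP x))
      rw [hx, Fin.le_def]
      have := Nat.mul_le_mul_right K h2
      simp only
      omega
    · obtain ⟨h4, h5, h6, h7⟩ := hXF g' (by omega) h2
      refine h4 _ (conn_insideGraph hP (e x)) (hr g' h2) ⟨_, hθP x, h5 _ (θ.lt_iff_lt.2 ?_)⟩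
      rw [hx, Fin.lt_def]
      have := Nat.mul_le_mul_right K (show g + 1 ≤ g' from h1)
      rw [add_mul] at this
      have := r.2
      simp only
      omega
  choose p hp using hr
  have hc : ∀ j g, ∃ c, j ≠ j₀ → 1 ≤ g → g < d →
      c ≤ l j ∧ (∀ t < c, q j t ∈ F g) ∧ ∀ t, c ≤ t → t ≤ l j → q j t ∉ F g := by
    intro j g
    by_cases h : j ≠ j₀ ∧ 1 ≤ g ∧ g < d
    · obtain ⟨c, hc⟩ := (hXF g h.2.1 h.2.2).2.2.2 j h.1
      exact ⟨c, fun _ _ _ => hc⟩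
    · exact ⟨0, fun h1 h2 h3 => absurd ⟨h1, h2, h3⟩ h⟩
  choose c₀ hc₀ using hc
  let c : Fin s → ℕ → ℕ := fun j g => if g = 0 then 0 else if g < d then c₀ j g else l j + 1
  have hcpos : ∀ j, j ≠ j₀ → ∀ g < d, ∀ t ≤ l j, q j t ∈ P (p g) → c j g ≤ t ∧ t < c j (g + 1) := by
    intro j hj g hg t ht htP
    constructor
    · by_cases h0 : g = 0
      · simp [c, h0]
      · simp only [c, h0, hg, if_true, if_false]
        by_contra hlt
        exact Set.disjoint_left.1 ((hp g hg).2.2.1 g (by omega) le_rfl) htP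
          ((hc₀ j g hj (by omega) hg).2.1 t (by omega))
    · by_cases h1 : g + 1 < d
      · simp only [c, h1, if_true]
        by_contra hlt
        exact (hc₀ j (g + 1) hj (by omega) h1).2.2 t (by simpa using hlt) ht
          ((hp g hg).2.2.2 (g + 1) (by omega) h1 htP)
      · simp [c, h1]
        omega
  obtain ⟨σ, hσinj, hσ⟩ : ∃ σ : Fin n → Fin s, Function.Injective σ ∧
      ∀ j, σ j ≠ j₀ ∧ ∀ g < d, ∃ t ≤ l (σ j), q (σ j) t ∈ P (p g) := by
    set S : Finset (Fin s) := Finset.univ.filter fun j =>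
      j ≠ j₀ ∧ ∀ g < d, ∃ t ≤ l j, q j t ∈ P (p g) with hS
    have h1 : Sᶜ ⊆ {j₀} ∪ (Finset.range d).biUnion fun g =>
        Finset.univ.filter fun j => ∀ t ≤ l j, q j t ∉ P (p g) := by
      intro j hj
      simp only [hS, Finset.mem_compl, Finset.mem_filter, Finset.mem_univ, true_and,
        not_and_or, not_not] at hj
      simp only [Finset.mem_union, Finset.mem_singleton, Finset.mem_biUnion, Finset.mem_range,
        Finset.mem_filter, Finset.mem_univ, true_and]
      rcases hj with h | h
      · exact Or.inl h
      · push Not at h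
        exact Or.inr h
    have h2 : ((Finset.range d).biUnion fun g =>
        Finset.univ.filter fun j : Fin s => ∀ t ≤ l j, q j t ∉ P (p g)).card ≤
        (Finset.range d).card * k := by
      refine Finset.card_biUnion_le_card_mul _ _ _ fun g hg => ?_
      have := hT _ (hp g (Finset.mem_range.1 hg)).1
      rw [ncard_eq_toFinset_card'] at this
      simpa using this
    have h3 := (Finset.card_le_card h1).trans (Finset.card_union_le _ _)
    rw [Finset.card_compl, Fintype.card_fin, Finset.card_singleton] at h3
    rw [Finset.card_range] at h2
    have h4 : n ≤ S.card := by omega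
    refine ⟨fun i => S.orderEmbOfCardLe h4 i, fun i j h => by simpa using h, fun j => ?_⟩
    have := S.orderEmbOfCardLe_mem h4 j
    exact (Finset.mem_filter.1 this).2
  have hcl : ∀ j g, j ≠ j₀ → c j g ≤ l j + 1 := by
    intro j g hj
    by_cases h0 : g = 0
    · simp [c, h0]
    by_cases h1 : g < d
    · simp only [c, h0, h1, if_true, if_false]
      have := (hc₀ j g hj (by omega) h1).1
      omega
    · simp [c, h0, h1]
  have hclt : ∀ j, ∀ g < d, c (σ j) g < c (σ j) (g + 1) := by
    intro j g hg
    obtain ⟨t, ht, htP⟩ := (hσ j).2 g hg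
    have := hcpos _ (hσ j).1 g hg t ht htP
    omega
  have hcmono : ∀ j g g', g ≤ g' → g' ≤ d → c (σ j) g ≤ c (σ j) g' := by
    intro j g g' h hd'
    induction g', h using Nat.le_induction with
    | base => exact le_rfl
    | succ m hm ih => exact (ih (by omega)).trans (hclt j m (by omega)).le
  have hmem : ∀ j g, g < d → ∀ t ∈ Icc (c (σ j) g) (c (σ j) (g + 1) - 1), t ≤ l (σ j) ∧
      c (σ j) g ≤ t ∧ t < c (σ j) (g + 1) := by
    intro j g hg t ht
    have h1 := hcl (σ j) (g + 1) (hσ j).1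
    have h2 := hclt j g hg
    obtain ⟨h3, h4⟩ := ht
    omega
  refine ⟨fun j g => q (σ j) '' Icc (c (σ j) g) (c (σ j) (g + 1) - 1), fun g => P (p g),
    ?_, fun g _ => hP _, ?_, ?_, ?_, ?_, ?_⟩
  · intro j g hg
    have h1 := hclt j g hg
    refine (conn_image_Icc (by omega) fun t h2 h3 => hq.adj _ t ?_).mono hMJ
    have := (hmem j g hg (t + 1) ⟨by omega, by omega⟩).1
    omega
  · intro j g hg
    have h1 := hclt j g (by omega)
    have h2 := hclt j (g + 1) hg
    refine ⟨_, ⟨c (σ j) (g + 1) - 1, ⟨by omega, le_rfl⟩, rfl⟩, _,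
      ⟨c (σ j) (g + 1), ⟨by omega, by omega⟩, rfl⟩, ?_⟩
    have h3 := hcl (σ j) (g + 1 + 1) (hσ j).1
    have h4 := hq.adj (σ j) (c (σ j) (g + 1) - 1) (by omega)
    rw [Nat.sub_add_cancel (by omega)] at h4
    exact hMJ h4
  · intro j j' g g' hg hg' hne
    rw [Set.disjoint_left]
    rintro _ ⟨t, ht, rfl⟩ ⟨t', ht', h⟩
    have h1 := hmem j g hg t ht
    have h2 := hmem j' g' hg' t' ht'
    obtain ⟨h3, rfl⟩ := hq.inj _ _ _ _ h2.1 h1.1 h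
    have h4 := hσinj h3
    subst h4
    apply hne
    have : g = g' := by
      by_contra hgg
      rcases Nat.lt_or_gt_of_ne hgg with h | h
      · have := hcmono j' (g + 1) g' h (by omega)
        omega
      · have := hcmono j' (g' + 1) g h (by omega)
        omega
    rw [this]
  · intro g g' hg hg' hne
    refine hPd _ _ fun h => ?_
    wlog hlt : g < g' generalizing g g'
    · exact this g' g hg' hg hne.symm h.symm (by omega)
    have h1 := (hp g hg).2.2.2 g' hlt hg'
    have h2 := (hp g' hg').2.2.1 g' (by omega) le_rfl
    obtain ⟨v, hv⟩ := (hP (p g)).1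
    exact Set.disjoint_left.1 h2 (h ▸ hv) (h1 hv)
  · intro j g hg
    obtain ⟨t, ht, htP⟩ := (hσ j).2 g hg
    have := hcpos _ (hσ j).1 g hg t ht htP
    exact ⟨_, htP, t, ⟨this.1, by omega⟩, rfl⟩
  · intro j g g' hg hg' hne
    rw [Set.disjoint_left]
    rintro _ hv ⟨t, ht, rfl⟩
    have h1 := hmem j g' hg' t ht
    have h2 := hcpos _ (hσ j).1 g hg t h1.1 hv
    rcases Nat.lt_or_gt_of_ne hne with h | h
    · have := hcmono j (g + 1) g' h (by omega)
      omega
    · have := hcmono j (g' + 1) g h (by omega)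
      omega

end Crossing

section Iteration

universe w

lemma HasCrossbar.mono {V : Type*} {J J' : SimpleGraph V} {n d : ℕ} (h : HasCrossbar J n d)
    (hJ : J ≤ J') : HasCrossbar J' n d := by
  obtain ⟨q, P, h1, h2, h3, h4, h5, h6, h7⟩ := h
  refine ⟨q, P, fun j i hi => (h1 j i hi).mono hJ, fun i hi => (h2 i hi).mono hJ, ?_,
    h4, h5, h6, h7⟩
  intro j i hi
  obtain ⟨x, hx, y, hy, hxy⟩ := h3 j i hi
  exact ⟨x, hx, y, hy, hJ hxy⟩

lemma exists_minimal_linked {V : Type*} [Finite V] {H J : SimpleGraph V} {A B : Set V} {s : ℕ}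
    (hHJ : H ≤ J) (h : Linked J A B s) :
    ∃ M, H ≤ M ∧ M ≤ J ∧ Linked M A B s ∧ ∀ N < M, H ≤ N → ¬ Linked N A B s := by
  obtain ⟨M, ⟨h1, h2, h3⟩, h4⟩ := (wellFounded_lt (α := SimpleGraph V)).has_min
    {M | H ≤ M ∧ M ≤ J ∧ Linked M A B s} ⟨J, hHJ, le_rfl, h⟩
  exact ⟨M, h1, h2, h3, fun N hN hHN hl => h4 N ⟨hHN, hN.le.trans h2, hl⟩ hN⟩

/-- The edges of `J` with both ends outside `P`. -/
def avoiding {V : Type*} (J : SimpleGraph V) (P : Set V) : SimpleGraph V where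
  Adj u v := J.Adj u v ∧ u ∉ P ∧ v ∉ P
  symm := ⟨fun _ _ h => ⟨h.1.symm, h.2.2, h.2.1⟩⟩
  loopless := ⟨fun _ h => h.1.ne rfl⟩

lemma avoiding_le {V : Type*} (J : SimpleGraph V) (P : Set V) : avoiding J P ≤ J :=
  fun _ _ h => h.1

lemma Conn.disjoint_of_avoiding {V : Type*} {J : SimpleGraph V} {P C : Set V}
    (h : Conn (avoiding J P) C) (hne : (C \ P).Nonempty) : Disjoint C P := by
  obtain ⟨x, hx, hxP⟩ := hne
  have : C ⊆ Pᶜ := h.subset_of_closed ⟨x, hx, hxP⟩ fun _ _ _ _ _ h => h.2.2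
  exact Set.disjoint_left.2 this

lemma linked_avoiding {V : Type*} {M J : SimpleGraph V} {A B P : Set V} {s k : ℕ}
    {q : Fin s → ℕ → V} {l : Fin s → ℕ} (hMJ : M ≤ J) (hq : IsPathFamily M A B q l)
    (hk : k ≤ {j | ∀ t ≤ l j, q j t ∉ P}.ncard) : Linked (avoiding J P) (A \ P) (B \ P) k := by
  obtain ⟨T, hT, hTk⟩ := exists_subset_card_eq hk
  have e := Finite.equivFinOfCardEq (α := T) (n := k) hTk
  have he : ∀ i, ∀ t ≤ l (e.symm i), q (e.symm i) t ∉ P := fun i => hT (e.symm i).2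
  refine ⟨fun i => q (e.symm i) '' Icc 0 (l (e.symm i)), fun i => ?_, fun i => ?_, fun i => ?_,
    fun i j hij => ?_⟩
  · exact conn_image_Icc (Nat.zero_le _) fun t _ ht =>
      ⟨hMJ (hq.adj _ t ht), he i t ht.le, he i (t + 1) ht⟩
  · exact ⟨_, ⟨0, by simp, rfl⟩, hq.left _, he i 0 (Nat.zero_le _)⟩
  · exact ⟨_, ⟨l (e.symm i), by simp, rfl⟩, hq.right _, he i _ le_rfl⟩
  · rw [Set.disjoint_left]
    rintro _ ⟨t, ht, rfl⟩ ⟨t', ht', h⟩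
    have := (hq.inj _ _ _ _ ht'.2 ht.2 h).1
    exact hij (e.symm.injective (Subtype.ext this)).symm

theorem exists_disjoint_connectors (n d : ℕ) (hd : 0 < d) (m : ℕ) :
    ∃ k : ℕ, ∀ (V : Type w) [Finite V] (J : SimpleGraph V) (A B : Fin m → Set V),
      (∀ e, Linked J (A e) (B e) k) → HasCrossbar J n d ∨
        ∃ C : Fin m → Set V, (∀ e, Conn J (C e)) ∧ (∀ e, (C e ∩ A e).Nonempty) ∧
          (∀ e, (C e ∩ B e).Nonempty) ∧ ∀ e f, e ≠ f → Disjoint (C e) (C f) := by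
  classical
  induction m with
  | zero => exact ⟨0, fun V _ J A B _ => Or.inr ⟨fun _ => ∅, fun e => e.elim0, fun e => e.elim0,
      fun e => e.elim0, fun e => e.elim0⟩⟩
  | succ m ih =>
    obtain ⟨k, hk⟩ := ih
    set s := 1 + d * k + n with hs
    set p := m * (s * (d * (d * s))) + 1 with hp
    refine ⟨max p s, fun V _ J A B hL => ?_⟩
    obtain ⟨P, hPc, hPA, hPB, hPd⟩ := (hL 0).mono (le_max_left p s)
    have hle : insideGraph J P ≤ J := fun _ _ h => h.1
    choose M hM1 hM2 hM3 hM4 using fun f : Fin m =>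
      exists_minimal_linked hle ((hL f.succ).mono (le_max_right p s))
    choose q l hq using fun f => (hM3 f).exists_isPathFamily
    by_cases hi : ∃ i, ∀ f, k ≤ {j | ∀ t ≤ l f j, q f j t ∉ P i}.ncard
    · obtain ⟨i, hi⟩ := hi
      rcases hk V (avoiding J (P i)) (fun f => A f.succ \ P i) (fun f => B f.succ \ P i)
        (fun f => linked_avoiding (hM2 f) (hq f) (hi f)) with h | ⟨C, h1, h2, h3, h4⟩
      · exact Or.inl (h.mono (avoiding_le _ _))
      · right
        have hCP : ∀ f, Disjoint (C f) (P i) := fun f => by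
          obtain ⟨x, hx, -, hxP⟩ := h2 f
          exact (h1 f).disjoint_of_avoiding ⟨x, hx, hxP⟩
        refine ⟨Fin.cons (P i) C, fun e => ?_, fun e => ?_, fun e => ?_, fun e f hef => ?_⟩
        · refine Fin.cases (hPc i) (fun f => (h1 f).mono (avoiding_le _ _)) e
        · refine Fin.cases (hPA i) (fun f => ?_) e
          obtain ⟨x, hx, hxA, -⟩ := h2 f
          exact ⟨x, hx, hxA⟩
        · refine Fin.cases (hPB i) (fun f => ?_) e
          obtain ⟨x, hx, hxA, -⟩ := h3 f
          exact ⟨x, hx, hxA⟩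
        · induction e using Fin.cases with
          | zero =>
            induction f using Fin.cases with
            | zero => exact absurd rfl hef
            | succ f => exact (hCP f).symm
          | succ e =>
            induction f using Fin.cases with
            | zero => exact hCP e
            | succ f => exact h4 e f fun h => hef (h ▸ rfl)
    · left
      push Not at hi
      choose g hg using hi
      obtain ⟨f, -, hf⟩ := Finset.exists_lt_card_fiber_of_mul_lt_card_of_maps_to
        (s := (Finset.univ : Finset (Fin p))) (t := Finset.univ) (f := g)
        (n := s * (d * (d * s))) (fun _ _ => Finset.mem_univ _) (by
          simp only [Finset.card_univ, Fintype.card_fin]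
          omega)
      refine hasCrossbar_of_hits hPc hPd (hM1 f) (hM2 f) (hM4 f) (hq f) hd hs.ge
        (Finset.univ.filter fun i => g i = f) (fun i hi => ?_) hf.le
      have := (Finset.mem_filter.1 hi).2
      subst this
      exact (hg i).le

end Iteration

section Grid

variable {V : Type*} {J : SimpleGraph V}

/-- The vertices that can be reached from `v` in at most `t` steps. -/
def ball (J : SimpleGraph V) (v : V) : ℕ → Set V
  | 0 => {v}
  | t + 1 => ball J v t ∪ ⋃ u ∈ ball J v t, J.neighborSet u

lemma ncard_biUnion_le {ι : Type*} [Finite V] [Finite ι] (S : Set ι) (f : ι → Set V) (k : ℕ)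
    (h : ∀ i ∈ S, (f i).ncard ≤ k) : (⋃ i ∈ S, f i).ncard ≤ S.ncard * k := by
  classical
  have := Finset.card_biUnion_le_card_mul S.toFinite.toFinset (fun i => (f i).toFinite.toFinset) k
    (fun i hi => by
      rw [← ncard_eq_toFinset_card]
      exact h i (by simpa using hi))
  rw [← ncard_eq_toFinset_card] at this
  refine le_trans (le_of_eq ?_) this
  rw [← ncard_coe_finset]
  congr 1
  ext v
  simp

lemma ncard_ball_le [Finite V] {r : ℕ} (hJ : MaxDegreeLE J r) (v : V) (t : ℕ) :
    (ball J v t).ncard ≤ (r + 1) ^ t := by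
  induction t with
  | zero => simp [ball]
  | succ t ih =>
    have h1 := ncard_biUnion_le (ball J v t) J.neighborSet r fun u _ => hJ u
    have h2 := ncard_union_le (ball J v t) (⋃ u ∈ ball J v t, J.neighborSet u)
    calc (ball J v (t + 1)).ncard ≤ (ball J v t).ncard + (ball J v t).ncard * r := by
          rw [ball]
          omega
      _ = (ball J v t).ncard * (r + 1) := by ring
      _ ≤ (r + 1) ^ (t + 1) := by
          rw [pow_succ]
          exact Nat.mul_le_mul_right _ ih

lemma ball_mono {v : V} {s t : ℕ} (h : s ≤ t) : ball J v s ⊆ ball J v t := by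
  induction t, h using Nat.le_induction with
  | base => exact subset_rfl
  | succ t _ ih => exact ih.trans subset_union_left

lemma mem_ball_of_walk {v x : V} (w : J.Walk v x) {t : ℕ} (ht : w.length ≤ t) :
    x ∈ ball J v t := by
  have key : ∀ i ≤ w.length, w.getVert i ∈ ball J v i := by
    intro i
    induction i with
    | zero => simp [ball]
    | succ i ih =>
      intro hi
      exact Or.inr (mem_biUnion (ih (by omega)) (w.adj_getVert_succ hi))
  have := key _ le_rfl
  rw [Walk.getVert_length] at this
  exact ball_mono ht this

/-- A large connected graph has a long path or a vertex of large degree. -/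
lemma exists_path_or_degree [Finite V] (hJ : J.Connected) {r : ℕ} (hr : (r + 1) ^ r < Nat.card V) :
    (∃ (a b : V) (w : J.Walk a b), w.IsPath ∧ r ≤ w.length) ∨
      ∃ v, r ≤ (J.neighborSet v).ncard := by
  classical
  by_contra hno
  push Not at hno
  obtain ⟨h1, h2⟩ := hno
  obtain ⟨v⟩ := hJ.nonempty
  have h3 : ball J v r = univ := by
    refine eq_univ_of_forall fun x => ?_
    obtain ⟨w⟩ := hJ.preconnected v x
    exact mem_ball_of_walk w.bypass (h1 _ _ _ w.bypass_isPath).le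
  have h4 := ncard_ball_le (J := J) (r := r) (fun v => (h2 v).le) v r
  rw [h3, ncard_univ] at h4
  omega

lemma Conn.exists_adjacent_trim {D U U' : Set V} (hD : Conn J D) (hU : (D ∩ U).Nonempty)
    (hU' : (D ∩ U').Nonempty) (hd : Disjoint U U') :
    ∃ E ⊆ D, Conn J E ∧ (E ∩ U).Nonempty ∧ Disjoint E U' ∧ ∃ x ∈ E, ∃ y ∈ U', J.Adj x y := by
  obtain ⟨a, ha, haU⟩ := hU
  have ha' : a ∈ D \ U' := ⟨ha, Set.disjoint_left.1 hd haU⟩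
  have hsub : reachIn J (D \ U') a ⊆ D \ U' := reachIn_subset a
  refine ⟨reachIn J (D \ U') a, hsub.trans sdiff_subset, conn_reachIn ha',
    ⟨a, mem_reachIn_self ha', haU⟩, Set.disjoint_left.2 fun v hv => (hsub hv).2, ?_⟩
  obtain ⟨b, hb, hbU⟩ := hU'
  obtain ⟨x, -, hx, y, hy, hyn, hxy⟩ := hD.exists_adj (reachIn J (D \ U') a)
    ⟨a, ha, mem_reachIn_self ha'⟩ ⟨b, hb, fun h => (hsub h).2 hbU⟩
  refine ⟨x, hx, y, ?_, hxy⟩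
  by_contra hyU
  exact hyn (reachIn_closed hx ⟨hy, hyU⟩ hxy)

/-- Within `Z`, the sets `U j` and `U j'` can be joined while avoiding all others. -/
def joinGraph {ι : Type*} (J : SimpleGraph V) (Z : Set V) (U : ι → Set V) : SimpleGraph ι where
  Adj j j' := j ≠ j' ∧ ∃ D ⊆ Z, Conn J D ∧ (D ∩ U j).Nonempty ∧ (D ∩ U j').Nonempty ∧
    ∀ i, i ≠ j → i ≠ j' → Disjoint D (U i)
  symm := ⟨fun _ _ ⟨hne, D, h1, h2, h3, h4, h5⟩ =>
    ⟨hne.symm, D, h1, h2, h4, h3, fun i hi hi' => h5 i hi' hi⟩⟩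
  loopless := ⟨fun _ h => h.1 rfl⟩

lemma exists_walk_segment {a b : V} (w : J.Walk a b) (P Q : Set V) (ha : a ∈ P) (hb : b ∈ Q) :
    ∃ t₀ t₁, t₀ ≤ t₁ ∧ t₁ ≤ w.length ∧ w.getVert t₀ ∈ P ∧ w.getVert t₁ ∈ Q ∧
      (∀ t < t₁, w.getVert t ∉ Q) ∧ ∀ t, t₀ < t → t ≤ t₁ → w.getVert t ∉ P := by
  classical
  have hex : ∃ t, w.getVert t ∈ Q := ⟨w.length, by simpa using hb⟩
  set t₁ := Nat.find hex with ht₁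
  have h1 : t₁ ≤ w.length := Nat.find_min' hex (by simpa using hb)
  have h0 : w.getVert 0 ∈ P := by simpa using ha
  refine ⟨Nat.findGreatest (fun t => w.getVert t ∈ P) t₁, t₁, Nat.findGreatest_le _, h1,
    Nat.findGreatest_spec (P := fun t => w.getVert t ∈ P) (Nat.zero_le _) h0, Nat.find_spec hex,
    fun t ht => Nat.find_min hex ht, fun t ht ht' => Nat.findGreatest_is_greatest ht ht'⟩

lemma joinGraph_connected {ι : Type*} [Nonempty ι] {Z : Set V} {U : ι → Set V} (hZ : Conn J Z)
    (hU : ∀ j, (U j).Nonempty) (hUZ : ∀ j, U j ⊆ Z) (hd : ∀ i j, i ≠ j → Disjoint (U i) (U j)) :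
    (joinGraph J Z U).Connected := by
  have : Conn (joinGraph J Z U) univ := by
    refine conn_of_closed univ_nonempty fun S hne hS => ?_
    by_contra hSn
    obtain ⟨i, -, hi⟩ := hne
    obtain ⟨j, -, hj⟩ := Set.not_subset.1 hSn
    obtain ⟨a, ha⟩ := hU i
    obtain ⟨b, hb⟩ := hU j
    obtain ⟨w, hw, hwZ⟩ := hZ.exists_walk (hUZ i ha) (hUZ j hb)
    obtain ⟨t₀, t₁, h01, h1, hP, hQ, hnQ, hnP⟩ := exists_walk_segment w (⋃ i ∈ S, U i)
      (⋃ i ∈ Sᶜ, U i) (mem_biUnion hi ha) (mem_biUnion hj hb)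
    obtain ⟨i', hi', hti⟩ := mem_iUnion₂.1 hP
    obtain ⟨j', hj', htj⟩ := mem_iUnion₂.1 hQ
    refine hj' (hS i' (mem_univ _) hi' j' (mem_univ _) ⟨?_, (fun t => w.getVert t) '' Icc t₀ t₁,
      ?_, ?_, ⟨_, ⟨t₀, ⟨le_rfl, h01⟩, rfl⟩, hti⟩, ⟨_, ⟨t₁, ⟨h01, le_rfl⟩, rfl⟩, htj⟩, ?_⟩)
    · rintro rfl
      exact hj' hi'
    · rintro _ ⟨t, ht, rfl⟩
      exact hwZ _ (Walk.getVert_mem_support _ _)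
    · exact conn_image_Icc h01 fun t _ ht => w.adj_getVert_succ (by omega)
    · intro k hki hkj
      rw [Set.disjoint_left]
      rintro _ ⟨t, ⟨ht0, ht1⟩, rfl⟩ hk
      by_cases hkS : k ∈ S
      · have : t = t₀ := by
          by_contra hne
          exact hnP t (by omega) ht1 (mem_biUnion hkS hk)
        subst this
        exact Set.disjoint_left.1 (hd _ _ hki) hk hti
      · have : t = t₁ := by
          by_contra hne
          exact hnQ t (by omega) (mem_biUnion (show k ∈ Sᶜ from hkS) hk)
        subst this
        exact Set.disjoint_left.1 (hd _ _ hkj) hk htj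
  have h := conn_iff_induce.1 this
  exact (induceUnivIso _).connected_iff.1 h

/-- Consecutive members of the tuple `X` can be joined within `Z` while avoiding the other ones. -/
def IsGoodTuple {ι : Type*} {r : ℕ} (J : SimpleGraph V) (Z : Set V) (U : ι → Set V)
    (X : Fin r → ι) : Prop :=
  Function.Injective X ∧ ∀ c c' : Fin r, c.val + 1 = c'.val → ∃ D ⊆ Z, Conn J D ∧
    (D ∩ U (X c)).Nonempty ∧ (D ∩ U (X c')).Nonempty ∧
      ∀ i, i ≠ c → i ≠ c' → Disjoint D (U (X i))

lemma exists_isGoodTuple {ι : Type*} [Finite ι] {Z : Set V} {U : ι → Set V} (hZ : Conn J Z)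
    (hU : ∀ j, Conn J (U j)) (hUZ : ∀ j, U j ⊆ Z) (hd : ∀ i j, i ≠ j → Disjoint (U i) (U j))
    {r : ℕ} (hr : (r + 1) ^ r < Nat.card ι) : ∃ X : Fin r → ι, IsGoodTuple J Z U X := by
  have : Nonempty ι := by
    by_contra h
    rw [not_nonempty_iff] at h
    simp at hr
  rcases exists_path_or_degree (joinGraph_connected hZ (fun j => (hU j).1) hUZ hd) hr with
    ⟨a, b, w, hw, hwr⟩ | ⟨v, hv⟩
  · refine ⟨fun c => w.getVert c, fun c c' h => ?_, fun c c' hcc => ?_⟩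
    · exact Fin.ext (hw.getVert_injOn (by simp; omega) (by simp; omega) h)
    · have hadj := w.adj_getVert_succ (i := c) (by omega)
      rw [hcc] at hadj
      obtain ⟨-, D, h1, h2, h3, h4, h5⟩ := hadj
      have hinj : ∀ i j : Fin r, i ≠ j → w.getVert i ≠ w.getVert j := fun i j hij h =>
        hij (Fin.ext (hw.getVert_injOn (by simp; omega) (by simp; omega) h))
      exact ⟨D, h1, h2, h3, h4, fun i hi hi' => h5 _ (hinj _ _ hi) (hinj _ _ hi')⟩
  · obtain ⟨T, hT, hTr⟩ := exists_subset_card_eq hv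
    have e := Finite.equivFinOfCardEq (α := T) (n := r) hTr
    have hadj : ∀ c, (joinGraph J Z U).Adj v (e.symm c) := fun c => hT (e.symm c).2
    have hinj : ∀ c c', c ≠ c' → (e.symm c : ι) ≠ e.symm c' := fun c c' hcc h =>
      hcc (e.symm.injective (Subtype.ext h))
    refine ⟨fun c => e.symm c, fun c c' h => e.symm.injective (Subtype.ext h), fun c c' hcc => ?_⟩
    obtain ⟨-, D, h1, h2, h3, h4, h5⟩ := hadj c
    obtain ⟨-, D', h1', h2', h3', h4', h5'⟩ := hadj c'
    refine ⟨D ∪ U v ∪ D', union_subset (union_subset h1 (hUZ v)) h1', ?_, ?_, ?_, ?_⟩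
    · refine (h2.union (hU v) h3).union h2' ?_
      obtain ⟨x, hx, hx'⟩ := h3'
      exact ⟨x, Or.inr hx', hx⟩
    · obtain ⟨x, hx, hx'⟩ := h4
      exact ⟨x, Or.inl (Or.inl hx), hx'⟩
    · obtain ⟨x, hx, hx'⟩ := h4'
      exact ⟨x, Or.inr hx, hx'⟩
    · intro i hi hi'
      rw [Set.disjoint_union_left, Set.disjoint_union_left]
      exact ⟨⟨h5 _ (hadj i).1.symm (hinj _ _ hi), hd _ _ (hadj i).1⟩,
        h5' _ (hadj i).1.symm (hinj _ _ hi')⟩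

lemma conn_iUnion_consecutive {q : ℕ → Set V} {a b : ℕ} (hab : a < b)
    (hq : ∀ i, a ≤ i → i < b → Conn J (q i))
    (hadj : ∀ i, a ≤ i → i + 1 < b → ∃ x ∈ q i, ∃ y ∈ q (i + 1), J.Adj x y) :
    Conn J (⋃ i ∈ Ico a b, q i) := by
  induction b, hab using Nat.le_induction with
  | base =>
    have h : (⋃ i ∈ Ico a (a + 1), q i) = q a := by
      have : Ico a (a + 1) = {a} := by
        ext
        simp
        omega
      simp [this]
    rw [h]
    exact hq a le_rfl (Nat.lt_succ_self a)
  | succ b hb ih =>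
    have h : (⋃ i ∈ Ico a (b + 1), q i) = (⋃ i ∈ Ico a b, q i) ∪ q b := by
      have : Ico a (b + 1) = insert b (Ico a b) := by
        ext
        simp
        omega
      rw [this, biUnion_insert, union_comm]
    rw [h]
    obtain ⟨x, hx, y, hy, hxy⟩ := hadj (b - 1) (by omega) (by omega)
    rw [Nat.sub_add_cancel (by omega)] at hy
    exact (ih (fun i h1 h2 => hq i h1 (by omega)) fun i h1 h2 => hadj i h1 (by omega)).union_adj
      (hq b (by omega) (by omega)) (mem_biUnion (show b - 1 ∈ Ico a b from ⟨by omega, by omega⟩) hx)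
      hy hxy

/-- The `r × t` grid. -/
abbrev gridGraph (r t : ℕ) : SimpleGraph (Fin r × Fin t) := pathGraph r □ pathGraph t

lemma IsCrossbar.isMinor_grid {n d r t : ℕ} {q : Fin n → ℕ → Set V} {P : ℕ → Set V}
    (h : IsCrossbar J (d := d) q P) (X : Fin r → Fin n) (θ : Fin (t * r + 1) ↪o ℕ)
    (hθ : ∀ x, θ x < d)
    (hX : ∀ x, IsGoodTuple J (P (θ x) ∪ ⋃ j, q j (θ x)) (fun j => q j (θ x)) X) :
    IsMinor (gridGraph r t) J := by
  classical
  let Z : ℕ → Set V := fun i => P i ∪ ⋃ j, q j i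
  have hZq : ∀ i i' j, i < d → i' < d → i ≠ i' → Disjoint (Z i) (q j i') := by
    intro i i' j hi hi' hne
    simp only [Z, disjoint_union_left, disjoint_iUnion_left]
    exact ⟨h.avoid j i i' hi hi' hne, fun j' => h.disj_seg _ _ _ _ hi hi' (by simp [hne])⟩
  have hZZ : ∀ i i', i < d → i' < d → i ≠ i' → Disjoint (Z i) (Z i') := by
    intro i i' hi hi' hne
    simp only [Z, disjoint_union_right, disjoint_iUnion_right]
    refine ⟨?_, fun j => hZq i i' j hi hi' hne⟩
    simp only [disjoint_union_left, disjoint_iUnion_left]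
    exact ⟨h.disj_vert i i' hi hi' hne, fun j => (h.avoid j i' i hi' hi hne.symm).symm⟩
  have hle : ∀ (b : Fin t) (c : ℕ), c ≤ r → b * r + c < t * r + 1 := by
    intro b c hc
    have := Nat.mul_le_mul_right r (show b.val + 1 ≤ t from b.2)
    rw [add_mul] at this
    omega
  let lay : Fin r × Fin t → ℕ := fun p => θ ⟨p.2 * r + p.1, hle p.2 p.1 p.1.2.le⟩
  have hlay : ∀ p, lay p < d := fun p => hθ _
  let lo : Fin t → ℕ := fun b => θ ⟨b * r + 0, hle b 0 (Nat.zero_le _)⟩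
  let hi : Fin t → ℕ := fun b => θ ⟨b * r + r, hle b r le_rfl⟩
  have hihi : ∀ b, hi b < d := fun b => hθ _
  have hlay_lo : ∀ p, lo p.2 ≤ lay p := fun p => θ.le_iff_le.2 (by simp [Fin.le_def])
  have hlay_hi : ∀ p, lay p < hi p.2 := fun p => θ.lt_iff_lt.2 (by
    rw [Fin.lt_def]
    have := p.1.2
    simp)
  have hnext : ∀ b b' : Fin t, b < b' → hi b ≤ lo b' := fun b b' hbb => θ.le_iff_le.2 (by
    rw [Fin.le_def]
    have := Nat.mul_le_mul_right r (show b.val + 1 ≤ b' from hbb)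
    rw [add_mul] at this
    simp only
    omega)
  have hnext_eq : ∀ b b' : Fin t, b.val + 1 = b' → hi b = lo b' := fun b b' hbb => by
    simp only [hi, lo]
    congr 2
    rw [← hbb]
    ring
  have huniq : ∀ b b' i, i ∈ Ico (lo b) (hi b) → i ∈ Ico (lo b') (hi b') → b = b' := by
    intro b b' i h1 h2
    rcases lt_trichotomy b b' with hlt | heq | hlt
    · have := hnext b b' hlt
      have := h1.2
      have := h2.1
      omega
    · exact heq
    · have := hnext b' b hlt
      have := h2.2
      have := h1.1
      omega
  have hlohi : ∀ (b : Fin t) (c : Fin r), lo b < hi b := fun b c =>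
    (hlay_lo (c, b)).trans_lt (hlay_hi (c, b))
  have hD : ∀ p : Fin r × Fin t, ∃ D ⊆ Z (lay p), (D = ∅ ∨ Conn J D ∧
      (D ∩ q (X p.1) (lay p)).Nonempty) ∧ (∀ c, c ≠ p.1 → Disjoint D (q (X c) (lay p))) ∧
      ∀ c', p.1.val + 1 = c'.val → ∃ x ∈ D, ∃ y ∈ q (X c') (lay p), J.Adj x y := by
    intro p
    by_cases hc : p.1.val + 1 < r
    · obtain ⟨hinj, hg⟩ := hX ⟨p.2 * r + p.1, hle p.2 p.1 p.1.2.le⟩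
      obtain ⟨D, h1, h2, h3, h4, h5⟩ := hg p.1 ⟨p.1.val + 1, hc⟩ rfl
      obtain ⟨E, hE, h6, h7, h8, h9⟩ := h2.exists_adjacent_trim h3 h4
        (h.disj_seg _ _ _ _ (hθ _) (hθ _) (by
          intro heq
          have := congrArg Fin.val (hinj (Prod.ext_iff.1 heq).1)
          simp at this))
      refine ⟨E, hE.trans h1, Or.inr ⟨h6, h7⟩, fun c hcp => ?_, fun c' hc' => ?_⟩
      · by_cases hcc : c = ⟨p.1.val + 1, hc⟩
        · subst hcc
          exact h8
        · exact (h5 c hcp hcc).mono_left hE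
      · have : c' = ⟨p.1.val + 1, hc⟩ := Fin.ext hc'.symm
        subst this
        exact h9
    · refine ⟨∅, empty_subset _, Or.inl rfl, fun _ _ => empty_disjoint _, fun c' hc' => ?_⟩
      have := c'.2
      omega
  choose D hDZ hDc hDd hDa using hD
  have hXinj : Function.Injective X := (hX ⟨0, by omega⟩).1
  let Hor : Fin r × Fin t → Set V := fun p => ⋃ i ∈ Ico (lo p.2) (hi p.2), q (X p.1) i
  have hlt : ∀ b i, i ∈ Ico (lo b) (hi b) → i < d := fun b i hib => hib.2.trans (hihi b)
  have hHor : ∀ p, Conn J (Hor p) := fun p => conn_iUnion_consecutive (hlohi p.2 p.1)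
    (fun i h1 h2 => h.conn_seg _ i (hlt p.2 i ⟨h1, h2⟩))
    fun i h1 h2 => h.adj _ i (hlt p.2 _ ⟨h1.trans (Nat.le_succ i), h2⟩)
  have hHorHor : ∀ p p', p ≠ p' → Disjoint (Hor p) (Hor p') := by
    intro p p' hne
    simp only [Hor, disjoint_iUnion_left, disjoint_iUnion_right]
    intro i hi1 i' hi2
    refine h.disj_seg _ _ _ _ (hlt _ _ hi2) (hlt _ _ hi1) fun heq => hne ?_
    obtain ⟨h1, h2⟩ := Prod.ext_iff.1 heq
    have h2 : i' = i := h2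
    subst h2
    exact Prod.ext (hXinj h1) (huniq _ _ _ hi2 hi1)
  have hHorD : ∀ p p', p ≠ p' → Disjoint (Hor p) (D p') := by
    intro p p' hne
    simp only [Hor, disjoint_iUnion_left]
    intro i hi1
    by_cases hil : i = lay p'
    · subst hil
      refine (hDd p' p.1 fun heq => hne (Prod.ext heq ?_)).symm
      exact huniq _ _ _ hi1 ⟨hlay_lo p', hlay_hi p'⟩
    · exact ((hZq _ _ _ (hlay p') (hlt _ _ hi1) (Ne.symm hil)).mono_left (hDZ p')).symm
  have hDD : ∀ p p', p ≠ p' → Disjoint (D p) (D p') := by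
    intro p p' hne
    refine (hZZ _ _ (hlay p) (hlay p') fun heq => hne ?_).mono (hDZ p) (hDZ p')
    have h2 : p.2 = p'.2 := huniq _ _ _ ⟨hlay_lo p, hlay_hi p⟩
      (by rw [heq]; exact ⟨hlay_lo p', hlay_hi p'⟩)
    have h3 := θ.injective heq
    simp only [Fin.mk.injEq, h2, Nat.add_left_cancel_iff] at h3
    exact Prod.ext (Fin.ext h3) h2
  have hlaymem : ∀ (c : Fin r) p, q (X c) (lay p) ⊆ Hor (c, p.2) := fun c p =>
    subset_biUnion_of_mem (u := fun i => q (X c) i) (show lay p ∈ Ico (lo p.2) (hi p.2) from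
      ⟨hlay_lo p, hlay_hi p⟩)
  have hdir : ∀ p p' : Fin r × Fin t, (p.1.val + 1 = p'.1.val ∧ p.2 = p'.2) ∨
      (p.2.val + 1 = p'.2.val ∧ p.1 = p'.1) →
      ∃ x ∈ Hor p ∪ D p, ∃ y ∈ Hor p' ∪ D p', J.Adj x y := by
    rintro p p' (⟨h1, h2⟩ | ⟨h1, h2⟩)
    · obtain ⟨x, hx, y, hy, hxy⟩ := hDa p p'.1 h1
      refine ⟨x, Or.inr hx, y, Or.inl ?_, hxy⟩
      have := hlaymem p'.1 p hy
      rwa [h2] at this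
    · have h3 := hlohi p.2 p.1
      have h4 := hlohi p'.2 p.1
      have h5 := hnext_eq p.2 p'.2 h1
      have h6 := hihi p.2
      obtain ⟨x, hx, y, hy, hxy⟩ := h.adj (X p.1) (hi p.2 - 1) (by omega)
      rw [Nat.sub_add_cancel (by omega), h2] at hy
      refine ⟨x, Or.inl (mem_biUnion (show hi p.2 - 1 ∈ Ico (lo p.2) (hi p.2) from
        ⟨by omega, by omega⟩) hx), y,
          Or.inl (mem_biUnion (show hi p.2 ∈ Ico (lo p'.2) (hi p'.2) from
        ⟨by omega, by omega⟩) hy), hxy⟩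
  rw [isMinor_iff]
  refine ⟨fun p => Hor p ∪ D p, fun p => ?_, fun p p' hne => ?_, fun p p' hpp => ?_⟩
  · rcases hDc p with h0 | ⟨h1, x, hx, hx'⟩
    · have h1 := hHor p
      simpa only [h0, union_empty] using h1
    · exact (hHor p).union h1 ⟨x, hlaymem p.1 p hx', hx⟩
  · simp only [disjoint_union_left, disjoint_union_right]
    exact ⟨⟨hHorHor _ _ hne, (hHorD _ _ hne.symm).symm⟩, hHorD _ _ hne, hDD _ _ hne⟩
  · rw [boxProd_adj, pathGraph_adj, pathGraph_adj] at hpp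
    have hsymm : (∃ x ∈ Hor p' ∪ D p', ∃ y ∈ Hor p ∪ D p, J.Adj x y) →
        ∃ x ∈ Hor p ∪ D p, ∃ y ∈ Hor p' ∪ D p', J.Adj x y :=
      fun ⟨x, hx, y, hy, hxy⟩ => ⟨y, hy, x, hx, hxy.symm⟩
    rcases hpp with ⟨h1 | h1, h2⟩ | ⟨h1 | h1, h2⟩
    · exact hdir p p' (Or.inl ⟨h1, h2⟩)
    · exact hsymm (hdir p' p (Or.inl ⟨h1, h2.symm⟩))
    · exact hdir p p' (Or.inr ⟨h1, h2⟩)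
    · exact hsymm (hdir p' p (Or.inr ⟨h1, h2.symm⟩))

theorem exists_crossbar_isMinor_grid.{w} (r t : ℕ) : ∃ n d : ℕ, 0 < d ∧
    ∀ (V : Type w) (J : SimpleGraph V), HasCrossbar J n d → IsMinor (gridGraph r t) J := by
  classical
  set n := (r + 1) ^ r + 1 with hn
  refine ⟨n, n ^ r * (t * r + 1), by positivity, fun V J h => ?_⟩
  obtain ⟨q, P, h⟩ := h
  set d := n ^ r * (t * r + 1) with hd
  have hX : ∀ i : Fin d, ∃ X : Fin r → Fin n,
      IsGoodTuple J (P i ∪ ⋃ j, q j i) (fun j => q j i) X := by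
    intro i
    refine exists_isGoodTuple ?_ (fun j => h.conn_seg j i i.2)
      (fun j => (subset_iUnion (fun j => q j i) j).trans subset_union_right)
      (fun j j' hj => h.disj_seg _ _ _ _ i.2 i.2 (by simp [hj])) (by simp [hn])
    refine (h.conn_vert i i.2).union_iUnion fun j => ?_
    exact (h.conn_vert i i.2).union (h.conn_seg j i i.2) (h.meet j i i.2)
  choose X hX using hX
  obtain ⟨Y, -, hY⟩ := Finset.exists_le_card_fiber_of_mul_le_card_of_maps_to
    (s := (Finset.univ : Finset (Fin d))) (t := Finset.univ) (f := X) (n := t * r + 1)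
    (fun _ _ => Finset.mem_univ _) ⟨fun _ => ⟨0, by omega⟩, Finset.mem_univ _⟩ (by
      simp [hd])
  let e := Finset.orderEmbOfCardLe _ hY
  have he : ∀ x, X (e x) = Y := fun x =>
    (Finset.mem_filter.1 (Finset.orderEmbOfCardLe_mem _ hY x)).2
  refine h.isMinor_grid Y (e.trans (Fin.valOrderEmb d)) (fun x => (e x).2) fun x => ?_
  rw [← he x]
  exact hX (e x)

end Grid

section Mesh

variable {V : Type*} {W : Type*} {G : SimpleGraph V}

/-- The vertices of `R` that have a neighbour in `T`. -/
def nbrIn (G : SimpleGraph V) (T R : Set V) : Set V :=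
  {x ∈ R | ∃ y ∈ T, G.Adj y x}

lemma exists_mesh_bound.{w} [Finite W] (H : SimpleGraph W) {r t : ℕ}
    (hH : IsMinor H (gridGraph r t)) : ∃ k : ℕ, ∀ (V : Type w) [Finite V] (G : SimpleGraph V)
      (R : Set V) (T : W → Set V), ¬ IsMinor H G → (∀ w, Conn G (T w)) →
      (∀ w w', w ≠ w' → Disjoint (T w) (T w')) → (∀ w, Disjoint (T w) R) →
      ∃ w w', w ≠ w' ∧ ¬ Linked (avoiding G Rᶜ) (nbrIn G (T w) R) (nbrIn G (T w') R) k := by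
  obtain ⟨n, d, hd, hnd⟩ := exists_crossbar_isMinor_grid.{w} r t
  have e : {p : W × W // p.1 ≠ p.2} ≃ Fin (Nat.card {p : W × W // p.1 ≠ p.2}) := Finite.equivFin _
  obtain ⟨k, hk⟩ := exists_disjoint_connectors.{w} n d hd (Nat.card {p : W × W // p.1 ≠ p.2})
  refine ⟨k, fun V _ G R T hHG hTc hTd hTR => ?_⟩
  by_contra hcon
  push Not at hcon
  rcases hk V (avoiding G Rᶜ) (fun i => nbrIn G (T (e.symm i).1.1) R)
    (fun i => nbrIn G (T (e.symm i).1.2) R) (fun i => hcon _ _ (e.symm i).2) with h | h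
  · exact hHG (isMinor_mono_right (avoiding_le G Rᶜ) (isMinor_trans hH (hnd V _ h)))
  obtain ⟨C, hC, hCA, hCB, hCd⟩ := h
  refine hHG (isMinor_iff.2 ⟨fun w => T w ∪ ⋃ i : {i // (e.symm i).1.1 = w}, C i, fun w => ?_,
    fun w w' hw => ?_, fun w w' hw => ?_⟩)
  · refine (hTc w).union_iUnion fun ⟨i, hi⟩ => ?_
    subst hi
    obtain ⟨x, hx, -, y, hy, hyx⟩ := hCA i
    exact (hTc _).union_adj ((hC i).mono (avoiding_le G Rᶜ)) hy hx hyx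
  · have hCR : ∀ i, C i ⊆ R := fun i => by
      obtain ⟨x, hx, hxR, -⟩ := hCA i
      exact disjoint_compl_right_iff_subset.1
        ((hC i).disjoint_of_avoiding ⟨x, hx, not_not_intro hxR⟩)
    simp only [disjoint_union_left, disjoint_union_right, disjoint_iUnion_left,
      disjoint_iUnion_right]
    refine ⟨⟨hTd w w' hw, fun i => ((hTR w').mono_right (hCR _)).symm⟩,
      fun j => ⟨(hTR w).mono_right (hCR _), fun i => hCd _ _ fun h => hw ?_⟩⟩
    rw [← i.2, ← j.2, h]
  · have hw' : w ≠ w' := hw.ne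
    obtain ⟨x, hx, -, y, hy, hyx⟩ := hCB (e ⟨(w, w'), hw'⟩)
    simp only [Equiv.symm_apply_apply] at hy
    exact ⟨x, Or.inr (mem_iUnion.2 ⟨⟨e ⟨(w, w'), hw'⟩, by simp⟩, hx⟩), y, Or.inl hy, hyx.symm⟩

/-- Deleting one component of `X \ {x}` leaves the rest of `D` connected. -/
lemma Conn.diff_reachIn {D X : Set V} {x y : V} (hX : Conn G X) (hxX : x ∈ X)
    (hD : Conn G (D \ X ∪ {x})) (hXD : X ⊆ D) :
    Conn G (D \ reachIn G (X \ {x}) y) := by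
  have key := hD.union_iUnion (D := fun z : {z // z ∈ X \ {x} ∧ z ∉ reachIn G (X \ {x}) y} =>
    reachIn G (X \ {x}) z) fun ⟨z, hz, _⟩ => by
      obtain ⟨u, huX, hu, v, hv, hvn, huv⟩ := hX.exists_adj (reachIn G (X \ {x}) z)
        ⟨z, hz.1, mem_reachIn_self hz⟩ ⟨x, hxX, fun h => (reachIn_subset _ h).2 rfl⟩
      have hvx : v = x := by
        by_contra hne
        exact hvn (reachIn_closed hu ⟨hv, hne⟩ huv)
      subst hvx
      exact hD.union_adj (conn_reachIn hz) (Or.inr rfl) hu huv.symm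
  convert key using 1
  ext z
  simp only [mem_sdiff, mem_union, mem_singleton_iff, mem_iUnion, Subtype.exists, exists_prop]
  constructor
  · rintro ⟨hz, hzn⟩
    by_cases hzX : z ∈ X
    · by_cases hzx : z = x
      · exact Or.inl (Or.inr hzx)
      · exact Or.inr ⟨z, ⟨⟨hzX, hzx⟩, hzn⟩, mem_reachIn_self ⟨hzX, hzx⟩⟩
    · exact Or.inl (Or.inl ⟨hz, hzX⟩)
  · rintro ((⟨hz, hzX⟩ | rfl) | ⟨u, ⟨-, hun⟩, hzu⟩)
    · exact ⟨hz, fun h => hzX (reachIn_subset _ h).1⟩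
    · exact ⟨hXD hxX, fun h => (reachIn_subset _ h).2 rfl⟩
    · refine ⟨hXD (reachIn_subset _ hzu).1, fun h => hun ?_⟩
      exact reachIn_trans h (reachIn_symm hzu)

lemma Conn.exists_piece [Finite V] {Δ k : ℕ} (hΔ : MaxDegreeLE G Δ) {D S : Set V} (hD : Conn G D)
    (hk : k ≤ (D ∩ S).ncard) : ∃ X ⊆ D, Conn G X ∧ (D \ X = ∅ ∨ Conn G (D \ X)) ∧
      k ≤ (X ∩ S).ncard ∧ (X ∩ S).ncard ≤ Δ * k + 1 := by
  obtain ⟨X, ⟨⟨hXD, hX, hDX, hXk⟩, hmin⟩⟩ := (Set.toFinite {X : Set V | X ⊆ D ∧ Conn G X ∧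
    (D \ X = ∅ ∨ Conn G (D \ X)) ∧ k ≤ (X ∩ S).ncard}).exists_minimal
      ⟨D, subset_rfl, hD, Or.inl (by simp), hk⟩
  refine ⟨X, hXD, hX, hDX, hXk, ?_⟩
  obtain ⟨x, hxX, hDx⟩ : ∃ x ∈ X, Conn G (D \ X ∪ {x}) := by
    rcases hDX with h | h
    · obtain ⟨x, hx⟩ := hX.1
      exact ⟨x, hx, by simpa [h] using conn_singleton x⟩
    · obtain ⟨u, hu, hun, v, hv, hvn, huv⟩ := hD.exists_adj X
        (hX.1.mono fun x hx => ⟨hXD hx, hx⟩) h.1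
      exact ⟨u, hun, h.union_adj (conn_singleton u) ⟨hv, hvn⟩ rfl huv.symm⟩
  have hcomp : ∀ y ∈ G.neighborSet x, (reachIn G (X \ {x}) y ∩ S).ncard ≤ k := by
    intro y _
    by_contra hlt
    push Not at hlt
    have hy : y ∈ X \ {x} := by
      by_contra hy
      have : reachIn G (X \ {x}) y = ∅ :=
        eq_empty_of_forall_notMem fun z hz => hy (left_mem_of_mem_reachIn hz)
      simp [this] at hlt
    have hsub : reachIn G (X \ {x}) y ⊆ X := (reachIn_subset y).trans sdiff_subset
    have := hmin ⟨hsub.trans hXD, conn_reachIn hy,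
      Or.inr (hX.diff_reachIn hxX hDx hXD), hlt.le⟩ hsub
    exact (reachIn_subset _ (this hxX)).2 rfl
  have hcov : X ∩ S ⊆ {x} ∪ ⋃ y ∈ G.neighborSet x, reachIn G (X \ {x}) y ∩ S := by
    rintro z ⟨hzX, hzS⟩
    by_cases hzx : z = x
    · exact Or.inl hzx
    obtain ⟨u, huX, hu, v, hv, hvn, huv⟩ := hX.exists_adj (reachIn G (X \ {x}) z)
        ⟨z, hzX, mem_reachIn_self ⟨hzX, hzx⟩⟩ ⟨x, hxX, fun h => (reachIn_subset _ h).2 rfl⟩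
    have hvx : v = x := by
      by_contra hne
      exact hvn (reachIn_closed hu ⟨hv, hne⟩ huv)
    subst hvx
    exact Or.inr (mem_biUnion huv.symm ⟨reachIn_symm hu, hzS⟩)
  calc (X ∩ S).ncard ≤ _ := ncard_le_ncard hcov
    _ ≤ _ := ncard_union_le _ _
    _ ≤ 1 + (G.neighborSet x).ncard * k := by
      rw [ncard_singleton]
      exact Nat.add_le_add_left (ncard_biUnion_le _ _ k hcomp) 1
    _ ≤ Δ * k + 1 := by
      rw [add_comm]
      exact Nat.add_le_add_right (Nat.mul_le_mul_right _ (hΔ x)) 1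

lemma Conn.exists_pieces [Finite V] {Δ k : ℕ} (hΔ0 : 0 < Δ) (hΔ : MaxDegreeLE G Δ) (S : Set V)
    (n : ℕ)
    {D : Set V} (hD : Conn G D) (hk : n * (Δ * k + 1) ≤ (D ∩ S).ncard) :
    ∃ T : Fin n → Set V, (∀ i, Conn G (T i)) ∧ (∀ i, T i ⊆ D) ∧ (∀ i, k ≤ (T i ∩ S).ncard) ∧
      ∀ i j, i ≠ j → Disjoint (T i) (T j) := by
  induction n generalizing D with
  | zero => exact ⟨fun _ => ∅, fun i => i.elim0, fun i => i.elim0, fun i => i.elim0,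
      fun i => i.elim0⟩
  | succ n ih =>
    have hΔk : k ≤ Δ * k := Nat.le_mul_of_pos_left k hΔ0
    rw [Nat.succ_mul] at hk
    obtain ⟨X, hXD, hX, hDX, hXk, hXk'⟩ := hD.exists_piece (S := S) (k := k) hΔ (by omega)
    have hcard : n * (Δ * k + 1) ≤ ((D \ X) ∩ S).ncard := by
      have h1 : D ∩ S ⊆ (X ∩ S) ∪ ((D \ X) ∩ S) := by
        rintro z ⟨hz, hzS⟩
        by_cases hzX : z ∈ X
        · exact Or.inl ⟨hzX, hzS⟩
        · exact Or.inr ⟨⟨hz, hzX⟩, hzS⟩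
      have h2 := (ncard_le_ncard h1).trans (ncard_union_le _ _)
      omega
    have hT : ∃ T : Fin n → Set V, (∀ i, Conn G (T i)) ∧ (∀ i, T i ⊆ D \ X) ∧
        (∀ i, k ≤ (T i ∩ S).ncard) ∧ ∀ i j, i ≠ j → Disjoint (T i) (T j) := by
      rcases hDX with h | h
      · obtain rfl : n = 0 := by
          simpa [h] using hcard
        exact ⟨fun _ => ∅, fun i => i.elim0, fun i => i.elim0, fun i => i.elim0, fun i => i.elim0⟩
      · exact ih h hcard
    obtain ⟨T, hTc, hTD, hTk, hTd⟩ := hT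
    have hXT : ∀ i, Disjoint X (T i) := fun i =>
      Set.disjoint_left.2 fun z hz hzT => (hTD i hzT).2 hz
    refine ⟨Fin.cons X T, Fin.cases hX hTc, Fin.cases hXD fun i => (hTD i).trans sdiff_subset,
      Fin.cases hXk hTk, ?_⟩
    refine Fin.cases (Fin.cases (by simp) fun j _ => hXT j) fun i =>
      Fin.cases (fun _ => (hXT i).symm) fun j hij => hTd i j fun h => hij (by rw [h])

end Mesh

section Structure

variable {V : Type*} {G : SimpleGraph V} {T₁ T₂ R X A B D S : Set V}

/-- `X` splits `R` into `A` and `B`, where `A` has no neighbours in `T₂` and `B` none in `T₁`. -/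
structure IsCut (G : SimpleGraph V) (T₁ T₂ R X A B : Set V) : Prop where
  cover : ∀ x, x ∈ R ↔ x ∈ A ∨ x ∈ X ∨ x ∈ B
  disjoint_left : Disjoint A X
  disjoint_right : Disjoint B X
  disjoint : Disjoint A B
  not_adj : ∀ x ∈ A, ∀ y ∈ B, ¬ G.Adj x y
  left : ∀ x ∈ A, ∀ y ∈ T₂, ¬ G.Adj x y
  right : ∀ x ∈ B, ∀ y ∈ T₁, ¬ G.Adj x y

lemma IsCut.symm (h : IsCut G T₁ T₂ R X A B) : IsCut G T₂ T₁ R X B A where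
  cover x := by
    rw [h.cover]
    tauto
  disjoint_left := h.disjoint_right
  disjoint_right := h.disjoint_left
  disjoint := h.disjoint.symm
  not_adj x hx y hy hxy := h.not_adj y hy x hx hxy.symm
  left := h.right
  right := h.left

lemma IsCut.conn_of_minimal [Finite V] (h : IsCut G T₁ T₂ R X A B) (hD : Conn G D)
    (hDR : Conn G (D ∪ R)) (hT : T₂ ⊆ D)
    (hmin : ∀ X' A' B', IsCut G T₁ T₂ R X' A' B' → X.ncard ≤ X'.ncard) :
    Conn G (D ∪ (X ∪ B)) := by
  obtain ⟨d, hd⟩ := hD.1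
  set Q := reachIn G (D ∪ (X ∪ B)) d with hQ
  have hDQ : D ⊆ Q := hD.subset_reachIn subset_union_left hd
  have hQc : ∀ x ∈ X ∪ B, ∀ y ∈ Q, G.Adj x y → x ∈ Q := fun x hx y hy hxy =>
    reachIn_closed hy (Or.inr hx) hxy.symm
  have hXR : ∀ x ∈ X ∪ B, x ∈ R := fun x hx => (h.cover x).2 (Or.inr hx)
  have hAX := Set.disjoint_left.1 h.disjoint_left
  have hBX := Set.disjoint_left.1 h.disjoint_right
  have hAB := Set.disjoint_left.1 h.disjoint
  have hcut : IsCut G T₁ T₂ R (X ∩ Q) (A ∪ (X ∪ B) \ Q) (B ∩ Q) := by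
    refine ⟨fun x => ?_, ?_, ?_, ?_, ?_, ?_, fun x hx => h.right x hx.1⟩
    · rw [h.cover]
      simp only [mem_union, mem_sdiff, mem_inter_iff]
      tauto
    · rw [Set.disjoint_left]
      rintro x (hx | hx) ⟨hx1, hx2⟩
      · exact hAX hx hx1
      · exact hx.2 hx2
    · exact h.disjoint_right.mono inter_subset_left inter_subset_left
    · rw [Set.disjoint_left]
      rintro x (hx | hx) ⟨hx1, hx2⟩
      · exact hAB hx hx1
      · exact hx.2 hx2
    · rintro x (hx | hx) y ⟨hy, hyQ⟩ hxy
      · exact h.not_adj x hx y hy hxy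
      · exact hx.2 (hQc x hx.1 y hyQ hxy)
    · rintro x (hx | hx) y hy hxy
      · exact h.left x hx y hy hxy
      · exact hx.2 (hQc x hx.1 y (hDQ (hT hy)) hxy)
  have hXQ : X ⊆ Q := by
    have := eq_of_subset_of_ncard_le inter_subset_left (hmin _ _ _ hcut)
    exact this ▸ inter_subset_right
  have hall : X ∪ B ⊆ Q := by
    by_contra hne
    obtain ⟨x, hx, hxQ⟩ := not_subset.1 hne
    have := hDR.subset_of_closed (P := (X ∪ B) \ Q) ⟨x, Or.inr (hXR x hx), hx, hxQ⟩ ?_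
      (Or.inl hd)
    · exact this.2 (hDQ hd)
    rintro u - ⟨hu, huQ⟩ v hv huv
    have huB : u ∈ B := hu.resolve_left fun h => huQ (hXQ h)
    have hvQ : v ∉ Q := fun hv => huQ (hQc u hu v hv huv)
    refine ⟨?_, hvQ⟩
    rcases hv with hv | hv
    · exact absurd (hDQ hv) hvQ
    rcases (h.cover v).1 hv with hv | hv
    · exact absurd huv.symm (h.not_adj v hv u huB)
    · exact hv
  have : D ∪ (X ∪ B) = Q := subset_antisymm (union_subset hDQ hall) (reachIn_subset d)
  rw [this]
  exact conn_reachIn (Or.inl hd)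

lemma exists_isCut_of_separates {X₀ : Set V}
    (h : Separates (avoiding G Rᶜ) (nbrIn G T₁ R) (nbrIn G T₂ R) X₀) :
    ∃ A B, IsCut G T₁ T₂ R (X₀ ∩ R) A B := by
  refine ⟨{x | ∃ u ∈ nbrIn G T₁ R, x ∈ reachIn G (R \ X₀) u},
    {x | x ∈ R \ X₀ ∧ ¬ ∃ u ∈ nbrIn G T₁ R, x ∈ reachIn G (R \ X₀) u}, ?_, ?_, ?_, ?_, ?_, ?_, ?_⟩
  · intro x
    have : (∃ u ∈ nbrIn G T₁ R, x ∈ reachIn G (R \ X₀) u) → x ∈ R ∧ x ∉ X₀ :=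
      fun ⟨u, _, hx⟩ => reachIn_subset u hx
    simp only [mem_ofPred_eq, mem_inter_iff, mem_sdiff]
    by_cases h1 : ∃ u ∈ nbrIn G T₁ R, x ∈ reachIn G (R \ X₀) u
    · simp [h1, (this h1).1]
    · simp only [h1, not_false_eq_true, and_true, false_or]
      tauto
  · exact Set.disjoint_left.2 fun x ⟨u, _, hx⟩ hX => (reachIn_subset u hx).2 hX.1
  · exact Set.disjoint_left.2 fun x hx hX => hx.1.2 hX.1
  · exact Set.disjoint_left.2 fun x hx hX => hX.2 hx
  · rintro x ⟨u, hu, hx⟩ y ⟨hy, hyn⟩ hxy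
    exact hyn ⟨u, hu, reachIn_closed hx hy hxy⟩
  · rintro x ⟨u, hu, hx⟩ y hy hxy
    have hu' := left_mem_of_mem_reachIn hx
    have hsub := reachIn_subset (G := G) (B := R \ X₀) u
    have hc : Conn (avoiding G Rᶜ) (reachIn G (R \ X₀) u) :=
      (conn_reachIn hu').mono_adj fun a ha b hb hab =>
        ⟨hab, not_not_intro (hsub ha).1, not_not_intro (hsub hb).1⟩
    obtain ⟨z, hz, hzX⟩ := h _ hc ⟨u, mem_reachIn_self hu', hu⟩
      ⟨x, hx, (hsub hx).1, y, hy, hxy.symm⟩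
    exact (hsub hz).2 hzX
  · rintro x ⟨hx, hxn⟩ y hy hxy
    exact hxn ⟨x, ⟨hx.1, y, hy, hxy.symm⟩, mem_reachIn_self hx⟩

/-- Two addresses are equal or one is the parent of the other. -/
def TreeAdj (l l' : List ℕ) : Prop :=
  l = l' ∨ (∃ a, l = a :: l') ∨ ∃ a, l' = a :: l

lemma TreeAdj.map {l l' : List ℕ} (h : TreeAdj l l') (f : ℕ → ℕ) :
    TreeAdj (l.map f) (l'.map f) := by
  rcases h with rfl | ⟨a, rfl⟩ | ⟨a, rfl⟩
  · exact Or.inl rfl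
  · exact Or.inr (Or.inl ⟨f a, rfl⟩)
  · exact Or.inr (Or.inr ⟨f a, rfl⟩)

lemma TreeAdj.symm {l l' : List ℕ} (h : TreeAdj l l') : TreeAdj l' l := by
  rcases h with h | h | h
  · exact Or.inl h.symm
  · exact Or.inr (Or.inr h)
  · exact Or.inr (Or.inl h)

lemma TreeAdj.append {l l' : List ℕ} (h : TreeAdj l l') (s : List ℕ) :
    TreeAdj (l ++ s) (l' ++ s) := by
  rcases h with rfl | ⟨a, rfl⟩ | ⟨a, rfl⟩
  · exact Or.inl rfl
  · exact Or.inr (Or.inl ⟨a, rfl⟩)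
  · exact Or.inr (Or.inr ⟨a, rfl⟩)

/-- `b` is a tree-partition of `R ∪ S` with all of `S` in the root bag, with the root bag of size
at most `r` and all other bags of size at most `M`. -/
structure IsTreePartition (G : SimpleGraph V) (R S : Set V) (r M : ℕ) (b : V → List ℕ) :
    Prop where
  root : ∀ x ∈ S, b x = []
  adj : ∀ x ∈ R, ∀ y ∈ R ∪ S, G.Adj x y → TreeAdj (b x) (b y)
  card_root : {x ∈ R ∪ S | b x = []}.ncard ≤ r
  card_bag : ∀ l ≠ [], {x ∈ R ∪ S | b x = l}.ncard ≤ M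

lemma isTreePartition_empty {r M : ℕ} (h : S.ncard ≤ r) :
    IsTreePartition G ∅ S r M fun _ => [] where
  root _ _ := rfl
  adj x hx := absurd hx (notMem_empty x)
  card_root := by simpa using h
  card_bag l hl := by
    have : {x ∈ ∅ ∪ S | ([] : List ℕ) = l} = ∅ := by
      ext x
      simp [hl.symm]
    rw [this]
    simp

lemma IsTreePartition.push [Finite V] {N : Set V} {b : V → List ℕ} {r r' M : ℕ}
    (h : IsTreePartition G (R \ N) N r M b) (hRS : Disjoint R S) (hrM : r ≤ M) (hS : S.ncard ≤ r')
    (hN : ∀ x ∈ R, x ∉ N → ∀ y ∈ S, ¬ G.Adj x y) (hNR : N ⊆ R) :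
    ∃ b', IsTreePartition G R S r' M b' := by
  classical
  have hRS' := Set.disjoint_left.1 hRS
  refine ⟨fun x => if x ∈ S then [] else b x ++ [0], fun x hx => if_pos hx, ?_, ?_, ?_⟩
  · intro x hx y hy hxy
    have hxS : x ∉ S := hRS' hx
    simp only [if_neg hxS]
    by_cases hyS : y ∈ S
    · rw [if_pos hyS]
      by_cases hxN : x ∈ N
      · rw [h.root x hxN]
        exact Or.inr (Or.inl ⟨0, rfl⟩)
      · exact absurd hxy (hN x hx hxN y hyS)
    · rw [if_neg hyS]
      have hyR : y ∈ R := hy.resolve_right hyS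
      by_cases hxN : x ∈ N
      · by_cases hyN : y ∈ N
        · rw [h.root x hxN, h.root y hyN]
          exact Or.inl rfl
        · exact (h.adj y ⟨hyR, hyN⟩ x (Or.inr hxN) hxy.symm).symm.append _
      · refine (h.adj x ⟨hx, hxN⟩ y ?_ hxy).append _
        by_cases hyN : y ∈ N
        · exact Or.inr hyN
        · exact Or.inl ⟨hyR, hyN⟩
  · refine (ncard_le_ncard fun x hx => ?_).trans hS
    by_contra hxS
    simp [hxS] at hx
  · intro l hl
    have hsub : ∀ x ∈ {x ∈ R ∪ S | (if x ∈ S then [] else b x ++ [0]) = l},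
        x ∈ R \ N ∪ N ∧ b x ++ [0] = l := by
      rintro x ⟨hx, hxl⟩
      by_cases hxS : x ∈ S
      · rw [if_pos hxS] at hxl
        exact absurd hxl.symm hl
      · rw [if_neg hxS] at hxl
        exact ⟨by simpa [sdiff_union_of_subset hNR] using hx.resolve_right hxS, hxl⟩
    by_cases hl0 : ∃ m, l = m ++ [0]
    · obtain ⟨m, rfl⟩ := hl0
      by_cases hm : m = []
      · refine (ncard_le_ncard fun x hx => ?_).trans (h.card_root.trans hrM)
        obtain ⟨h1, h2⟩ := hsub x hx
        exact ⟨h1, by simpa [hm] using h2⟩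
      · refine (ncard_le_ncard fun x hx => ?_).trans (h.card_bag m hm)
        obtain ⟨h1, h2⟩ := hsub x hx
        exact ⟨h1, by simpa using h2⟩
    · have : {x ∈ R ∪ S | (if x ∈ S then [] else b x ++ [0]) = l} = ∅ :=
        eq_empty_of_forall_notMem fun x hx => hl0 ⟨_, (hsub x hx).2.symm⟩
      rw [this]
      simp

lemma IsTreePartition.merge [Finite V] {S₁ S₂ : Set V} {b₁ b₂ : V → List ℕ} {r r' M : ℕ}
    (h₁ : IsTreePartition G A S₁ r M b₁) (h₂ : IsTreePartition G B S₂ r M b₂)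
    (hRS : Disjoint R S) (hc : IsCut G T₁ T₂ R X A B) (hXS₁ : X ⊆ S₁) (hXS₂ : X ⊆ S₂)
    (hS : S ⊆ S₁ ∪ S₂) (hS₁ : S₁ ⊆ S ∪ X) (hS₂ : S₂ ⊆ S ∪ X)
    (hA : ∀ x ∈ A, ∀ y ∈ S, G.Adj x y → y ∈ S₁) (hB : ∀ x ∈ B, ∀ y ∈ S, G.Adj x y → y ∈ S₂)
    (hr : 2 * r ≤ r') : ∃ b, IsTreePartition G R S r' M b := by
  classical
  have hRS' := Set.disjoint_left.1 hRS
  have hAX := Set.disjoint_left.1 hc.disjoint_left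
  have hBX := Set.disjoint_left.1 hc.disjoint_right
  have hAB := Set.disjoint_left.1 hc.disjoint
  have hAR : ∀ x ∈ A, x ∈ R := fun x hx => (hc.cover x).2 (Or.inl hx)
  have hBR : ∀ x ∈ B, x ∈ R := fun x hx => (hc.cover x).2 (Or.inr (Or.inr hx))
  set b : V → List ℕ := fun x => if x ∈ A then (b₁ x).map (2 * ·) else
    if x ∈ B then (b₂ x).map (2 * · + 1) else [] with hb
  have hbA : ∀ x ∈ A, b x = (b₁ x).map (2 * ·) := fun x hx => if_pos hx
  have hbB : ∀ x ∈ B, b x = (b₂ x).map (2 * · + 1) := fun x hx => by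
    simp only [hb, if_neg (fun h => hAB h hx), if_pos hx]
  have hbS : ∀ x ∈ S ∪ X, b x = [] := by
    intro x hx
    have h1 : x ∉ A := fun h => hx.elim (hRS' (hAR x h)) (hAX h)
    have h2 : x ∉ B := fun h => hx.elim (hRS' (hBR x h)) (hBX h)
    simp only [hb, if_neg h1, if_neg h2]
  have hbA' : ∀ x ∈ A ∪ S₁, b x = (b₁ x).map (2 * ·) := by
    rintro x (hx | hx)
    · exact hbA x hx
    · rw [hbS x (hS₁ hx), h₁.root x hx, List.map_nil]
  have hbB' : ∀ x ∈ B ∪ S₂, b x = (b₂ x).map (2 * · + 1) := by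
    rintro x (hx | hx)
    · exact hbB x hx
    · rw [hbS x (hS₂ hx), h₂.root x hx, List.map_nil]
  have hadjA : ∀ x ∈ A, ∀ y ∈ R ∪ S, G.Adj x y → TreeAdj (b x) (b y) := by
    intro x hx y hy hxy
    have hy' : y ∈ A ∪ S₁ := by
      rcases hy with hy | hy
      · rcases (hc.cover y).1 hy with hy | hy | hy
        · exact Or.inl hy
        · exact Or.inr (hXS₁ hy)
        · exact absurd hxy (hc.not_adj x hx y hy)
      · exact Or.inr (hA x hx y hy hxy)
    rw [hbA x hx, hbA' y hy']
    exact (h₁.adj x hx y hy' hxy).map _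
  have hadjB : ∀ x ∈ B, ∀ y ∈ R ∪ S, G.Adj x y → TreeAdj (b x) (b y) := by
    intro x hx y hy hxy
    have hy' : y ∈ B ∪ S₂ := by
      rcases hy with hy | hy
      · rcases (hc.cover y).1 hy with hy | hy | hy
        · exact absurd hxy.symm (hc.not_adj y hy x hx)
        · exact Or.inr (hXS₂ hy)
        · exact Or.inl hy
      · exact Or.inr (hB x hx y hy hxy)
    rw [hbB x hx, hbB' y hy']
    exact (h₂.adj x hx y hy' hxy).map _
  have hcov : ∀ x ∈ R ∪ S, x ∈ A ∨ x ∈ B ∨ x ∈ S ∪ X := by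
    rintro x (hx | hx)
    · rcases (hc.cover x).1 hx with hx | hx | hx
      · exact Or.inl hx
      · exact Or.inr (Or.inr (Or.inr hx))
      · exact Or.inr (Or.inl hx)
    · exact Or.inr (Or.inr (Or.inl hx))
  refine ⟨b, fun x hx => hbS x (Or.inl hx), ?_, ?_, ?_⟩
  · intro x hx y hy hxy
    rcases (hc.cover x).1 hx with hxA | hxX | hxB
    · exact hadjA x hxA y hy hxy
    · rcases hcov y hy with hyA | hyB | hyS
      · exact (hadjA y hyA x (Or.inl hx) hxy.symm).symm
      · exact (hadjB y hyB x (Or.inl hx) hxy.symm).symm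
      · rw [hbS x (Or.inr hxX), hbS y hyS]
        exact Or.inl rfl
    · exact hadjB x hxB y hy hxy
  · have hsub : {x ∈ R ∪ S | b x = []} ⊆ {x ∈ A ∪ S₁ | b₁ x = []} ∪ {x ∈ B ∪ S₂ | b₂ x = []} := by
      rintro x ⟨hx, hxb⟩
      have h1 : x ∈ A ∪ S₁ ∨ x ∈ B ∪ S₂ := by
        rcases hcov x hx with h | h | h | h
        · exact Or.inl (Or.inl h)
        · exact Or.inr (Or.inl h)
        · exact (hS h).imp Or.inr Or.inr
        · exact Or.inl (Or.inr (hXS₁ h))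
      rcases h1 with h | h
      · rw [hbA' x h] at hxb
        exact Or.inl ⟨h, by simpa using hxb⟩
      · rw [hbB' x h] at hxb
        exact Or.inr ⟨h, by simpa using hxb⟩
    have := (ncard_le_ncard hsub).trans (ncard_union_le _ _)
    have h1 := h₁.card_root
    have h2 := h₂.card_root
    omega
  · intro l hl
    have hodd : ∀ m m' : List ℕ, m.map (2 * ·) = m'.map (2 * · + 1) → m = [] := by
      rintro (_ | ⟨a, m⟩) (_ | ⟨a', m'⟩) h
      · rfl
      · rfl
      · simp at h
      · simp only [List.map_cons, List.cons.injEq] at h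
        omega
    have hinj0 : Function.Injective fun x : ℕ => 2 * x := fun x y h => by
      simp only at h
      omega
    have hinj1 : Function.Injective fun x : ℕ => 2 * x + 1 := fun x y h => by
      simp only at h
      omega
    by_cases h0 : ∃ m : List ℕ, l = m.map (2 * ·)
    · obtain ⟨m, rfl⟩ := h0
      refine (ncard_le_ncard fun x hx => ?_).trans (h₁.card_bag m fun h => hl (by simp [h]))
      obtain ⟨hx, hxb⟩ := hx
      rcases hcov x hx with h | h | h
      · rw [hbA x h] at hxb
        exact ⟨Or.inl h, hinj0.list_map hxb⟩
      · rw [hbB x h] at hxb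
        exact absurd (by simp [hodd _ _ hxb.symm]) hl
      · rw [hbS x h] at hxb
        exact absurd hxb.symm hl
    by_cases h1 : ∃ m : List ℕ, l = m.map (2 * · + 1)
    · obtain ⟨m, rfl⟩ := h1
      refine (ncard_le_ncard fun x hx => ?_).trans (h₂.card_bag m fun h => hl (by simp [h]))
      obtain ⟨hx, hxb⟩ := hx
      rcases hcov x hx with h | h | h
      · exact absurd ⟨_, ((hbA x h).symm.trans hxb).symm⟩ h0
      · rw [hbB x h] at hxb
        exact ⟨Or.inl h, hinj1.list_map hxb⟩
      · rw [hbS x h] at hxb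
        exact absurd hxb.symm hl
    · have : {x ∈ R ∪ S | b x = l} = ∅ := by
        refine eq_empty_of_forall_notMem fun x ⟨hx, hxb⟩ => ?_
        rcases hcov x hx with h | h | h
        · exact h0 ⟨_, ((hbA x h).symm.trans hxb).symm⟩
        · exact h1 ⟨_, ((hbB x h).symm.trans hxb).symm⟩
        · rw [hbS x h] at hxb
          exact hl hxb.symm
      rw [this]
      simp

end Structure

section Structure

variable {V : Type*} {G : SimpleGraph V}

lemma IsTreePartition.mono {R S : Set V} {r r' M M' : ℕ} {b : V → List ℕ}
    (h : IsTreePartition G R S r M b) (hr : r ≤ r') (hM : M ≤ M') :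
    IsTreePartition G R S r' M' b :=
  ⟨h.root, h.adj, h.card_root.trans hr, fun l hl => (h.card_bag l hl).trans hM⟩

lemma ncard_nbrIn_le [Finite V] {Δ : ℕ} (hΔ : MaxDegreeLE G Δ) (S R : Set V) :
    (nbrIn G S R).ncard ≤ S.ncard * Δ := by
  refine (ncard_le_ncard ?_).trans (ncard_biUnion_le S G.neighborSet Δ fun v _ => hΔ v)
  rintro x ⟨-, y, hy, hyx⟩
  exact mem_biUnion hy hyx

lemma Conn.union_nbrIn {D S R : Set V} (hD : Conn G D) (hS : S ⊆ D) :
    Conn G (D ∪ nbrIn G S R) := by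
  have := hD.union_iUnion (D := fun x : nbrIn G S R => {(x : V)}) fun ⟨x, _, y, hy, hyx⟩ =>
    hD.union_adj (conn_singleton x) (hS hy) rfl hyx
  convert this using 2
  ext x
  simp

theorem exists_isTreePartition {W : Type*} [Finite W] [Finite V] {k Δ M₀ : ℕ} (hΔ0 : 0 < Δ)
    (hΔ : MaxDegreeLE G Δ)
    (hmesh : ∀ (R : Set V) (T : W → Set V), (∀ w, Conn G (T w)) →
      (∀ w w', w ≠ w' → Disjoint (T w) (T w')) → (∀ w, Disjoint (T w) R) →
      ∃ w w', w ≠ w' ∧ ¬ Linked (avoiding G Rᶜ) (nbrIn G (T w) R) (nbrIn G (T w') R) k)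
    (hM₀ : Nat.card W * (Δ * k + 1) < M₀) (N : ℕ) (D R S : Set V) (hN : R.ncard + S.ncard ≤ N)
    (hDR : Disjoint D R) (hD : Conn G D) (hDR' : Conn G (D ∪ R)) (hSD : S ⊆ D)
    (hcl : ∀ x ∈ R, ∀ y, G.Adj x y → y ∈ R ∪ S) (hS : S.ncard ≤ Δ * M₀) :
    ∃ b, IsTreePartition G R S (M₀ * 2 ^ S.ncard) (M₀ * 2 ^ (Δ * M₀)) b := by
  have hpow : ∀ s : ℕ, s ≤ M₀ * 2 ^ s := fun s =>
    Nat.lt_two_pow_self.le.trans (Nat.le_mul_of_pos_left _ (by omega))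
  induction N generalizing D R S with
  | zero =>
    have : R = ∅ := by
      rw [← ncard_eq_zero]
      omega
    subst this
    exact ⟨_, isTreePartition_empty (hpow _)⟩
  | succ N ih =>
  rcases eq_empty_or_nonempty R with rfl | hR
  · exact ⟨_, isTreePartition_empty (hpow _)⟩
  have hDR1 := Set.disjoint_left.1 hDR
  have hRS : Disjoint R S := (hDR.mono_left hSD).symm
  by_cases hsmall : S.ncard ≤ M₀
  · have hNR : nbrIn G S R ⊆ R := fun x hx => hx.1
    have hSne : S.Nonempty := by
      obtain ⟨r, hr⟩ := hR
      obtain ⟨d, hd⟩ := hD.1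
      obtain ⟨x, -, hx, y, hy, hyn, hxy⟩ := hDR'.exists_adj D ⟨d, Or.inl hd, hd⟩
        ⟨r, Or.inr hr, fun h => hDR1 h hr⟩
      exact ⟨x, (hcl y (hy.resolve_left hyn) x hxy.symm).resolve_left (hDR1 hx)⟩
    have h1 : (nbrIn G S R).ncard ≤ Δ * M₀ := by
      have := ncard_nbrIn_le hΔ S R
      nlinarith
    have h2 := ncard_sdiff_add_ncard_of_subset hNR
    have h3 := (ncard_pos (s := S)).2 hSne
    obtain ⟨b, hb⟩ := ih (D ∪ nbrIn G S R) (R \ nbrIn G S R) (nbrIn G S R) (by omega) (by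
        rw [Set.disjoint_left]
        rintro x (hx | hx) ⟨hxR, hxn⟩
        · exact hDR1 hx hxR
        · exact hxn hx) (hD.union_nbrIn hSD) (by
        rwa [union_assoc, union_sdiff_cancel hNR]) subset_union_right (by
        rintro x ⟨hx, hxn⟩ y hxy
        rw [sdiff_union_of_subset hNR]
        exact (hcl x hx y hxy).resolve_right fun hy => hxn ⟨hx, y, hy, hxy.symm⟩) h1
    refine hb.push hRS (Nat.mul_le_mul_left _ (Nat.pow_le_pow_right two_pos h1)) ?_
      (fun x hx hxn y hy hxy => hxn ⟨hx, y, hy, hxy.symm⟩) hNR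
    exact hpow _
  push Not at hsmall
  have e := Finite.equivFin W
  obtain ⟨T, hTc, hTD, hTk, hTd⟩ := hD.exists_pieces hΔ0 hΔ S (Nat.card W) (k := k) (by
    rw [inter_eq_self_of_subset_right hSD]
    omega)
  obtain ⟨w, w', hww, hL⟩ := hmesh R (fun w => T (e w)) (fun w => hTc _)
    (fun w w' h => hTd _ _ fun h' => h (e.injective h')) (fun w => hDR.mono_left (hTD _))
  set T₁ := T (e w) with hT₁
  set T₂ := T (e w') with hT₂
  have hT₁D : T₁ ⊆ D := hTD _
  have hT₂D : T₂ ⊆ D := hTD _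
  have hT₁₂ := Set.disjoint_left.1 (hTd _ _ fun h => hww (e.injective h) : Disjoint T₁ T₂)
  obtain ⟨X₀, hX₀, hX₀s⟩ := (menger k _ _ _).resolve_left hL
  obtain ⟨X, ⟨A, B, hc⟩, hmin⟩ := Set.exists_min_image {X | ∃ A B, IsCut G T₁ T₂ R X A B}
    Set.ncard (Set.toFinite _) ⟨_, exists_isCut_of_separates hX₀s⟩
  have hXk : X.ncard < k :=
    ((hmin _ (exists_isCut_of_separates hX₀s)).trans (ncard_le_ncard
      inter_subset_left)).trans_lt hX₀
  have hAR : A ⊆ R := fun x hx => (hc.cover x).2 (Or.inl hx)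
  have hXR : X ⊆ R := fun x hx => (hc.cover x).2 (Or.inr (Or.inl hx))
  have hBR : B ⊆ R := fun x hx => (hc.cover x).2 (Or.inr (Or.inr hx))
  have hside : ∀ T₁ T₂ A B : Set V, IsCut G T₁ T₂ R X A B → T₂ ⊆ D → k ≤ (T₂ ∩ S).ncard →
      (∀ X' A' B', IsCut G T₁ T₂ R X' A' B' → X.ncard ≤ X'.ncard) →
      ∃ b, IsTreePartition G A (S \ T₂ ∪ X) (M₀ * 2 ^ (S.ncard - 1)) (M₀ * 2 ^ (Δ * M₀)) b := by
    intro T₁ T₂ A B hc hT₂ hTk hmin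
    have hAX := Set.disjoint_left.1 hc.disjoint_left
    have hAB := Set.disjoint_left.1 hc.disjoint
    have hAR : A ⊆ R := fun x hx => (hc.cover x).2 (Or.inl hx)
    have h1 := ncard_inter_add_ncard_sdiff_eq_ncard S T₂
    have h2 := ncard_union_le (S \ T₂) X
    rw [inter_comm] at hTk
    have h3 : A.ncard + X.ncard ≤ R.ncard := by
      rw [← ncard_union_eq hc.disjoint_left]
      exact ncard_le_ncard (union_subset hAR hXR)
    obtain ⟨b, hb⟩ := ih (D ∪ (X ∪ B)) A (S \ T₂ ∪ X) (by omega) (by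
      rw [Set.disjoint_left]
      rintro x (hx | hx | hx) hxA
      · exact hDR1 hx (hAR hxA)
      · exact hAX hxA hx
      · exact hAB hxA hx) (hc.conn_of_minimal hD hDR' hT₂ hmin) (by
      convert hDR' using 1
      ext x
      simp only [mem_union, hc.cover]
      tauto) (by
      rintro x (hx | hx)
      · exact Or.inl (hSD hx.1)
      · exact Or.inr (Or.inl hx)) (by
      intro x hx y hxy
      rcases hcl x (hAR hx) y hxy with hy | hy
      · rcases (hc.cover y).1 hy with hy | hy | hy
        · exact Or.inl hy
        · exact Or.inr (Or.inr hy)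
        · exact absurd hxy (hc.not_adj x hx y hy)
      · exact Or.inr (Or.inl ⟨hy, fun hyT => hc.left x hx y hyT hxy⟩)) (by omega)
    exact ⟨b, hb.mono (Nat.mul_le_mul_left _ (Nat.pow_le_pow_right two_pos (by omega))) le_rfl⟩
  obtain ⟨b₁, hb₁⟩ := hside T₁ T₂ A B hc hT₂D (hTk _) fun X' A' B' h => hmin _ ⟨A', B', h⟩
  obtain ⟨b₂, hb₂⟩ := hside T₂ T₁ B A hc.symm hT₁D (hTk _)
    fun X' A' B' h => hmin _ ⟨B', A', h.symm⟩
  refine hb₁.merge hb₂ hRS hc subset_union_right subset_union_right ?_ ?_ ?_ ?_ ?_ ?_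
  · intro x hx
    by_cases h : x ∈ T₂
    · exact Or.inr (Or.inl ⟨hx, fun h' => hT₁₂ h' h⟩)
    · exact Or.inl (Or.inl ⟨hx, h⟩)
  · exact union_subset_union_left X sdiff_subset
  · exact union_subset_union_left X sdiff_subset
  · exact fun x hx y hy hxy => Or.inl ⟨hy, fun hyT => hc.left x hx y hyT hxy⟩
  · exact fun x hx y hy hxy => Or.inl ⟨hy, fun hyT => hc.right x hx y hyT hxy⟩
  · have : S.ncard = S.ncard - 1 + 1 := by omega
    rw [this, pow_succ]
    simp only [Nat.add_sub_cancel]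
    exact (by ring : 2 * (M₀ * 2 ^ (S.ncard - 1)) = M₀ * (2 ^ (S.ncard - 1) * 2)).le

end Structure

section TreePartition

theorem exists_tree_partition.{w} {W : Type*} [Finite W] (H : SimpleGraph W) {r t : ℕ}
    (hH : IsMinor H (gridGraph r t)) {Δ : ℕ} (hΔ0 : 0 < Δ) :
    ∃ M : ℕ, ∀ (V : Type w) [Finite V] (G : SimpleGraph V), ¬ IsMinor H G → MaxDegreeLE G Δ →
      ∃ b : V → List ℕ, (∀ x y, G.Adj x y → TreeAdj (b x) (b y)) ∧
        ∀ l, {x | b x = l}.ncard ≤ M := by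
  obtain ⟨k, hk⟩ := exists_mesh_bound.{_, w} H hH
  set M₀ := Nat.card W * (Δ * k + 1) + 1 with hM₀
  refine ⟨M₀ * 2 ^ (Δ * M₀), fun V _ G hHG hΔ => ?_⟩
  have h1 : 1 ≤ Δ * M₀ := Nat.mul_pos hΔ0 (by omega)
  have hcomp : ∀ C : G.ConnectedComponent, ∃ b,
      IsTreePartition G (C.supp \ {C.out}) {C.out} (M₀ * 2 ^ 1) (M₀ * 2 ^ (Δ * M₀)) b := by
    intro C
    have hout : C.out ∈ C.supp := C.out_eq
    have hun : {C.out} ∪ C.supp \ {C.out} = C.supp := union_sdiff_cancel (by simpa using hout)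
    have := exists_isTreePartition (G := G) (M₀ := M₀) hΔ0 hΔ (fun R T h1 h2 h3 =>
      hk V G R T hHG h1 h2 h3) (by omega) _ {C.out} (C.supp \ {C.out}) {C.out} le_rfl
      Set.disjoint_sdiff_right (conn_singleton _) (by
        rw [hun, conn_iff_induce]
        exact C.connected_toSimpleGraph) subset_rfl (by
        rintro x ⟨hx, -⟩ y hxy
        rw [union_comm, hun]
        exact (C.mem_supp_congr_adj hxy).1 hx) (by rwa [ncard_singleton])
    rwa [ncard_singleton] at this
  choose b hb using hcomp
  set comp := G.connectedComponentMk with hcompdef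
  obtain ⟨f, hf⟩ : ∃ f : G.ConnectedComponent → ℕ, Function.Injective f :=
    ⟨fun C => (Finite.equivFin _ C : ℕ), fun C C' h => (Finite.equivFin _).injective (Fin.ext h)⟩
  have hmem : ∀ x, x ∈ (comp x).supp \ {(comp x).out} ∪ {(comp x).out} := by
    intro x
    by_cases hx : x = (comp x).out
    · exact Or.inr hx
    · exact Or.inl ⟨rfl, hx⟩
  refine ⟨fun x => b (comp x) x ++ [f (comp x)], fun x y hxy => ?_, fun l => ?_⟩
  · have hc : comp x = comp y := ConnectedComponent.sound hxy.reachable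
    simp only [hc]
    refine TreeAdj.append ?_ _
    have hx := hmem x
    have hy := hmem y
    rw [hc] at hx
    by_cases h : x = (comp y).out
    · have hyR : y ∈ (comp y).supp \ {(comp y).out} := ⟨rfl, fun h' => hxy.ne (h.trans h'.symm)⟩
      exact ((hb _).adj y hyR x hx hxy.symm).symm
    · exact (hb _).adj x (hx.resolve_right h) y hy hxy
  · rcases eq_empty_or_nonempty {x | b (comp x) x ++ [f (comp x)] = l} with h | ⟨x, rfl⟩
    · rw [h]
      simp
    · have hsub : {y | b (comp y) y ++ [f (comp y)] = b (comp x) x ++ [f (comp x)]} ⊆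
          {y ∈ (comp x).supp \ {(comp x).out} ∪ {(comp x).out} | b (comp x) y = b (comp x) x} := by
        intro y hy
        obtain ⟨h1, h2⟩ := List.append_inj' hy rfl
        have h3 : comp y = comp x := hf (by simpa using h2)
        have := hmem y
        rw [h3] at this h1
        exact ⟨this, h1⟩
      refine (ncard_le_ncard hsub).trans ?_
      by_cases h0 : b (comp x) x = []
      · rw [h0]
        exact (hb _).card_root.trans (Nat.mul_le_mul_left _ (Nat.pow_le_pow_right two_pos h1))
      · exact (hb _).card_bag _ h0

end TreePartition

section Coloring

variable {V : Type*} {G : SimpleGraph V}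

lemma exists_constrained_coloring (L : V → Finset ℕ) (hL : ∀ x, (L x).card = 2) (S : Set V)
    (c₀ : V → ℕ) (hc₀ : ∀ x ∈ S, c₀ x ∈ L x) (d : V → ℕ) (ref : V → V) :
    ∃ c : V → ℕ, (∀ x, c x ∈ L x) ∧ (∀ x ∈ S, c x = c₀ x) ∧
      ∀ x ∉ S, d (ref x) < d x → c x ≠ c (ref x) := by
  classical
  have hpick : ∀ (x : V) (i : ℕ), ∃ j ∈ L x, j ≠ i := fun x i =>
    Finset.exists_mem_ne (by rw [hL]; norm_num) i
  choose pick hpick hpick' using hpick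
  let F : (x : V) → ((y : V) → d y < d x → ℕ) → ℕ := fun x rec =>
    if x ∈ S then c₀ x else pick x (if h : d (ref x) < d x then rec (ref x) h else 0)
  let c : V → ℕ := (measure d).wf.fix F
  have hc : ∀ x, c x = F x fun y _ => c y := fun x => (measure d).wf.fix_eq F x
  refine ⟨c, fun x => ?_, fun x hx => ?_, fun x hx hd => ?_⟩
  · rw [hc]
    by_cases hx : x ∈ S
    · simpa [F, hx] using hc₀ x hx
    · simpa [F, hx] using hpick x _
  · rw [hc]
    simp [F, hx]
  · rw [hc]
    simpa [F, hx, hd] using hpick' x (c (ref x))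

lemma exists_last_crossing {f : V → ℕ} (hf : ∀ x y, G.Adj x y → f y ≤ f x + 1) {p : ℕ} {x y : V}
    (w : G.Walk x y) (hx : ∃ v ∈ w.support, f v ≤ p) (hy : p < f y) :
    ∃ (x' y' : V) (w' : G.Walk y' y), G.Adj x' y' ∧ f x' = p ∧ x' ∈ w.support ∧
      ∀ v ∈ w'.support, v ∈ w.support ∧ p < f v := by
  induction w with
  | nil =>
    obtain ⟨v, hv, hvp⟩ := hx
    simp only [Walk.support_nil, List.mem_singleton] at hv
    subst hv
    omega
  | @cons x z y h w ih =>
    by_cases hw : ∃ v ∈ w.support, f v ≤ p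
    · obtain ⟨x', y', w', h1, h2, h3, h4⟩ := ih hw hy
      exact ⟨x', y', w', h1, h2, by simp [h3], fun v hv => ⟨by simp [(h4 v hv).1], (h4 v hv).2⟩⟩
    · push Not at hw
      refine ⟨x, z, w, h, ?_, by simp, fun v hv => ⟨by simp [hv], hw v hv⟩⟩
      obtain ⟨v, hv, hvp⟩ := hx
      rw [Walk.support_cons, List.mem_cons] at hv
      rcases hv with rfl | hv
      · have := hf _ _ h
        have := hw z (by simp)
        omega
      · exact absurd hvp (hw v hv).not_ge

lemma exists_first_visit {f : V → ℕ} (hf : ∀ x y, G.Adj x y → f y ≤ f x + 1) {q : ℕ} {x y : V}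
    (w : G.Walk x y) (hx : f x ≤ q) (hy : q ≤ f y) :
    ∃ (y' : V) (w' : G.Walk x y'), f y' = q ∧ ∀ v ∈ w'.support, v ∈ w.support ∧ f v ≤ q := by
  induction w with
  | nil => exact ⟨_, Walk.nil, le_antisymm hx hy, by simpa using hx⟩
  | @cons x z y h w ih =>
    rcases hx.eq_or_lt with hx' | hx'
    · exact ⟨x, Walk.nil, hx', by simp [hx']⟩
    · have := hf _ _ h
      obtain ⟨y', w', h1, h2⟩ := ih (by omega) hy
      refine ⟨y', Walk.cons h w', h1, fun v hv => ?_⟩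
      rw [Walk.support_cons, List.mem_cons] at hv
      rcases hv with rfl | hv
      · exact ⟨by simp, hx⟩
      · exact ⟨by simp [(h2 v hv).1], (h2 v hv).2⟩

/-- The ancestor of the address `l` at depth `e`. -/
def ancestor (e : ℕ) (l : List ℕ) : List ℕ :=
  l.drop (l.length - e)

lemma ancestor_length (l : List ℕ) : ancestor l.length l = l := by
  simp [ancestor]

lemma TreeAdj.ancestor_eq {e : ℕ} {l l' : List ℕ} (h : TreeAdj l l') (hl : e ≤ l.length)
    (hl' : e ≤ l'.length) : ancestor e l = ancestor e l' := by
  rcases h with rfl | ⟨a, rfl⟩ | ⟨a, rfl⟩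
  · rfl
  · simp only [ancestor, List.length_cons]
    rw [Nat.succ_sub hl', List.drop_succ_cons]
  · simp only [ancestor, List.length_cons]
    rw [Nat.succ_sub hl, List.drop_succ_cons]

lemma TreeAdj.length_le {l l' : List ℕ} (h : TreeAdj l l') : l'.length ≤ l.length + 1 := by
  rcases h with rfl | ⟨a, rfl⟩ | ⟨a, rfl⟩ <;> simp; omega

lemma ancestor_eq_of_walk {b : V → List ℕ} (hb : ∀ x y, G.Adj x y → TreeAdj (b x) (b y)) {e : ℕ}
    {x y : V} (w : G.Walk x y) (hw : ∀ v ∈ w.support, e ≤ (b v).length) :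
    ∀ v ∈ w.support, ancestor e (b v) = ancestor e (b x) := by
  induction w with
  | nil => simp
  | @cons x z y h w ih =>
    intro v hv
    rw [Walk.support_cons, List.mem_cons] at hv
    rcases hv with rfl | hv
    · rfl
    · rw [ih (fun u hu => hw u (by simp [hu])) v hv]
      exact ((hb _ _ h).ancestor_eq (hw x (by simp)) (hw z (by simp))).symm

lemma length_le_of_walk {b : V → List ℕ} (hb : ∀ x y, G.Adj x y → TreeAdj (b x) (b y)) {x y : V}
    (w : G.Walk x y) : (b y).length ≤ (b x).length + w.length := by
  induction w with
  | nil => simp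
  | cons h w ih =>
    have := (hb _ _ h).length_le
    rw [Walk.length_cons]
    omega

end Coloring

section Clustering

variable {V : Type*} {G : SimpleGraph V}

lemma exists_enumeration [Finite V] (T : Set V) {M : ℕ} (hT : T.ncard ≤ M) (v₀ : V) :
    ∃ f : ℕ → V, ∀ z ∈ T, ∃ i < M, f i = z := by
  classical
  have e := Finite.equivFin T
  refine ⟨fun i => if h : i < Nat.card T then e.symm ⟨i, h⟩ else v₀, fun z hz =>
    ⟨e ⟨z, hz⟩, (e ⟨z, hz⟩).2.trans_le hT, ?_⟩⟩
  refine (dif_pos (e ⟨z, hz⟩).2).trans ?_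
  exact congrArg Subtype.val (e.symm_apply_apply ⟨z, hz⟩)

/-- If the reference vertices are chosen band by band, monochromatic walks starting at the depth
of a bag whose vertices serve as references cannot run much deeper. -/
lemma not_deep_walk {b : V → List ℕ} (hb : ∀ x y, G.Adj x y → TreeAdj (b x) (b y))
    {M P e : ℕ} {S : Set V} {c : V → ℕ} {en : List ℕ → ℕ → V}
    (hen : ∀ z, ∃ i < M, en (b z) i = z)
    (hc : ∀ x ∉ S, ∀ i < M, e < (b x).length → (b x).length - 1 - e < M * P →
      ((b x).length - 1 - e) / P = i → (b (en (ancestor e (b x)) i)).length = e →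
      c x ≠ c (en (ancestor e (b x)) i))
    (hP : 2 ≤ P) (hdiam : ∀ x y (w : G.Walk x y), (∀ v ∈ w.support, v ∈ S ∧ c v = c x) →
      (b y).length + 1 < (b x).length + P)
    {u v : V} (w : G.Walk u v) (hw : ∀ z ∈ w.support, c z = c u) (hu : (b u).length ≤ e) :
    (b v).length ≤ e + M * P := by
  by_contra hv
  push Not at hv
  have hf : ∀ x y, G.Adj x y → (b y).length ≤ (b x).length + 1 := fun x y h => (hb x y h).length_le
  obtain ⟨z, y, w₁, hzy, hz, hzw, hw₁⟩ := exists_last_crossing (f := fun x => (b x).length) hf w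
    ⟨u, by simp, hu⟩ (show e < (b v).length by omega)
  obtain ⟨i, hiM, hi⟩ := hen z
  have hiP : i * P + P ≤ M * P := by
    have := Nat.mul_le_mul_right P (show i + 1 ≤ M by omega)
    rwa [Nat.succ_mul] at this
  have hy : (b y).length = e + 1 := by
    have h1 := hf z y hzy
    have h2 := (hw₁ y (by simp)).2
    omega
  have hanc : ∀ x ∈ w₁.support, ancestor e (b x) = b z := by
    intro x hx
    rw [ancestor_eq_of_walk hb w₁ (fun x hx => (hw₁ x hx).2.le) x hx,
      ← (hb z y hzy).ancestor_eq (e := e) (by omega) (by omega), ← hz, ancestor_length]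
  have hsub : ∃ (x' : V) (w₂ : G.Walk x' v), (b x').length = e + 1 + i * P ∧
      ∀ x ∈ w₂.support, x ∈ w₁.support ∧ e + 1 + i * P ≤ (b x).length := by
    obtain ⟨x', y', w₂, h1, h2, h3, h4⟩ := exists_last_crossing (f := fun x => (b x).length) hf
      w₁ (p := e + 1 + i * P) ⟨y, by simp, by omega⟩ (by omega)
    refine ⟨x', Walk.cons h1 w₂, h2, fun x hx => ?_⟩
    rw [Walk.support_cons, List.mem_cons] at hx
    rcases hx with rfl | hx
    · exact ⟨h3, h2.ge⟩
    · exact ⟨(h4 x hx).1, (h4 x hx).2.le⟩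
  obtain ⟨x', w₂, hx', hw₂⟩ := hsub
  obtain ⟨y', w₃, hy', hw₃⟩ := exists_first_visit (f := fun x => (b x).length) hf w₂
    (q := e + i * P + P) (by omega) (by omega)
  have hcw : ∀ x ∈ w₃.support, c x = c u := fun x hx =>
    hw x (hw₁ x (hw₂ x (hw₃ x hx).1).1).1
  have := hdiam x' y' w₃ fun x hx => ⟨by
    by_contra hxS
    have h1 := (hw₂ x (hw₃ x hx).1).2
    have h2 := (hw₃ x hx).2
    refine hc x hxS i hiM (by omega) (by omega) ?_ ?_ ?_
    · rw [Nat.div_eq_iff (by omega)]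
      constructor <;> omega
    · rw [hanc x (hw₂ x (hw₃ x hx).1).1, hi, hz]
    · rw [hanc x (hw₂ x (hw₃ x hx).1).1, hi, hcw x hx, hw z hzw], by
    rw [hcw x hx, hcw x' (by simp)]⟩
  omega

lemma ncard_monoReach_le [Finite V] {b : V → List ℕ}
    (hb : ∀ x y, G.Adj x y → TreeAdj (b x) (b y)) {M Δ Q : ℕ} (hM : ∀ l, {x | b x = l}.ncard ≤ M)
    (hΔ : MaxDegreeLE G Δ) {K : Set V} (hK : Conn G K)
    (hQ : ∀ x ∈ K, ∀ y ∈ K, (b y).length ≤ (b x).length + Q) :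
    K.ncard ≤ (Q + 1) * (M * (Δ * M + 1) ^ Q) := by
  obtain ⟨u, huK, hmin⟩ := Set.exists_min_image K (fun x => (b x).length) (Set.toFinite _) hK.1
  have hf : ∀ x y, G.Adj x y → (b y).length ≤ (b x).length + 1 := fun x y h => (hb x y h).length_le
  have hlev : ∀ j, {x ∈ K | (b x).length = (b u).length + j}.ncard ≤ M * (Δ * M + 1) ^ j := by
    intro j
    induction j with
    | zero =>
      rw [pow_zero, mul_one]
      refine (ncard_le_ncard ?_).trans (hM (b u))
      rintro x ⟨hx, hxl⟩
      obtain ⟨w, -, hw⟩ := hK.exists_walk huK hx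
      have := ancestor_eq_of_walk hb w (fun v hv => hmin v (hw v hv)) x (by simp)
      rw [ancestor_length] at this
      have h2 := ancestor_length (b x)
      rw [hxl, Nat.add_zero, this] at h2
      exact h2.symm
    | succ j ih =>
      have hsub : {x ∈ K | (b x).length = (b u).length + (j + 1)} ⊆
          ⋃ z ∈ {x ∈ K | (b x).length = (b u).length + j}, ⋃ y ∈ G.neighborSet z,
            {x | b x = b y} := by
        rintro x ⟨hx, hxl⟩
        obtain ⟨w, -, hw⟩ := hK.exists_walk huK hx
        obtain ⟨z, y, w', hzy, hz, hzw, hw'⟩ := exists_last_crossing (f := fun x => (b x).length)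
          hf w (p := (b u).length + j) ⟨u, by simp, by omega⟩ (by omega)
        refine mem_biUnion (⟨hw z hzw, hz⟩ : z ∈ {x ∈ K | (b x).length = (b u).length + j})
          (mem_biUnion hzy ?_)
        have h1 := hf z y hzy
        have h2 := (hw' y (by simp)).2
        have h3 := ancestor_eq_of_walk hb w' (e := (b u).length + (j + 1))
          (fun v hv => (hw' v hv).2) x (by simp)
        have h4 := ancestor_length (b x)
        have h5 := ancestor_length (b y)
        rw [show (b y).length = (b u).length + (j + 1) by omega] at h5
        rw [hxl] at h4
        exact h4.symm.trans (h3.trans h5)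
      have h1 : ∀ z ∈ {x ∈ K | (b x).length = (b u).length + j},
          (⋃ y ∈ G.neighborSet z, {x | b x = b y}).ncard ≤ Δ * M := fun z _ =>
        (ncard_biUnion_le _ _ M fun y _ => hM _).trans (Nat.mul_le_mul_right _ (hΔ z))
      calc _ ≤ _ := ncard_le_ncard hsub
        _ ≤ _ := ncard_biUnion_le _ _ _ h1
        _ ≤ (M * (Δ * M + 1) ^ j) * (Δ * M + 1) := Nat.mul_le_mul ih (Nat.le_succ _)
        _ = M * (Δ * M + 1) ^ (j + 1) := by ring
  have hsub : K ⊆ ⋃ j ∈ (univ : Set (Fin (Q + 1))),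
      {x ∈ K | (b x).length = (b u).length + j} := by
    intro x hx
    have h1 := hmin x hx
    have h2 := hQ u huK x hx
    have h1 : (b u).length ≤ (b x).length := h1
    exact mem_biUnion (mem_univ (⟨(b x).length - (b u).length, by omega⟩ : Fin (Q + 1)))
      ⟨hx, by simp only; omega⟩
  calc K.ncard ≤ _ := ncard_le_ncard hsub
    _ ≤ _ := ncard_biUnion_le _ _ (M * (Δ * M + 1) ^ Q) fun j _ => (hlev j).trans
      (Nat.mul_le_mul_left _ (Nat.pow_le_pow_right (Nat.succ_pos _) (by omega)))
    _ = _ := by simp [ncard_univ]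

theorem exists_clustered_extension.{w} (M Δ N₀ : ℕ) : ∃ N : ℕ, 0 < N ∧
    ∀ (V : Type w) [Finite V] (G : SimpleGraph V) (b : V → List ℕ),
      (∀ x y, G.Adj x y → TreeAdj (b x) (b y)) → (∀ l, {x | b x = l}.ncard ≤ M) →
      MaxDegreeLE G Δ → ∀ L : V → Finset ℕ, (∀ x, (L x).card = 2) →
      ∀ (S : Set V) (c₀ : V → ℕ), (∀ x ∈ S, c₀ x ∈ L x) → HasWeakDiamLE G S c₀ N₀ →
      ∃ c : V → ℕ, (∀ x, c x ∈ L x) ∧ (∀ x ∈ S, c x = c₀ x) ∧ HasClusteringLE G Set.univ c N := by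
  set P := N₀ + 2 with hP
  set Q := 2 * (M * P) with hQdef
  refine ⟨(Q + 1) * (M * (Δ * M + 1) ^ Q) + 1, Nat.succ_pos _,
    fun V _ G b hb hM hΔ L hL S c₀ hc₀ hdiam => ?_⟩
  rcases isEmpty_or_nonempty V with hV | ⟨⟨v₀⟩⟩
  · exact ⟨c₀, fun x => isEmptyElim x, fun _ _ => rfl, fun x => isEmptyElim x⟩
  have hM0 : 0 < M :=
    (Nat.lt_of_lt_of_le ((ncard_pos (s := {x | b x = b v₀})).2 ⟨v₀, rfl⟩) (hM (b v₀)))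
  have hMP : 0 < M * P := Nat.mul_pos hM0 (by omega)
  choose en hen using fun l => exists_enumeration _ (hM l) v₀
  obtain ⟨c, hcL, hcS, hc⟩ := exists_constrained_coloring L hL S c₀ hc₀ (fun x => (b x).length)
    (fun x => en (ancestor (M * P * (((b x).length - 1) / (M * P))) (b x))
      (((b x).length - 1) % (M * P) / P))
  refine ⟨c, hcL, hcS, fun a => ?_⟩
  have hwalk : ∀ x y (w : G.Walk x y), (∀ v ∈ w.support, v ∈ S ∧ c v = c x) →
      (b y).length + 1 < (b x).length + P := by
    intro x y w hw
    have h1 : G.dist x y ≤ N₀ := hdiam x y ⟨w, fun v hv => ⟨(hw v hv).1, by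
      rw [← hcS v (hw v hv).1, ← hcS x (hw x (by simp)).1, (hw v hv).2]⟩⟩
    obtain ⟨w', hw'⟩ := w.reachable.exists_walk_length_eq_dist
    have := length_le_of_walk hb w'
    omega
  have hdeep : ∀ (u v : V) (w : G.Walk u v), (∀ z ∈ w.support, c z = c u) →
      (b v).length ≤ (b u).length + Q := by
    intro u v w hw
    set q := ((b u).length + M * P - 1) / (M * P) with hq
    have hq1 : (b u).length ≤ M * P * q := by
      have := Nat.div_add_mod ((b u).length + M * P - 1) (M * P)
      have := Nat.mod_lt ((b u).length + M * P - 1) hMP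
      rw [← hq] at *
      omega
    have hq2 : M * P * q ≤ (b u).length + M * P := by
      have := Nat.mul_div_le ((b u).length + M * P - 1) (M * P)
      rw [← hq] at *
      omega
    have := not_deep_walk hb (e := M * P * q) (S := S) (c := c) (fun z => hen (b z) z rfl)
      (fun x hxS i _ h1 h2 h3 h4 => by
        have h5 : ((b x).length - 1) / (M * P) = q := by
          rw [Nat.div_eq_iff hMP, mul_comm q]
          constructor <;> omega
        have h6 : ((b x).length - 1) % (M * P) = (b x).length - 1 - M * P * q := by
          have := Nat.div_add_mod ((b x).length - 1) (M * P)
          rw [h5] at this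
          omega
        have := hc x hxS
        simp only [h5, h6, h3] at this
        exact this (by omega)) (by omega) hwalk w hw hq1
    omega
  have hK : Conn G (reachIn G {x | c x = c a} a) := conn_reachIn rfl
  have hsub : reachIn G {x | c x = c a} a ⊆ {x | c x = c a} := reachIn_subset a
  have hle := ncard_monoReach_le hb hM hΔ hK (Q := Q) fun x hx y hy => by
    obtain ⟨w, -, hw⟩ := hK.exists_walk hx hy
    refine hdeep x y w fun z hz => ?_
    have h1 : c z = c a := hsub (hw z hz)
    have h2 : c x = c a := hsub hx
    rw [h1, h2]
  refine (ncard_le_ncard ?_).trans (hle.trans (Nat.le_succ _))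
  rintro y ⟨w, hw⟩
  exact ⟨w, fun z hz => (hw z hz).2⟩

end Clustering

section Sweep

variable {V : Type*} {H : SimpleGraph V}

/-- `Sweep H a w U`: the vertices in `U` can be swept one by one from `a`, ending with the
frontier `w`. -/
inductive Sweep (H : SimpleGraph V) (a : V) : List V → Set V → Prop
  | init : Sweep H a [a] {a}
  | dup {A C : List V} {x : V} {U : Set V} :
      Sweep H a (A ++ x :: C) U → Sweep H a (A ++ x :: x :: C) U
  | sublist {w w' : List V} {U : Set V} : Sweep H a w U → w'.Sublist w → Sweep H a w' U
  | cover {A B C : List V} {v : V} {U : Set V} : Sweep H a (A ++ (B ++ C)) U → v ∉ U → B ≠ [] →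
      (∀ u ∈ U, H.Adj u v → u ∈ B) → Sweep H a (A ++ v :: C) (insert v U)

/-- The quarter-plane grid. -/
def plane : SimpleGraph (ℕ × ℕ) :=
  SimpleGraph.fromRel fun p q => (p.1 = q.1 ∧ p.2 + 1 = q.2) ∨ (p.2 = q.2 ∧ p.1 + 1 = q.1)

lemma plane_adj {p q : ℕ × ℕ} : plane.Adj p q ↔
    (p.1 = q.1 ∧ (p.2 + 1 = q.2 ∨ q.2 + 1 = p.2)) ∨
      (p.2 = q.2 ∧ (p.1 + 1 = q.1 ∨ q.1 + 1 = p.1)) := by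
  obtain ⟨a, b⟩ := p
  obtain ⟨c, d⟩ := q
  simp only [plane, fromRel_adj, ne_eq, Prod.mk.injEq]
  omega

/-- The positions with label `v` in the rectangle with rows `0, …, R` and `n` columns. -/
def cell (lab : ℕ × ℕ → V) (R n : ℕ) (v : V) : Set (ℕ × ℕ) :=
  {p | p.1 ≤ R ∧ p.2 < n ∧ lab p = v}

/-- The vertices in `U` are modelled in a rectangle with `w` as a subword of the top row. -/
def Model (H : SimpleGraph V) (w : List V) (U : Set V) : Prop :=
  ∃ (R n : ℕ) (lab : ℕ × ℕ → V) (marks : List ℕ), marks.Pairwise (· < ·) ∧ (∀ m ∈ marks, m < n) ∧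
    marks.map (fun m => lab (R, m)) = w ∧ (∀ p : ℕ × ℕ, p.1 ≤ R → p.2 < n → lab p ∈ U) ∧
    (∀ v ∈ U, Conn plane (cell lab R n v)) ∧
    ∀ u ∈ U, ∀ v ∈ U, H.Adj u v → ∃ p ∈ cell lab R n u, ∃ q ∈ cell lab R n v, plane.Adj p q

lemma model_singleton (a : V) : Model H [a] {a} := by
  refine ⟨0, 1, fun _ => a, [0], by simp, by simp, by simp, by simp, ?_, ?_⟩
  · rintro v rfl
    convert conn_singleton (G := plane) (0, 0)
    ext ⟨x, y⟩
    simp [cell]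
  · rintro u rfl v rfl h
    exact (H.irrefl h).elim

lemma Model.sublist {w w' : List V} {U : Set V} (h : Model H w U) (hw : w'.Sublist w) :
    Model H w' U := by
  obtain ⟨R, n, lab, marks, h1, h2, rfl, h4⟩ := h
  obtain ⟨m', hm', rfl⟩ := List.sublist_map_iff.1 hw
  exact ⟨R, n, lab, m', h1.sublist hm', fun m hm => h2 m (hm'.subset hm), rfl, h4⟩

lemma Model.cover {A B C : List V} {v : V} {U : Set V} (h : Model H (A ++ (B ++ C)) U)
    (hv : v ∉ U) (hB : B ≠ []) (hadj : ∀ u ∈ U, H.Adj u v → u ∈ B) :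
    Model H (A ++ v :: C) (insert v U) := by
  classical
  obtain ⟨R, n, lab, marks, h1, h2, h3, h4, h5, h6⟩ := h
  obtain ⟨mA, m', rfl, rfl, h3'⟩ := List.map_eq_append_iff.1 h3
  obtain ⟨mB, mC, rfl, rfl, rfl⟩ := List.map_eq_append_iff.1 h3'
  have hmB : mB ≠ [] := by simpa using hB
  obtain ⟨i, hi, hile⟩ : ∃ i ∈ mB, ∀ m ∈ mB, i ≤ m := by
    obtain ⟨i, hi, h⟩ := Finset.exists_min_image mB.toFinset id (by simpa using hmB)
    exact ⟨i, by simpa using hi, by simpa using h⟩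
  obtain ⟨j, hj, hjle⟩ : ∃ j ∈ mB, ∀ m ∈ mB, m ≤ j := by
    obtain ⟨i, hi, h⟩ := Finset.exists_max_image mB.toFinset id (by simpa using hmB)
    exact ⟨i, by simpa using hi, by simpa using h⟩
  have hij := hile j hj
  rw [List.pairwise_append, List.pairwise_append] at h1
  obtain ⟨pA, ⟨pB, pC, pBC⟩, pA'⟩ := h1
  have hjn : j < n := h2 j (by simp [hj])
  set lab' : ℕ × ℕ → V := fun p =>
    if p.1 ≤ R then lab p else if i ≤ p.2 ∧ p.2 ≤ j then v else lab (R, p.2) with hlab'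
  have hlow : ∀ u ∈ U, cell lab R n u ⊆ cell lab' (R + 1) n u := by
    rintro u _ p ⟨hp1, hp2, hp3⟩
    exact ⟨by omega, hp2, by simp only [hlab', if_pos hp1, hp3]⟩
  have hcv : ∀ m, i ≤ m → m ≤ j → (R + 1, m) ∈ cell lab' (R + 1) n v := fun m hm1 hm2 =>
    ⟨le_rfl, by simp only; omega, by simp [hlab', hm1, hm2]⟩
  refine ⟨R + 1, n, lab', mA ++ i :: mC, ?_, ?_, ?_, ?_, ?_, ?_⟩
  · rw [List.pairwise_append, List.pairwise_cons]
    refine ⟨pA, ⟨fun m hm => pBC i hi m hm, pC⟩, fun m hm k hk => pA' m hm k ?_⟩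
    simp only [List.mem_cons, List.mem_append] at hk ⊢
    rcases hk with rfl | hk
    · exact Or.inl hi
    · exact Or.inr hk
  · intro m hm
    apply h2
    simp only [List.mem_cons, List.mem_append] at hm ⊢
    rcases hm with hm | rfl | hm
    · exact Or.inl hm
    · exact Or.inr (Or.inl hi)
    · exact Or.inr (Or.inr hm)
  · rw [List.map_append, List.map_cons]
    have hA : ∀ m ∈ mA, lab' (R + 1, m) = lab (R, m) := by
      intro m hm
      have := pA' m hm i (by simp [hi])
      simp only [hlab']
      rw [if_neg (by omega), if_neg (by omega)]
    have hC : ∀ m ∈ mC, lab' (R + 1, m) = lab (R, m) := by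
      intro m hm
      have := pBC j hj m hm
      simp only [hlab']
      rw [if_neg (by omega), if_neg (by omega)]
    rw [List.map_congr_left hA, List.map_congr_left hC, (hcv i le_rfl hij).2.2]
  · intro p hp1 hp2
    simp only [hlab']
    split_ifs with ha hb
    · exact Or.inr (h4 p ha hp2)
    · exact Or.inl rfl
    · exact Or.inr (h4 _ le_rfl hp2)
  · rintro u (rfl | hu)
    · refine conn_of_closed ⟨_, hcv i le_rfl hij⟩ fun P hne hP => ?_
      have hcell : ∀ p ∈ cell lab' (R + 1) n u, p.1 = R + 1 ∧ i ≤ p.2 ∧ p.2 ≤ j := by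
        rintro ⟨p1, p2⟩ ⟨hp1, hp2, hp3⟩
        simp only [hlab'] at hp1 hp2 hp3 ⊢
        split_ifs at hp3 with ha hb
        · exact (hv (hp3 ▸ h4 (p1, p2) ha hp2)).elim
        · exact ⟨by omega, hb⟩
        · exact (hv (hp3 ▸ h4 (R, p2) le_rfl hp2)).elim
      have hup : ∀ k m, i ≤ m → m + k ≤ j → ((R + 1, m) ∈ P ↔ (R + 1, m + k) ∈ P) := by
        intro k
        induction k with
        | zero => simp
        | succ k ih =>
          intro m hm hmj
          rw [ih m hm (by omega)]
          exact ⟨fun h => hP _ (hcv (m + k) (by omega) (by omega)) h _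
              (hcv (m + (k + 1)) (by omega) (by omega)) (by rw [plane_adj]; simp; omega),
            fun h => hP _ (hcv (m + (k + 1)) (by omega) (by omega)) h _
              (hcv (m + k) (by omega) (by omega)) (by rw [plane_adj]; simp; omega)⟩
      have hiff : ∀ p ∈ cell lab' (R + 1) n u, (p ∈ P ↔ (R + 1, i) ∈ P) := by
        rintro ⟨p1, p2⟩ hp
        obtain ⟨rfl, hp2, hp3⟩ := hcell _ hp
        simp only at hp2 hp3
        obtain ⟨k, rfl⟩ := Nat.exists_eq_add_of_le hp2
        exact (hup k i le_rfl hp3).symm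
      obtain ⟨q, hq, hqP⟩ := hne
      exact fun p hp => (hiff p hp).2 ((hiff q hq).1 hqP)
    · have hc := h5 u hu
      refine conn_of_closed (hc.1.mono (hlow u hu)) fun P hne hP => ?_
      have hproj : ∀ p ∈ cell lab' (R + 1) n u, p ∉ cell lab R n u →
          p.1 = R + 1 ∧ (R, p.2) ∈ cell lab R n u := by
        rintro ⟨p1, p2⟩ ⟨hp1, hp2, hp3⟩ hp
        simp only [hlab'] at hp1 hp2 hp3 ⊢
        split_ifs at hp3 with ha hb
        · exact (hp ⟨ha, hp2, hp3⟩).elim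
        · exact (hv (hp3 ▸ hu)).elim
        · exact ⟨by omega, le_rfl, hp2, hp3⟩
      have hPc : (cell lab R n u ∩ P).Nonempty := by
        obtain ⟨p, hp, hpP⟩ := hne
        by_cases hpc : p ∈ cell lab R n u
        · exact ⟨p, hpc, hpP⟩
        · obtain ⟨e, hq⟩ := hproj p hp hpc
          exact ⟨_, hq, hP p hp hpP _ (hlow u hu hq) (by rw [plane_adj]; simp [e])⟩
      have hsub := hc.subset_of_closed hPc fun x hx hxP y hy hxy =>
        hP x (hlow u hu hx) hxP y (hlow u hu hy) hxy
      intro p hp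
      by_cases hpc : p ∈ cell lab R n u
      · exact hsub hpc
      · obtain ⟨e, hq⟩ := hproj p hp hpc
        exact hP _ (hlow u hu hq) (hsub hq) p hp (by rw [plane_adj]; simp [e])
  · have key : ∀ u ∈ U, H.Adj u v → ∃ p ∈ cell lab' (R + 1) n u,
        ∃ q ∈ cell lab' (R + 1) n v, plane.Adj p q := by
      intro u hu huv
      obtain ⟨m, hm, hmu⟩ := List.mem_map.1 (hadj u hu huv)
      refine ⟨(R, m), hlow u hu ⟨le_rfl, h2 m (by simp [hm]), hmu⟩, _,
        hcv m (hile m hm) (hjle m hm), by rw [plane_adj]; simp⟩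
    rintro u (rfl | hu) z (rfl | hz) huz
    · exact (H.irrefl huz).elim
    · obtain ⟨p, hp, q, hq, hpq⟩ := key z hz huz.symm
      exact ⟨q, hq, p, hp, hpq.symm⟩
    · exact key u hu huz
    · obtain ⟨p, hp, q, hq, hpq⟩ := h6 u hu z hz huz
      exact ⟨p, hlow u hu hp, q, hlow z hz hq, hpq⟩

lemma Model.dup {A C : List V} {x : V} {U : Set V} (h : Model H (A ++ x :: C) U) :
    Model H (A ++ x :: x :: C) U := by
  obtain ⟨R, n, lab, marks, h1, h2, h3, h4, h5, h6⟩ := h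
  obtain ⟨mA, m', rfl, rfl, h3'⟩ := List.map_eq_append_iff.1 h3
  obtain ⟨m, mC, rfl, rfl, rfl⟩ := List.map_eq_cons_iff.1 h3'
  rw [List.pairwise_append, List.pairwise_cons] at h1
  obtain ⟨pA, ⟨pm, pC⟩, pA'⟩ := h1
  have hmn : m < n := h2 m (by simp)
  set φ : ℕ × ℕ → ℕ × ℕ := fun p => (p.1, if p.2 ≤ m then p.2 else p.2 - 1) with hφ
  set σ : ℕ × ℕ → ℕ × ℕ := fun p => (p.1, if p.2 ≤ m then p.2 else p.2 + 1) with hσ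
  have hφσ : ∀ p, φ (σ p) = p := by
    rintro ⟨p1, p2⟩
    simp only [hφ, hσ, Prod.mk.injEq, true_and]
    split_ifs <;> omega
  have hφc : ∀ {v : V} {p : ℕ × ℕ}, p ∈ cell (lab ∘ φ) R (n + 1) v ↔ φ p ∈ cell lab R n v := by
    rintro v ⟨p1, p2⟩
    simp only [cell, mem_ofPred_eq, Function.comp, hφ]
    refine and_congr_right fun _ => and_congr_left fun _ => ?_
    split_ifs <;> omega
  have hσc : ∀ {v : V} {p : ℕ × ℕ}, p ∈ cell lab R n v → σ p ∈ cell (lab ∘ φ) R (n + 1) v :=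
    fun {v p} hp => hφc.2 (by rwa [hφσ])
  have hσφ : ∀ p, σ (φ p) = p ∨ plane.Adj (σ (φ p)) p := by
    rintro ⟨p1, p2⟩
    rw [plane_adj]
    simp only [hφ, hσ, Prod.mk.injEq, true_and]
    split_ifs <;> omega
  have hσadj : ∀ p q, plane.Adj p q → plane.Adj (σ p) (σ q) ∨
      ∃ z, (φ z = p ∨ φ z = q) ∧ plane.Adj (σ p) z ∧ plane.Adj z (σ q) := by
    rintro ⟨p1, p2⟩ ⟨q1, q2⟩ h
    by_cases h' : p1 = q1 ∧ (p2 = m ∧ q2 = m + 1 ∨ q2 = m ∧ p2 = m + 1)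
    · right
      refine ⟨(p1, m + 1), ?_⟩
      simp only [plane_adj, hφ, hσ, Prod.mk.injEq, true_and]
      simp only [plane_adj] at h
      split_ifs <;> omega
    · left
      simp only [plane_adj, hσ] at h ⊢
      split_ifs <;> omega
  refine ⟨R, n + 1, lab ∘ φ, mA ++ m :: (m + 1) :: mC.map (· + 1), ?_, ?_, ?_, ?_, ?_, ?_⟩
  · simp only [List.pairwise_append, List.pairwise_cons, List.pairwise_map, List.mem_cons,
      List.mem_map]
    refine ⟨pA, ⟨?_, ?_, pC.imp (by omega)⟩, ?_⟩
    · rintro b (rfl | ⟨c, hc, rfl⟩)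
      · omega
      · have := pm c hc
        omega
    · rintro b ⟨c, hc, rfl⟩
      have := pm c hc
      omega
    · rintro a ha b (rfl | rfl | ⟨c, hc, rfl⟩)
      · exact pA' a ha b (by simp)
      · exact (pA' a ha m (by simp)).trans (by omega)
      · exact (pA' a ha c (by simp [hc])).trans (by omega)
  · simp only [List.mem_append, List.mem_cons, List.mem_map]
    rintro b (hb | rfl | rfl | ⟨c, hc, rfl⟩)
    · have := h2 b (by simp [hb])
      omega
    · omega
    · omega
    · have := h2 c (by simp [hc])
      omega
  · simp only [List.map_append, List.map_cons, List.map_map, Function.comp, hφ]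
    have e1 : ∀ a ∈ mA, lab (R, if a ≤ m then a else a - 1) = lab (R, a) := fun a ha => by
      rw [if_pos (pA' a ha m (by simp)).le]
    have e2 : ∀ a ∈ mC, lab (R, if a + 1 ≤ m then a + 1 else a + 1 - 1) = lab (R, a) :=
      fun a ha => by
        have := pm a ha
        rw [if_neg (by omega), Nat.add_sub_cancel]
    have e3 : mC.map ((fun a => lab (R, if a ≤ m then a else a - 1)) ∘ fun x => x + 1) =
        mC.map fun a => lab (R, a) := List.map_congr_left e2
    rw [List.map_congr_left e1, e3]
    simp
  · rintro ⟨p1, p2⟩ hp1 hp2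
    refine h4 _ hp1 ?_
    simp only [hφ] at hp2 ⊢
    split_ifs <;> omega
  · intro v hv
    have hc := h5 v hv
    refine conn_of_closed ⟨_, hσc hc.1.some_mem⟩ fun P hne hP => ?_
    have hiff : ∀ p ∈ cell (lab ∘ φ) R (n + 1) v, (p ∈ P ↔ σ (φ p) ∈ P) := by
      intro p hp
      have hp' := hσc (hφc.1 hp)
      rcases hσφ p with e | e
      · rw [e]
      · exact ⟨fun h => hP p hp h _ hp' e.symm, fun h => hP _ hp' h p hp e⟩
    have hsub : cell lab R n v ⊆ {p | σ p ∈ P} := by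
      refine hc.subset_of_closed ?_ ?_
      · obtain ⟨p, hp, hpP⟩ := hne
        exact ⟨φ p, hφc.1 hp, (hiff p hp).1 hpP⟩
      · intro p hp hpP q hq hpq
        rcases hσadj p q hpq with h | ⟨z, hz, h, h'⟩
        · exact hP _ (hσc hp) hpP _ (hσc hq) h
        · have hzc : z ∈ cell (lab ∘ φ) R (n + 1) v := by
            rcases hz with hz | hz
            · exact hφc.2 (hz ▸ hp)
            · exact hφc.2 (hz ▸ hq)
          exact hP _ hzc (hP _ (hσc hp) hpP _ hzc h) _ (hσc hq) h'
    exact fun p hp => (hiff p hp).2 (hsub (hφc.1 hp))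
  · intro u hu v hv huv
    obtain ⟨p, hp, q, hq, hpq⟩ := h6 u hu v hv huv
    rcases hσadj p q hpq with h | ⟨z, hz | hz, h, h'⟩
    · exact ⟨_, hσc hp, _, hσc hq, h⟩
    · exact ⟨z, hφc.2 (hz ▸ hp), _, hσc hq, h'⟩
    · exact ⟨_, hσc hp, z, hφc.2 (hz ▸ hq), h⟩

lemma Sweep.model {a : V} {w : List V} {U : Set V} (h : Sweep H a w U) : Model H w U := by
  induction h with
  | init => exact model_singleton a
  | dup _ ih => exact ih.dup
  | sublist _ hw ih => exact ih.sublist hw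
  | cover _ hv hB hadj ih => exact ih.cover hv hB hadj

lemma Model.isMinor {w : List V} (h : Model H w univ) : ∃ r t, IsMinor H (gridGraph r t) := by
  obtain ⟨R, n, lab, -, -, -, -, -, h5, h6⟩ := h
  set ι : Fin (R + 1) × Fin n → ℕ × ℕ := fun p => (p.1, p.2) with hι
  have hadj : ∀ p q, plane.Adj (ι p) (ι q) → (gridGraph (R + 1) n).Adj p q := by
    rintro ⟨p1, p2⟩ ⟨q1, q2⟩ h
    simp only [hι, plane_adj] at h
    simp only [boxProd_adj, pathGraph_adj, Fin.ext_iff]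
    omega
  have hcell : ∀ {v : V} {p : ℕ × ℕ}, p ∈ cell lab R n v → ∃ q, ι q = p ∧ lab (ι q) = v := by
    rintro v ⟨p1, p2⟩ ⟨hp1, hp2, hp3⟩
    exact ⟨(⟨p1, Nat.lt_succ_of_le hp1⟩, ⟨p2, hp2⟩), rfl, hp3⟩
  have hcell' : ∀ {v : V} {q}, lab (ι q) = v → ι q ∈ cell lab R n v := fun {v q} h =>
    ⟨Nat.lt_succ_iff.1 q.1.2, q.2.2, h⟩
  refine ⟨R + 1, n, isMinor_iff.2 ⟨fun v => {q | lab (ι q) = v}, fun v => ?_, fun u v huv => ?_,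
    fun u v huv => ?_⟩⟩
  · have hc := h5 v (mem_univ v)
    obtain ⟨p, hp⟩ := hc.1
    obtain ⟨q, -, hq⟩ := hcell hp
    refine conn_of_closed ⟨q, hq⟩ fun P hne hP => ?_
    obtain ⟨z, hz, hzP⟩ := hne
    have hsub : cell lab R n v ⊆ ι '' P := by
      refine hc.subset_of_closed ⟨ι z, hcell' hz, z, hzP, rfl⟩ ?_
      rintro _ hx ⟨x, hxP, rfl⟩ y hy hxy
      obtain ⟨y, rfl, hy'⟩ := hcell hy
      exact ⟨y, hP x hx.2.2 hxP y hy' (hadj x y hxy), rfl⟩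
    intro y hy
    obtain ⟨y', hy', e⟩ := hsub (hcell' hy)
    have : y' = y := by
      obtain ⟨y1, y2⟩ := y
      obtain ⟨z1, z2⟩ := y'
      simp only [hι, Prod.mk.injEq, Fin.val_inj] at e
      rw [e.1, e.2]
    exact this ▸ hy'
  · exact Set.disjoint_left.2 fun q hq hq' => huv (hq.symm.trans hq')
  · obtain ⟨p, hp, q, hq, hpq⟩ := h6 u (mem_univ u) v (mem_univ v) huv
    obtain ⟨p, rfl, hp'⟩ := hcell hp
    obtain ⟨q, rfl, hq'⟩ := hcell hq
    exact ⟨p, hp', q, hq', hadj p q hpq⟩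

end Sweep

section Gluing

variable {V : Type*} {H : SimpleGraph V}

lemma Sweep.start_mem {a : V} {w : List V} {U : Set V} (h : Sweep H a w U) : a ∈ U := by
  induction h with
  | init => rfl
  | dup _ ih => exact ih
  | sublist _ hw ih => exact ih
  | cover _ hv hB hadj ih => exact Or.inr ih

lemma Sweep.mem_of_mem {a : V} {w : List V} {U : Set V} (h : Sweep H a w U) : ∀ x ∈ w, x ∈ U := by
  induction h with
  | init => simp
  | dup _ ih =>
    intro y hy
    exact ih y (by simpa using hy)
  | sublist _ hw ih => exact fun x hx => ih x (hw.subset hx)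
  | cover _ hv hB hadj ih =>
    intro y hy
    simp only [List.mem_append, List.mem_cons] at hy
    rcases hy with hy | rfl | hy
    · exact Or.inr (ih y (by simp [hy]))
    · exact Or.inl rfl
    · exact Or.inr (ih y (by simp [hy]))

/-- A sweep starting from a letter of the frontier can be carried out in place. -/
lemma Sweep.context {a x : V} {A C w : List V} {U₀ U : Set V} (h₀ : Sweep H a (A ++ x :: C) U₀)
    (h : Sweep H x w U) (hmeet : ∀ u ∈ U₀, u ∈ U → u = x)
    (hno : ∀ u ∈ U₀, u ≠ x → ∀ v ∈ U, v ≠ x → ¬ H.Adj u v) :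
    Sweep H a (A ++ (w ++ C)) (U₀ ∪ U) := by
  induction h with
  | init =>
    rw [union_eq_self_of_subset_right (singleton_subset_iff.2 (h₀.mem_of_mem x (by simp)))]
    exact h₀
  | @dup A' C' y U h ih =>
    have := ih hmeet hno
    have := Sweep.dup (A := A ++ A') (C := C' ++ C) (x := y) (by simpa using this)
    simpa using this
  | sublist _ hw ih =>
    exact (ih hmeet hno).sublist ((List.Sublist.refl _).append (hw.append (List.Sublist.refl _)))
  | @cover A' B' C' v U h hv hB hadj ih =>
    have h1 := ih (fun u hu hu' => hmeet u hu (Or.inr hu'))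
      fun u hu hux z hz hzx => hno u hu hux z (Or.inr hz) hzx
    have hvx : v ≠ x := fun e => hv (e ▸ h.start_mem)
    have := Sweep.cover (A := A ++ A') (B := B') (C := C' ++ C) (v := v) (by simpa using h1)
      (by
        rintro (h | h)
        · exact hvx (hmeet v h (Or.inl rfl))
        · exact hv h) hB (by
        rintro u (hu | hu) huv
        · by_cases hux : u = x
          · exact hadj u (hux ▸ h.start_mem) huv
          · exact (hno u hu hux v (Or.inl rfl) hvx huv).elim
        · exact hadj u hu huv)
    rw [← union_insert] at this
    simpa using this

lemma Sweep.glue_step {a x y : V} {A B C w : List V} {U B₂ : Set V} (hxy : H.Adj x y)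
    (h : Sweep H a (A ++ (B ++ C)) U) (hy : y ∉ U) (hadj : ∀ u ∈ U, H.Adj u y → u ∈ B)
    (hUB : ∀ u ∈ U, u ∈ B₂ → u = x) (hxU : x ∈ U)
    (hno : ∀ u ∈ U, u ≠ x → ∀ v ∈ B₂, v ≠ x → v ≠ y → ¬ H.Adj u v)
    (hw : Sweep H x w (B₂ \ {y})) (hwy : ∀ v ∈ B₂, H.Adj v y → v ∈ w) :
    Sweep H a (A ++ y :: C) (insert y U ∪ B₂) := by
  obtain ⟨B1, B2, rfl⟩ := List.append_of_mem (hadj x hxU hxy)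
  have h1 := Sweep.context (A := A ++ B1) (C := B2 ++ C) (x := x) (by simpa using h) hw
    (fun u hu hu2 => hUB u hu hu2.1) fun u hu hux v hv hvx => hno u hu hux v hv.1 hvx hv.2
  have h2 := Sweep.cover (A := A) (B := B1 ++ (w ++ B2)) (C := C) (v := y) (by simpa using h1)
    (by
      rintro (h | h)
      · exact hy h
      · exact h.2 rfl)
    (fun e => by
      have := hwy x (hw.start_mem.1) hxy
      simp only [List.append_eq_nil_iff] at e
      simp [e.2.1] at this) (by
      rintro u (hu | hu) huy
      · have := hadj u hu huy
        simp only [List.mem_append, List.mem_cons] at this ⊢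
        rcases this with h | rfl | h
        · exact Or.inl h
        · exact Or.inr (Or.inl (hwy u hw.start_mem.1 huy))
        · exact Or.inr (Or.inr h)
      · have := hwy u hu.1 huy
        simp [this])
  convert h2 using 1
  ext z
  simp only [mem_union, mem_insert_iff, mem_sdiff, mem_singleton_iff]
  by_cases hz : z = y
  · simp [hz]
  · simp [hz]

/-- A sweep of one side of a separation extends to the other side. -/
lemma Sweep.glue {a x y : V} {B₁ B₂ : Set V} {wx wy : List V} (hxy : H.Adj x y)
    (hmeet : ∀ u ∈ B₁, u ∈ B₂ → u = x ∨ u = y) (hx2 : x ∈ B₂) (hy2 : y ∈ B₂)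
    (hno : ∀ u ∈ B₁, u ∉ B₂ → ∀ v ∈ B₂, v ∉ B₁ → ¬ H.Adj u v) (hx1 : x ∈ B₁) (hy1 : y ∈ B₁)
    (hwx : Sweep H x wx (B₂ \ {y})) (hwy : ∀ v ∈ B₂, H.Adj v y → v ∈ wx)
    (hwy' : Sweep H y wy (B₂ \ {x})) (hwx' : ∀ v ∈ B₂, H.Adj v x → v ∈ wy) {w : List V} {U : Set V}
    (h : Sweep H a w U) (hU : U ⊆ B₁) : Sweep H a w (U ∪ {z ∈ B₂ | x ∈ U ∧ y ∈ U}) := by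
  induction h with
  | init =>
    convert Sweep.init using 1
    refine union_eq_self_of_subset_right ?_
    rintro z ⟨-, hx, hy⟩
    exact (hxy.ne (hx.trans hy.symm)).elim
  | dup _ ih => exact (ih hU).dup
  | sublist _ hw ih => exact (ih hU).sublist hw
  | @cover A B C v U h hv hB hadj ih =>
    have hU' : U ⊆ B₁ := (subset_insert v U).trans hU
    have hv1 : v ∈ B₁ := hU (Or.inl rfl)
    have hno' : ∀ u ∈ U, u ≠ x → u ≠ y → ∀ v ∈ B₂, v ≠ x → v ≠ y → ¬ H.Adj u v := by
      intro u hu hux huy v hv hvx hvy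
      refine hno u (hU' hu) (fun h => ?_) v hv fun h => ?_
      · rcases hmeet u (hU' hu) h with h | h
        · exact hux h
        · exact huy h
      · rcases hmeet v h hv with h | h
        · exact hvx h
        · exact hvy h
    have hext : ¬ (x ∈ U ∧ y ∈ U) → U ∪ {z ∈ B₂ | x ∈ U ∧ y ∈ U} = U := by
      intro hn
      simp [hn]
    by_cases hvx : v = x
    · subst hvx
      by_cases hyU : y ∈ U
      · have := Sweep.glue_step (B₂ := B₂) hxy.symm h hv hadj (fun u hu hu2 =>
          (hmeet u (hU' hu) hu2).resolve_left fun e => hv (e ▸ hu)) hyU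
          (fun u hu huy z hz hzy hzv => hno' u hu (fun e => hv (e ▸ hu)) huy z hz hzv hzy) hwy' hwx'
        convert this using 2
        simp [hyU]
      · have : Sweep H a (A ++ v :: C) (insert v U) := Sweep.cover h hv hB hadj
        convert this using 1
        simp [hyU, hxy.ne']
    by_cases hvy : v = y
    · subst hvy
      by_cases hxU : x ∈ U
      · have := Sweep.glue_step (B₂ := B₂) hxy h hv hadj (fun u hu hu2 =>
          (hmeet u (hU' hu) hu2).resolve_right fun e => hv (e ▸ hu)) hxU
          (fun u hu hux z hz hzx hzv => hno' u hu hux (fun e => hv (e ▸ hu)) z hz hzx hzv) hwx hwy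
        convert this using 2
        simp [hxU]
      · have : Sweep H a (A ++ v :: C) (insert v U) := Sweep.cover h hv hB hadj
        convert this using 1
        simp [hxU, hxy.ne]
    have hv2 : v ∉ B₂ := fun h => by
      rcases hmeet v hv1 h with h | h
      · exact hvx h
      · exact hvy h
    have := Sweep.cover (v := v) (ih hU') (by
      rintro (h | h)
      · exact hv h
      · exact hv2 h.1) hB (by
      rintro u (hu | hu) huv
      · exact hadj u hu huv
      · by_cases hu1 : u ∈ B₁
        · rcases hmeet u hu1 hu.1 with rfl | rfl
          · exact hadj u hu.2.1 huv
          · exact hadj u hu.2.2 huv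
        · exact (hno v hv1 hv2 u hu.1 hu1 huv.symm).elim)
    convert this using 1
    rw [insert_union]
    simp [Ne.symm hvx, Ne.symm hvy]

/-- The set `B` can be swept from `a` with the neighbours of `t` on the final frontier. -/
def Sweepable (H : SimpleGraph V) (B : Set V) (a t : V) : Prop :=
  ∃ w, Sweep H a w (B \ {t}) ∧ ∀ v ∈ B, H.Adj v t → v ∈ w

lemma Sweepable.glue {a t x y : V} {B₁ B₂ : Set V} (h : Sweepable H B₁ a t)
    (ht : t ∈ B₁) (hxy : H.Adj x y) (hmeet : ∀ u ∈ B₁, u ∈ B₂ → u = x ∨ u = y)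
    (hx1 : x ∈ B₁) (hy1 : y ∈ B₁) (hx2 : x ∈ B₂) (hy2 : y ∈ B₂)
    (hno : ∀ u ∈ B₁, u ∉ B₂ → ∀ v ∈ B₂, v ∉ B₁ → ¬ H.Adj u v)
    (h1 : Sweepable H B₂ x y) (h2 : Sweepable H B₂ y x) : Sweepable H (B₁ ∪ B₂) a t := by
  have key : ∀ x, H.Adj x t → x ∈ B₁ → (∀ u ∈ B₁, u ∈ B₂ → u = x ∨ u = t) → Sweepable H B₂ x t →
      Sweepable H (B₁ ∪ B₂) a t := by
    intro x hxt hx1 hmeet h1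
    obtain ⟨w, hw, hwt⟩ := h
    obtain ⟨w', hw', hwt'⟩ := h1
    obtain ⟨A, C, rfl⟩ := List.append_of_mem (hwt x hx1 hxt)
    have := hw.context hw' (fun u hu hu2 => (hmeet u hu.1 hu2.1).resolve_right hu.2) (by
      intro u hu hux v hv hvx
      refine hno u hu.1 (fun h => ?_) v hv.1 fun h => ?_
      · rcases hmeet u hu.1 h with h | h
        · exact hux h
        · exact hu.2 h
      · rcases hmeet v h hv.1 with h | h
        · exact hvx h
        · exact hv.2 h)
    rw [← union_sdiff_distrib] at this
    refine ⟨_, this, ?_⟩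
    rintro v (hv | hv) hvt
    · have := hwt v hv hvt
      simp only [List.mem_append, List.mem_cons] at this ⊢
      rcases this with h | rfl | h
      · exact Or.inl h
      · exact Or.inr (Or.inl (hwt' v hw'.start_mem.1 hvt))
      · exact Or.inr (Or.inr h)
    · simp [hwt' v hv hvt]
  by_cases htx : t = x
  · subst htx
    exact key y hxy.symm hy1 (fun u hu hu2 => (hmeet u hu hu2).symm) h2
  by_cases hty : t = y
  · subst hty
    exact key x hxy hx1 hmeet h1
  obtain ⟨w, hw, hwt⟩ := h
  obtain ⟨wx, hwx, hwxy⟩ := h1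
  obtain ⟨wy, hwy, hwyx⟩ := h2
  have ht2 : t ∉ B₂ := fun h => by
    rcases hmeet t ht h with h | h
    · exact htx h
    · exact hty h
  have := Sweep.glue hxy hmeet hx2 hy2 hno hx1 hy1 hwx hwxy hwy hwyx hw sdiff_subset
  refine ⟨w, ?_, ?_⟩
  · convert this using 1
    ext z
    simp only [mem_sdiff, mem_union, mem_singleton_iff, mem_ofPred_eq, hx1, hy1, Ne.symm htx,
      Ne.symm hty, not_false_eq_true, and_self, and_true]
    constructor
    · tauto
    · rintro (h | h)
      · exact ⟨Or.inl h.1, h.2⟩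
      · exact ⟨Or.inr h, fun e => ht2 (e ▸ h)⟩
  · rintro v (hv | hv) hvt
    · exact hwt v hv hvt
    · by_cases hv1 : v ∈ B₁
      · exact hwt v hv1 hvt
      · exact (hno t ht ht2 v hv hv1 hvt.symm).elim

/-- Every separation of `H[B]` of order at most two is along an edge. -/
def EdgeSeparated (H : SimpleGraph V) (B : Set V) : Prop :=
  ∀ (B₁ B₂ : Set V) (x y : V), B₁ ∪ B₂ = B → (B₁ \ B₂).Nonempty → (B₂ \ B₁).Nonempty →
    (∀ u ∈ B₁, u ∉ B₂ → ∀ v ∈ B₂, v ∉ B₁ → ¬ H.Adj u v) → (∀ u ∈ B₁, u ∈ B₂ → u = x ∨ u = y) →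
    H.Adj x y ∧ x ∈ B₁ ∧ x ∈ B₂ ∧ y ∈ B₁ ∧ y ∈ B₂

/-- No two vertices separate `H[B]`. -/
def ThreeConn (H : SimpleGraph V) (B : Set V) : Prop :=
  ∀ J ⊆ B, J.Nonempty → ∀ x y, (∀ u ∈ B, u ∉ J → ∀ v ∈ J, H.Adj v u → u = x ∨ u = y) →
    ∀ u ∈ B, u ∈ J ∨ u = x ∨ u = y

lemma EdgeSeparated.left {B₁ B₂ : Set V} (h : EdgeSeparated H (B₁ ∪ B₂)) {x y : V}
    (hxy : H.Adj x y) (hmeet : ∀ u ∈ B₁, u ∈ B₂ → u = x ∨ u = y)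
    (hx1 : x ∈ B₁) (hy1 : y ∈ B₁)
    (hno : ∀ u ∈ B₁, u ∉ B₂ → ∀ v ∈ B₂, v ∉ B₁ → ¬ H.Adj u v) : EdgeSeparated H B₁ := by
  intro C₁ C₂ p q hC h1 h2 hnoC hmeetC
  have key : ∀ C₁ C₂ : Set V, C₁ ∪ C₂ = B₁ → (C₁ \ C₂).Nonempty → (C₂ \ C₁).Nonempty →
      (∀ u ∈ C₁, u ∉ C₂ → ∀ v ∈ C₂, v ∉ C₁ → ¬ H.Adj u v) → (∀ u ∈ C₁, u ∈ C₂ → u = p ∨ u = q) →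
      x ∈ C₁ → y ∈ C₁ → H.Adj p q ∧ p ∈ C₁ ∧ p ∈ C₂ ∧ q ∈ C₁ ∧ q ∈ C₂ := by
    intro C₁ C₂ hC h1 h2 hnoC hmeetC hx hy
    have h2B : ∀ u ∈ C₂, u ∈ B₂ → u ∈ C₁ := fun u hu hu2 => by
      rcases hmeet u (hC ▸ Or.inr hu) hu2 with rfl | rfl <;> assumption
    have := h (C₁ ∪ B₂) C₂ p q (by rw [← hC]; ext z; simp only [mem_union]; tauto) (by
      obtain ⟨u, hu, hu'⟩ := h1
      exact ⟨u, Or.inl hu, hu'⟩) (by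
      obtain ⟨u, hu, hu'⟩ := h2
      refine ⟨u, hu, ?_⟩
      rintro (h | h)
      · exact hu' h
      · exact hu' (h2B u hu h)) (by
      rintro u (hu | hu) hu2 v hv hv1
      · exact hnoC u hu hu2 v hv fun h => hv1 (Or.inl h)
      · by_cases hu1 : u ∈ C₁
        · exact hnoC u hu1 hu2 v hv fun h => hv1 (Or.inl h)
        · exact fun hadj => hno v (hC ▸ Or.inr hv) (fun h => hv1 (Or.inr h)) u hu
            (fun h => by rw [← hC] at h; exact h.elim hu1 hu2) hadj.symm) (by
      rintro u (hu | hu) hu2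
      · exact hmeetC u hu hu2
      · exact hmeetC u (h2B u hu2 hu) hu2)
    refine ⟨this.1, ?_, this.2.2.1, ?_, this.2.2.2.2⟩
    · exact this.2.1.elim id (h2B p this.2.2.1)
    · exact this.2.2.2.1.elim id (h2B q this.2.2.2.2)
  have hcase : (x ∈ C₁ ∧ y ∈ C₁) ∨ (x ∈ C₂ ∧ y ∈ C₂) := by
    by_contra hn
    rw [← hC] at hx1 hy1
    rcases hx1 with hx | hx <;> rcases hy1 with hy | hy
    · exact hn (Or.inl ⟨hx, hy⟩)
    · exact hnoC x hx (fun h => hn (Or.inr ⟨h, hy⟩)) y hy (fun h => hn (Or.inl ⟨hx, h⟩)) hxy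
    · exact hnoC y hy (fun h => hn (Or.inr ⟨hx, h⟩)) x hx (fun h => hn (Or.inl ⟨h, hy⟩)) hxy.symm
    · exact hn (Or.inr ⟨hx, hy⟩)
  rcases hcase with ⟨hx, hy⟩ | ⟨hx, hy⟩
  · exact key C₁ C₂ hC h1 h2 hnoC hmeetC hx hy
  · have := key C₂ C₁ (by rw [union_comm, hC]) h2 h1
      (fun u hu hu' v hv hv' hadj => hnoC v hv hv' u hu hu' hadj.symm)
      (fun u hu hu' => hmeetC u hu' hu) hx hy
    exact ⟨this.1, this.2.2.1, this.2.1, this.2.2.2.2, this.2.2.2.1⟩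

lemma sweepable_of_edgeSeparated [Finite V]
    (htri : ∀ (B : Set V) (a t : V), ThreeConn H B → a ∈ B → t ∈ B → H.Adj a t →
      Sweepable H B a t) (B : Set V) (hB : EdgeSeparated H B) (a t : V) (ha : a ∈ B) (ht : t ∈ B)
    (hat : H.Adj a t) : Sweepable H B a t := by
  induction hn : B.ncard using Nat.strong_induction_on generalizing B a t with
  | _ n ih =>
  subst hn
  by_cases h3 : ThreeConn H B
  · exact htri B a t h3 ha ht hat
  simp only [ThreeConn] at h3
  push Not at h3
  obtain ⟨J, hJB, hJ, x, y, hN, u, huB, huJ, hux, huy⟩ := h3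
  set B₁ := J ∪ {z ∈ B | z = x ∨ z = y} with hB₁
  set B₂ := B \ J with hB₂
  have hun : B₁ ∪ B₂ = B := by
    ext z
    simp only [hB₁, hB₂, mem_union, mem_ofPred_eq, mem_sdiff]
    have := @hJB z
    tauto
  have hno : ∀ u ∈ B₁, u ∉ B₂ → ∀ v ∈ B₂, v ∉ B₁ → ¬ H.Adj u v := by
    intro u hu hu2 v hv hv1 hadj
    have huB : u ∈ B := hun ▸ Or.inl hu
    have huJ : u ∈ J := by
      by_contra h
      exact hu2 ⟨huB, h⟩
    exact hv1 (Or.inr ⟨hv.1, hN v hv.1 hv.2 u huJ hadj⟩)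
  have hmeet : ∀ u ∈ B₁, u ∈ B₂ → u = x ∨ u = y := by
    rintro u (hu | hu) hu2
    · exact (hu2.2 hu).elim
    · exact hu.2
  have hd1 : (B₁ \ B₂).Nonempty := hJ.mono fun z hz => ⟨Or.inl hz, fun h => h.2 hz⟩
  have hd2 : (B₂ \ B₁).Nonempty := ⟨u, ⟨huB, huJ⟩, by
    rintro (h | h)
    · exact huJ h
    · exact h.2.elim hux huy⟩
  obtain ⟨hxy, hx1, hx2, hy1, hy2⟩ := hB B₁ B₂ x y hun hd1 hd2 hno hmeet
  have hmeet' : ∀ u ∈ B₂, u ∈ B₁ → u = x ∨ u = y := fun u hu hu' => hmeet u hu' hu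
  have hno' : ∀ u ∈ B₂, u ∉ B₁ → ∀ v ∈ B₁, v ∉ B₂ → ¬ H.Adj u v :=
    fun u hu hu' v hv hv' hadj => hno v hv hv' u hu hu' hadj.symm
  have hE1 : EdgeSeparated H B₁ :=
    EdgeSeparated.left (B₂ := B₂) (by rwa [hun]) hxy hmeet hx1 hy1 hno
  have hE2 : EdgeSeparated H B₂ :=
    EdgeSeparated.left (B₂ := B₁) (by rwa [union_comm, hun]) hxy hmeet' hx2 hy2 hno'
  have hlt1 : B₁.ncard < B.ncard := by
    refine ncard_lt_ncard ⟨hun ▸ subset_union_left, fun h => ?_⟩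
    obtain ⟨z, hz, hz'⟩ := hd2
    exact hz' (h hz.1)
  have hlt2 : B₂.ncard < B.ncard := by
    refine ncard_lt_ncard ⟨hun ▸ subset_union_right, fun h => ?_⟩
    obtain ⟨z, hz, hz'⟩ := hd1
    exact hz' (h (hun ▸ Or.inl hz))
  have hside : (a ∈ B₁ ∧ t ∈ B₁) ∨ (a ∈ B₂ ∧ t ∈ B₂) := by
    by_contra hn
    rw [← hun] at ha ht
    rcases ha with hx | hx <;> rcases ht with hy | hy
    · exact hn (Or.inl ⟨hx, hy⟩)
    · exact hno a hx (fun h => hn (Or.inr ⟨h, hy⟩)) t hy (fun h => hn (Or.inl ⟨hx, h⟩)) hat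
    · exact hno t hy (fun h => hn (Or.inr ⟨hx, h⟩)) a hx (fun h => hn (Or.inl ⟨h, hy⟩)) hat.symm
    · exact hn (Or.inr ⟨hx, hy⟩)
  rcases hside with ⟨ha, ht⟩ | ⟨ha, ht⟩
  · have := (ih _ hlt1 B₁ hE1 a t ha ht hat rfl).glue ht hxy hmeet hx1 hy1 hx2 hy2 hno
      (ih _ hlt2 B₂ hE2 x y hx2 hy2 hxy rfl) (ih _ hlt2 B₂ hE2 y x hy2 hx2 hxy.symm rfl)
    rwa [hun] at this
  · have := (ih _ hlt2 B₂ hE2 a t ha ht hat rfl).glue ht hxy hmeet' hx2 hy2 hx1 hy1 hno'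
      (ih _ hlt1 B₁ hE1 x y hx1 hy1 hxy rfl) (ih _ hlt1 B₁ hE1 y x hy1 hx1 hxy.symm rfl)
    rwa [union_comm, hun] at this

end Gluing

section Ear

variable {V : Type*} {H : SimpleGraph V}

/-- Connected subsets of `K` missing a vertex with a neighbour in `O` do not join `z` and `q`. -/
def NoBridge (H : SimpleGraph V) (K O : Set V) (z q : V) : Prop :=
  ∀ w ∈ K, (∃ o ∈ O, H.Adj w o) → ∀ J ⊆ K \ {w}, Conn H J → (∃ j ∈ J, H.Adj z j) →
    ¬ ∃ j ∈ J, H.Adj q j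

lemma NoBridge.symm {K O : Set V} {z q : V} (h : NoBridge H K O z q) : NoBridge H K O q z :=
  fun w hw ho J hJ hc hq hz => h w hw ho J hJ hc hz hq

lemma NoBridge.step {K O : Set V} {z q w : V} (h : NoBridge H K O z q) (hw : w ∈ K)
    (hzw : H.Adj z w) : NoBridge H (K \ {w}) O w q := by
  rintro v ⟨hv, hvw⟩ ho J hJ hc ⟨j, hj, hwj⟩ ⟨i, hi, hqi⟩
  refine h v hv ho ({w} ∪ J) ?_ ((conn_singleton w).union_adj hc rfl hj hwj)
    ⟨w, Or.inl rfl, hzw⟩ ⟨i, Or.inr hi, hqi⟩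
  rintro x (rfl | hx)
  · exact ⟨hw, fun e => hvw e.symm⟩
  · exact ⟨(hJ hx).1.1, (hJ hx).2⟩

/-- If deleting a vertex with a neighbour in `O` leaves only pieces with at most one neighbour in
`U`, then each such piece has itself a neighbour in `O`. -/
lemma ThreeConn.exists_adj {B U K O J : Set V} {w : V} (h3 : ThreeConn H B) (hB : B = U ∪ K ∪ O)
    (hKO : Disjoint K O) (hUO : Disjoint U O) (hO : O.Nonempty) (hw : w ∈ K) (hJK : J ⊆ K \ {w})
    (hJ : J.Nonempty) (hcl : ∀ x ∈ J, ∀ y ∈ K \ {w}, H.Adj x y → y ∈ J)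
    (hU : ∀ u ∈ U, ∀ v ∈ U, (∃ j ∈ J, H.Adj u j) → (∃ j ∈ J, H.Adj v j) → u = v) :
    ∃ j ∈ J, ∃ o ∈ O, H.Adj j o := by
  by_contra hc
  push Not at hc
  obtain ⟨z, hzO, hz⟩ : ∃ z, z ∉ O ∧ ∀ u ∈ U, (∃ j ∈ J, H.Adj u j) → u = z := by
    by_cases h : ∃ z ∈ U, ∃ j ∈ J, H.Adj z j
    · obtain ⟨z, hz, h⟩ := h
      exact ⟨z, Set.disjoint_left.1 hUO hz, fun u hu h' => hU u hu z hz h' h⟩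
    · exact ⟨w, Set.disjoint_left.1 hKO hw, fun u hu h' => (h ⟨u, hu, h'⟩).elim⟩
  obtain ⟨o, ho⟩ := hO
  rcases h3 J (fun x hx => hB ▸ Or.inl (Or.inr (hJK hx).1)) hJ w z (by
    intro u hu huJ v hv hvu
    rw [hB] at hu
    rcases hu with (hu | hu) | hu
    · exact Or.inr (hz u hu ⟨v, hv, hvu.symm⟩)
    · by_contra hne
      exact huJ (hcl v hv u ⟨hu, fun e => hne (Or.inl e)⟩ hvu)
    · exact (hc v hv u hu hvu).elim) o (hB ▸ Or.inr ho) with h | rfl | rfl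
  · exact Set.disjoint_left.1 hKO (hJK h).1 ho
  · exact Set.disjoint_left.1 hKO hw ho
  · exact hzO ho

lemma ThreeConn.exists_noncut [Finite V] {B U K O : Set V} (h3 : ThreeConn H B)
    (hB : B = U ∪ K ∪ O) (hKO : Disjoint K O) (hUO : Disjoint U O) (hO : O.Nonempty)
    (hK : Conn H K) (hZ : ∃ w ∈ K, ∃ o ∈ O, H.Adj w o)
    (hU : ∀ w ∈ K, (∃ o ∈ O, H.Adj w o) → ∀ J ⊆ K \ {w}, Conn H J → ∀ u ∈ U, ∀ v ∈ U,
      (∃ j ∈ J, H.Adj u j) → (∃ j ∈ J, H.Adj v j) → u = v) :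
    ∃ w ∈ K, (∃ o ∈ O, H.Adj w o) ∧ (K = {w} ∨ Conn H (K \ {w}) ∧
      ∃ j ∈ K \ {w}, ∃ o ∈ O, H.Adj j o) := by
  obtain ⟨w₀, hw₀, ho₀⟩ := hZ
  by_cases hs : K = {w₀}
  · exact ⟨w₀, hw₀, ho₀, Or.inl hs⟩
  obtain ⟨x₀, hx₀⟩ : (K \ {w₀}).Nonempty := by
    by_contra h
    rw [Set.not_nonempty_iff_eq_empty, sdiff_eq_empty] at h
    exact hs (subset_antisymm h (singleton_subset_iff.2 hw₀))
  obtain ⟨⟨w, x⟩, ⟨hw, ho, hx⟩, hmax⟩ := Set.exists_max_image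
    {p : V × V | p.1 ∈ K ∧ (∃ o ∈ O, H.Adj p.1 o) ∧ p.2 ∈ K \ {p.1}}
    (fun p => (reachIn H (K \ {p.1}) p.2).ncard) (toFinite _) ⟨(w₀, x₀), hw₀, ho₀, hx₀⟩
  simp only at hw ho hx hmax
  have hJ : ∀ y ∈ K \ {w}, ∃ j ∈ reachIn H (K \ {w}) y, ∃ o ∈ O, H.Adj j o := fun y hy =>
    h3.exists_adj hB hKO hUO hO hw (reachIn_subset y) ⟨y, mem_reachIn_self hy⟩
      (fun _ hx _ hy h => reachIn_closed hx hy h)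
      (hU w hw ho _ (reachIn_subset y) (conn_reachIn hy))
  have hall : K \ {w} ⊆ reachIn H (K \ {w}) x := by
    intro y hy
    by_contra hyx
    obtain ⟨v, hv, hvo⟩ := hJ y hy
    have hvx : v ∉ reachIn H (K \ {w}) x := fun h => hyx (reachIn_trans h (reachIn_symm hv))
    have hvK := reachIn_subset y hv
    obtain ⟨i, hiK, hi, j, hjK, hj, hij⟩ := hK.exists_adj (reachIn H (K \ {w}) x)
      ⟨x, hx.1, mem_reachIn_self hx⟩ ⟨w, hw, fun h => (reachIn_subset x h).2 rfl⟩
    have hjw : j = w := by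
      by_contra h
      exact hj (reachIn_closed hi ⟨hjK, h⟩ hij)
    have hc := (conn_reachIn hx).union_adj (conn_singleton w) hi rfl (hjw ▸ hij)
    have hsub := hc.subset_reachIn (B := K \ {v}) (x := x) (by
      rintro u (hu | rfl)
      · exact ⟨(reachIn_subset x hu).1, fun e => hvx (e ▸ hu)⟩
      · exact ⟨hw, fun e => hvK.2 e.symm⟩) (Or.inl (mem_reachIn_self hx))
    have := hmax (v, x) ⟨hvK.1, hvo, hx.1, fun e : x = v => hvx (e ▸ mem_reachIn_self hx)⟩
    refine absurd this (not_le.2 (ncard_lt_ncard ⟨subset_union_left.trans hsub, fun h => ?_⟩))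
    exact (reachIn_subset x (h (hsub (Or.inr rfl)))).2 rfl
  refine ⟨w, hw, ho, Or.inr ?_⟩
  rw [subset_antisymm hall (reachIn_subset x)]
  exact ⟨conn_reachIn hx, hJ x hx⟩

/-- A sweep can be threaded through a connected set attached at two consecutive letters. -/
lemma Sweep.thread [Finite V] {a : V} {B O : Set V} (h3 : ThreeConn H B) (hO : O.Nonempty)
    {K U : Set V} {z q : V} {A C : List V}
    (h : Sweep H a (A ++ z :: q :: C) U) (hB : B = U ∪ K ∪ O) (hUK : Disjoint U K)
    (hKO : Disjoint K O) (hUO : Disjoint U O) (hK : Conn H K)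
    (hz : ∃ k ∈ K, H.Adj z k) (hq : ∃ k ∈ K, H.Adj q k)
    (hU : ∀ u ∈ U, (∃ k ∈ K, H.Adj u k) → u = z ∨ u = q) (hstar : NoBridge H K O z q) :
    ∃ us : List V, us.Nodup ∧ (∀ v, v ∈ us ↔ v ∈ K) ∧ List.IsChain H.Adj (z :: (us ++ [q])) ∧
      Sweep H a (A ++ z :: (us ++ q :: C)) (U ∪ K) := by
  induction hn : K.ncard using Nat.strong_induction_on generalizing K U z q A C with
  | _ n ih =>
  subst hn
  have hZ : ∃ w ∈ K, ∃ o ∈ O, H.Adj w o := by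
    by_contra hc
    push Not at hc
    obtain ⟨o, ho⟩ := hO
    have hzU := h.mem_of_mem z (by simp)
    have hqU := h.mem_of_mem q (by simp)
    rcases h3 K (hB ▸ subset_union_right.trans subset_union_left) hK.1 z q (by
      intro u hu huK v hv hvu
      rw [hB] at hu
      rcases hu with (hu | hu) | hu
      · exact hU u hu ⟨v, hv, hvu.symm⟩
      · exact (huK hu).elim
      · exact (hc v hv u hu hvu).elim) o (hB ▸ Or.inr ho) with h | rfl | rfl
    · exact Set.disjoint_left.1 hKO h ho
    · exact Set.disjoint_left.1 hUO hzU ho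
    · exact Set.disjoint_left.1 hUO hqU ho
  obtain ⟨w, hw, ho, hcase⟩ := h3.exists_noncut hB hKO hUO hO hK hZ (by
    rintro w hw ho J hJ hc u hu v hv ⟨i, hi, hui⟩ ⟨j, hj, hvj⟩
    rcases hU u hu ⟨i, (hJ hi).1, hui⟩ with rfl | rfl <;>
      rcases hU v hv ⟨j, (hJ hj).1, hvj⟩ with rfl | rfl
    · rfl
    · exact (hstar w hw ho J hJ hc ⟨i, hi, hui⟩ ⟨j, hj, hvj⟩).elim
    · exact (hstar w hw ho J hJ hc ⟨j, hj, hvj⟩ ⟨i, hi, hui⟩).elim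
    · rfl)
  have hwU : w ∉ U := fun h => Set.disjoint_left.1 hUK h hw
  rcases hcase with rfl | ⟨hK', w', hw', ho'⟩
  · obtain ⟨k, rfl, hzw⟩ := hz
    obtain ⟨k', hk', hqw⟩ := hq
    rw [mem_singleton_iff] at hk'
    subst hk'
    refine ⟨[k'], by simp, by simp, by simp [hzw, hqw.symm], ?_⟩
    have h1 : Sweep H a (A ++ z :: z :: q :: C) U := h.dup
    have h2 := Sweep.dup (A := A ++ [z, z]) (x := q) (C := C) (by simpa using h1)
    have h3 := Sweep.cover (A := A ++ [z]) (B := [z, q]) (C := q :: C) (v := k')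
      (by simpa using h2) hwU (by simp) (by
        intro u hu hadj
        simpa using hU u hu ⟨k', rfl, hadj⟩)
    rw [union_singleton]
    simpa using h3
  have hnotboth : ¬ (H.Adj z w ∧ H.Adj q w) := fun hb =>
    hstar w' hw'.1 ho' {w} (by
      rintro x rfl
      exact ⟨hw, fun e => hw'.2 e.symm⟩) (conn_singleton w) ⟨w, rfl, hb.1⟩ ⟨w, rfl, hb.2⟩
  have hnotboth' := hstar w hw ho (K \ {w}) subset_rfl hK'
  have hlt : (K \ {w}).ncard < K.ncard := ncard_sdiff_singleton_lt_of_mem hw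
  have hB' : B = insert w U ∪ K \ {w} ∪ O := by
    rw [hB]
    ext x
    simp only [mem_union, mem_insert_iff, mem_sdiff, mem_singleton_iff]
    by_cases hx : x = w
    · simp [hx, hw]
    · simp [hx]
  have hUK' : Disjoint (insert w U) (K \ {w}) := by
    rw [Set.disjoint_left] at hUK ⊢
    rintro x (rfl | hx) hx'
    · exact hx'.2 rfl
    · exact hUK hx hx'.1
  have hKO' : Disjoint (K \ {w}) O := hKO.mono_left sdiff_subset
  have hUO' : Disjoint (insert w U) O := by
    rw [Set.disjoint_left] at hUO hKO ⊢
    rintro x (rfl | hx)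
    · exact hKO hw
    · exact hUO hx
  have hwK : ∃ k ∈ K \ {w}, H.Adj w k := by
    obtain ⟨i, hiK, rfl, j, hjK, hj, hij⟩ := hK.exists_adj {w} ⟨w, hw, rfl⟩ ⟨w', hw'⟩
    exact ⟨j, ⟨hjK, hj⟩, hij⟩
  have hsplit : ∀ p, (∃ k ∈ K, H.Adj p k) → H.Adj p w ∨ ∃ k ∈ K \ {w}, H.Adj p k := by
    rintro p ⟨k, hk, hpk⟩
    by_cases hkw : k = w
    · exact Or.inl (hkw ▸ hpk)
    · exact Or.inr ⟨k, ⟨hk, hkw⟩, hpk⟩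
  have hun : insert w U ∪ K \ {w} = U ∪ K := by
    ext x
    simp only [mem_union, mem_insert_iff, mem_sdiff, mem_singleton_iff]
    by_cases hx : x = w
    · simp [hx, hw]
    · simp [hx]
  have hU' : ∀ p r, (∀ u ∈ U, (∃ k ∈ K, H.Adj u k) → u = p ∨ u = r) →
      (¬ ∃ k ∈ K \ {w}, H.Adj p k) → ∀ u ∈ insert w U, (∃ k ∈ K \ {w}, H.Adj u k) →
      u = w ∨ u = r := by
    rintro p r h hp u (rfl | hu) hk
    · exact Or.inl rfl
    · rcases h u hu (by
        obtain ⟨k, hk, huk⟩ := hk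
        exact ⟨k, hk.1, huk⟩) with rfl | rfl
      · exact (hp hk).elim
      · exact Or.inr rfl
  by_cases hzw : H.Adj z w
  · have hqw : ¬ H.Adj q w := fun h => hnotboth ⟨hzw, h⟩
    have hqK := (hsplit q hq).resolve_left hqw
    have hzK : ¬ ∃ k ∈ K \ {w}, H.Adj z k := fun h => hnotboth' h hqK
    have h1 : Sweep H a (A ++ z :: z :: q :: C) U := h.dup
    have h2 := Sweep.cover (A := A ++ [z]) (B := [z]) (C := q :: C) (v := w)
      (by simpa using h1) hwU (by simp) (by
        intro u hu hadj
        rcases hU u hu ⟨w, hw, hadj⟩ with rfl | rfl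
        · simp
        · exact (hqw hadj).elim)
    obtain ⟨us, hnd, hus, hch, hsw⟩ := ih _ hlt h2 hB' hUK' hKO' hUO' hK' hwK hqK
      (hU' z q hU hzK) (hstar.step hw hzw) rfl
    refine ⟨w :: us, ?_, ?_, ?_, ?_⟩
    · rw [List.nodup_cons, hus]
      exact ⟨fun h => h.2 rfl, hnd⟩
    · intro v
      rw [List.mem_cons, hus]
      by_cases hv : v = w <;> simp [hv, hw]
    · rw [List.cons_append, List.isChain_cons_cons]
      exact ⟨hzw, hch⟩
    · rw [hun] at hsw
      simpa using hsw
  · have hzK := (hsplit z hz).resolve_left hzw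
    have hqK := hnotboth' hzK
    have hqw := (hsplit q hq).resolve_right hqK
    have h1 := Sweep.dup (A := A ++ [z]) (x := q) (C := C) (by simpa using h)
    have h2 := Sweep.cover (A := A ++ [z]) (B := [q]) (C := q :: C) (v := w)
      (by simpa using h1) hwU (by simp) (by
        intro u hu hadj
        rcases hU u hu ⟨w, hw, hadj⟩ with rfl | rfl
        · exact (hzw hadj).elim
        · simp)
    obtain ⟨us, hnd, hus, hch, hsw⟩ := ih _ hlt (A := A) (z := z) (q := w) (C := q :: C)
      (by simpa using h2) hB' hUK' hKO' hUO' hK' hzK hwK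
      (fun u hu hk => (hU' q z (fun u hu hk => (hU u hu hk).symm) hqK u hu hk).symm)
      (hstar.symm.step hw hqw).symm rfl
    refine ⟨us ++ [w], ?_, ?_, ?_, ?_⟩
    · rw [List.nodup_append]
      refine ⟨hnd, by simp, ?_⟩
      rintro x hx y hy rfl
      rw [List.mem_singleton] at hy
      exact ((hus x).1 hx).2 hy
    · intro v
      rw [List.mem_append, hus, List.mem_singleton]
      by_cases hv : v = w <;> simp [hv, hw]
    · have : z :: (us ++ [w] ++ [q]) = (z :: (us ++ [w])) ++ [q] := by simp
      rw [this, List.isChain_append]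
      refine ⟨hch, by simp, ?_⟩
      intro x hx y hy
      have : x = w := by
        rw [← List.cons_append, List.getLast?_concat] at hx
        simpa using hx.symm
      have hy' : y = q := by simpa using hy.symm
      exact this ▸ hy' ▸ hqw.symm
    · rw [hun] at hsw
      simpa using hsw

/-- A connected part of `O` that can be split off, attached at two vertices of `U`. -/
lemma ThreeConn.exists_ear [Finite V] {B U O : Set V} {t : V} (h3 : ThreeConn H B)
    (hB : B = U ∪ O) (hUO : Disjoint U O) (hO : Conn H O) (ht : t ∈ O) (hOt : (O \ {t}).Nonempty)
    (hU : ∃ x ∈ U, ∃ y ∈ U, x ≠ y) :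
    ∃ P ⊆ O \ {t}, Conn H P ∧ Conn H (O \ P) ∧ ∃ p ∈ U, ∃ q ∈ U, p ≠ q ∧ (∃ k ∈ P, H.Adj p k) ∧
      (∃ k ∈ P, H.Adj q k) ∧ ((∃ v, P = {v}) ∨ ∀ p ∈ U, ∀ q ∈ U, p ≠ q → (∃ k ∈ P, H.Adj p k) →
        (∃ k ∈ P, H.Adj q k) →
          (∀ u ∈ U, (∃ k ∈ P, H.Adj u k) → u = p ∨ u = q) ∧ NoBridge H P (O \ P) p q) := by
  set S : Set (Set V) := {P | P ⊆ O \ {t} ∧ Conn H P ∧ Conn H (O \ P) ∧ ∃ p ∈ U, ∃ q ∈ U, p ≠ q ∧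
    (∃ k ∈ P, H.Adj p k) ∧ ∃ k ∈ P, H.Adj q k} with hS
  have hSne : S.Nonempty := by
    obtain ⟨x, hx⟩ := hOt
    refine ⟨reachIn H (O \ {t}) x, reachIn_subset x, conn_reachIn hx,
      hO.diff_reachIn ht (by simpa using conn_singleton t) subset_rfl, ?_⟩
    by_contra hc
    push Not at hc
    obtain ⟨z, hz⟩ : ∃ z, ∀ u ∈ U, (∃ k ∈ reachIn H (O \ {t}) x, H.Adj u k) → u = z := by
      by_cases h : ∃ z ∈ U, ∃ k ∈ reachIn H (O \ {t}) x, H.Adj z k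
      · obtain ⟨z, hz, k, hk, hzk⟩ := h
        refine ⟨z, fun u hu ⟨j, hj, huj⟩ => ?_⟩
        by_contra hne
        exact hc u hu z hz hne ⟨j, hj, huj⟩ k hk hzk
      · exact ⟨t, fun u hu h' => (h ⟨u, hu, h'⟩).elim⟩
    have := h3 (reachIn H (O \ {t}) x)
      (fun y hy => hB ▸ Or.inr (reachIn_subset x hy).1) ⟨x, mem_reachIn_self hx⟩ t z (by
      intro u hu huJ v hv hvu
      rw [hB] at hu
      rcases hu with hu | hu
      · exact Or.inr (hz u hu ⟨v, hv, hvu.symm⟩)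
      · by_contra hne
        exact huJ (reachIn_closed hv ⟨hu, fun e => hne (Or.inl e)⟩ hvu))
    have hUz : ∀ u ∈ U, u = z := by
      intro u hu
      have huO := Set.disjoint_left.1 hUO hu
      rcases this u (hB ▸ Or.inl hu) with h | h | h
      · exact (huO (reachIn_subset x h).1).elim
      · exact (huO (h ▸ ht)).elim
      · exact h
    obtain ⟨x, hx, y, hy, hxy⟩ := hU
    exact hxy ((hUz x hx).trans (hUz y hy).symm)
  obtain ⟨P, hPS, hmin⟩ := Set.exists_min_image S ncard (toFinite _) hSne
  obtain ⟨hPO, hP, hOP, p, hp, q, hq, hpq, hpP, hqP⟩ := id hPS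
  refine ⟨P, hPO, hP, hOP, p, hp, q, hq, hpq, hpP, hqP, ?_⟩
  have hPO' : P ⊆ O := hPO.trans sdiff_subset
  have hsplit : ∀ w ∈ P, (∃ o ∈ O \ P, H.Adj w o) → ∀ J ⊆ P \ {w}, Conn H J → ∀ u ∈ U, ∀ v ∈ U,
      (∃ j ∈ J, H.Adj u j) → (∃ j ∈ J, H.Adj v j) → u = v := by
    rintro w hw ⟨o, ho, hwo⟩ J hJ hc u hu v hv ⟨i, hi, hui⟩ ⟨j, hj, hvj⟩
    by_contra huv
    obtain ⟨x, hx⟩ := hc.1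
    have hsub := hc.subset_reachIn hJ hx
    refine absurd (hmin (reachIn H (P \ {w}) x) ⟨?_, conn_reachIn (hJ hx), ?_, u, hu, v, hv, huv,
      ⟨i, hsub hi, hui⟩, ⟨j, hsub hj, hvj⟩⟩) (not_le.2 (ncard_lt_ncard ⟨?_, ?_⟩))
    · exact (reachIn_subset x).trans (sdiff_subset.trans hPO)
    · exact hP.diff_reachIn hw (hOP.union_adj (conn_singleton w) ho rfl hwo.symm) hPO'
    · exact (reachIn_subset x).trans sdiff_subset
    · exact fun h => (reachIn_subset x (h hw)).2 rfl
  have hB' : B = U ∪ P ∪ O \ P := by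
    rw [hB, union_assoc, union_sdiff_cancel hPO']
  have hZ : ∃ w ∈ P, ∃ o ∈ O \ P, H.Adj w o := by
    obtain ⟨w, -, hw, o, ho, ho', hwo⟩ := hO.exists_adj P
      (hP.1.mono fun x hx => ⟨hPO' hx, hx⟩) ⟨t, ht, fun h => (hPO h).2 rfl⟩
    exact ⟨w, hw, o, ⟨ho, ho'⟩, hwo⟩
  obtain ⟨w, hw, ho, hcase⟩ := h3.exists_noncut hB' disjoint_sdiff_right
    (hUO.mono_right sdiff_subset) hOP.1 hP hZ hsplit
  rcases hcase with h | ⟨hP', w', hw', ho'⟩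
  · exact Or.inl ⟨w, h⟩
  refine Or.inr fun p hp q hq hpq hpP hqP => ⟨fun u hu huP => ?_, fun w hw ho J hJ hc hpJ hqJ =>
    hpq (hsplit w hw ho J hJ hc p hp q hq hpJ hqJ)⟩
  have h1 := hsplit w hw ho _ subset_rfl hP'
  have h2 := hsplit w' hw'.1 ho' {w} (by
    rintro x rfl
    exact ⟨hw, fun e => hw'.2 e.symm⟩) (conn_singleton w)
  have hside : ∀ p, (∃ k ∈ P, H.Adj p k) →
      (∃ k ∈ ({w} : Set V), H.Adj p k) ∨ ∃ k ∈ P \ {w}, H.Adj p k := by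
    rintro p ⟨k, hk, hpk⟩
    by_cases hkw : k = w
    · exact Or.inl ⟨k, hkw, hpk⟩
    · exact Or.inr ⟨k, ⟨hk, hkw⟩, hpk⟩
  rcases hside p hpP with hp' | hp' <;> rcases hside q hqP with hq' | hq' <;>
    rcases hside u huP with hu' | hu'
  · exact (hpq (h2 p hp q hq hp' hq')).elim
  · exact (hpq (h2 p hp q hq hp' hq')).elim
  · exact Or.inl (h2 u hu p hp hu' hp')
  · exact Or.inr (h1 u hu q hq hu' hq')
  · exact Or.inr (h2 u hu q hq hu' hq')
  · exact Or.inl (h1 u hu p hp hu' hp')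
  · exact (hpq (h1 p hp q hq hp' hq')).elim
  · exact (hpq (h1 p hp q hq hp' hq')).elim

/-- Replace a segment of the frontier by an ear attached at its ends. -/
lemma Sweep.replace [Finite V] {a : V} {B U O P : Set V} (h3 : ThreeConn H B)
    {p q : V} {A M C : List V} (h : Sweep H a (A ++ p :: (M ++ q :: C)) U) (hB : B = U ∪ O)
    (hUO : Disjoint U O) (hPO : P ⊆ O) (hP : Conn H P) (hO : (O \ P).Nonempty)
    (hp : ∃ k ∈ P, H.Adj p k) (hq : ∃ k ∈ P, H.Adj q k)
    (hmem : ∀ u ∈ U, (∃ k ∈ P, H.Adj u k) → u ∈ p :: (M ++ [q]))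
    (hcase : (∃ v, P = {v}) ∨
        (∀ u ∈ U, (∃ k ∈ P, H.Adj u k) → u = p ∨ u = q) ∧ NoBridge H P (O \ P) p q) :
    ∃ us : List V, us.Nodup ∧ (∀ v, v ∈ us ↔ v ∈ P) ∧ List.IsChain H.Adj (p :: (us ++ [q])) ∧
      Sweep H a (A ++ p :: (us ++ q :: C)) (U ∪ P) := by
  rcases hcase with ⟨v, rfl⟩ | ⟨hU, hstar⟩
  · obtain ⟨k, rfl, hpk⟩ := hp
    obtain ⟨k', hk', hqk⟩ := hq
    rw [mem_singleton_iff] at hk'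
    subst hk'
    refine ⟨[k'], by simp, by simp, by simp [hpk, hqk.symm], ?_⟩
    have h1 := h.dup
    have h2 := Sweep.dup (A := A ++ p :: p :: M) (x := q) (C := C) (by simpa using h1)
    have h3 := Sweep.cover (A := A ++ [p]) (B := p :: (M ++ [q])) (C := q :: C) (v := k')
      (by simpa using h2) (fun h => Set.disjoint_left.1 hUO h (hPO rfl)) (by simp)
      fun u hu hadj => hmem u hu ⟨k', rfl, hadj⟩
    rw [union_singleton]
    simpa using h3
  · have hs : Sweep H a (A ++ p :: q :: C) U := h.sublist
      ((List.Sublist.refl A).append ((List.sublist_append_right M (q :: C)).cons_cons p))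
    exact hs.thread h3 hO (by rw [hB, union_assoc, union_sdiff_cancel hPO]) (hUO.mono_right hPO)
      disjoint_sdiff_right (hUO.mono_right sdiff_subset) hP hp hq hU hstar

end Ear

section Obstructions

variable {V : Type*} {H : SimpleGraph V}

/-- Some edge joins `A` and `B`. -/
def Touch (H : SimpleGraph V) (A B : Set V) : Prop :=
  ∃ x ∈ A, ∃ y ∈ B, H.Adj x y

lemma Touch.symm {A B : Set V} (h : Touch H A B) : Touch H B A := by
  obtain ⟨x, hx, y, hy, hxy⟩ := h
  exact ⟨y, hy, x, hx, hxy.symm⟩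

lemma touch_singleton_left {a : V} {B : Set V} : Touch H {a} B ↔ ∃ k ∈ B, H.Adj a k := by
  simp [Touch]

lemma isMinor_completeGraph_five {D : Fin 5 → Set V} (hD : ∀ i, Conn H (D i))
    (hdisj : ∀ i j, i < j → Disjoint (D i) (D j)) (htouch : ∀ i j, i < j → Touch H (D i) (D j)) :
    IsMinor (⊤ : SimpleGraph (Fin 5)) H := by
  refine isMinor_iff.2 ⟨D, hD, fun i j hij => ?_, fun i j hij => ?_⟩
  · rcases lt_or_gt_of_ne hij with h | h
    · exact hdisj i j h
    · exact (hdisj j i h).symm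
  · rcases lt_or_gt_of_ne hij.ne with h | h
    · exact htouch i j h
    · exact (htouch j i h).symm

lemma isMinor_completeBipartiteGraph_three {D E : Fin 3 → Set V} (hD : ∀ i, Conn H (D i))
    (hE : ∀ i, Conn H (E i)) (hDD : ∀ i j, i < j → Disjoint (D i) (D j))
    (hEE : ∀ i j, i < j → Disjoint (E i) (E j)) (hDE : ∀ i j, Disjoint (D i) (E j))
    (htouch : ∀ i j, Touch H (D i) (E j)) :
    IsMinor (completeBipartiteGraph (Fin 3) (Fin 3)) H := by
  refine isMinor_iff.2 ⟨Sum.elim D E, ?_, ?_, ?_⟩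
  · rintro (i | i)
    · exact hD i
    · exact hE i
  · rintro (i | i) (j | j) hij
    · rcases lt_or_gt_of_ne fun e => hij (congrArg Sum.inl e) with h | h
      · exact hDD i j h
      · exact (hDD j i h).symm
    · exact hDE i j
    · exact (hDE j i).symm
    · rcases lt_or_gt_of_ne fun e => hij (congrArg Sum.inr e) with h | h
      · exact hEE i j h
      · exact (hEE j i h).symm
  · rintro (i | i) (j | j) hij
    · simp at hij
    · exact htouch i j
    · exact (htouch j i).symm
    · simp at hij

lemma conn_of_isChain {l : List V} (h : l.IsChain H.Adj) (hl : l ≠ []) : Conn H {v | v ∈ l} := by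
  induction l with
  | nil => exact (hl rfl).elim
  | cons x l ih =>
    cases l with
    | nil => simpa using conn_singleton x
    | cons y l =>
      rw [List.isChain_cons_cons] at h
      have := (conn_singleton x).union_adj (ih h.2 (by simp)) rfl (by simp) h.1
      convert this using 1
      ext z
      simp

lemma touch_of_isChain {A l₁ l₂ C : List V} (h : (A ++ (l₁ ++ (l₂ ++ C))).IsChain H.Adj)
    (h1 : l₁ ≠ []) (h2 : l₂ ≠ []) : Touch H {v | v ∈ l₁} {v | v ∈ l₂} := by
  obtain ⟨y, l₂, rfl⟩ := List.exists_cons_of_ne_nil h2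
  obtain ⟨l₁, x, rfl⟩ := List.eq_nil_or_concat l₁ |>.resolve_left h1
  refine ⟨x, by simp, y, by simp, ?_⟩
  have : (A ++ (l₁ ++ [x] ++ (y :: l₂ ++ C))) = (A ++ l₁) ++ x :: y :: (l₂ ++ C) := by simp
  rw [List.concat_eq_append, this, List.isChain_append, List.isChain_cons_cons] at h
  exact h.2.1.1

lemma conn_segment {A l C : List V} (h : (A ++ (l ++ C)).IsChain H.Adj) (hl : l ≠ []) :
    Conn H {v | v ∈ l} :=
  conn_of_isChain (List.isChain_append.1 (List.isChain_append.1 h).2.1).1 hl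

/-- A cycle with a crossing between two connected sets yields a `K₃,₃` minor. -/
lemma isMinor_of_crossing {a y : V} {l₁ l₂ : List V} {P Q : Set V}
    (hnd : (a :: (l₁ ++ y :: l₂)).Nodup) (hch : (a :: (l₁ ++ y :: l₂ ++ [a])).IsChain H.Adj)
    (hP : Conn H P) (hQ : Conn H Q) (hPQ : Disjoint P Q) (hPQt : Touch H P Q)
    (hlP : ∀ x ∈ a :: (l₁ ++ y :: l₂), x ∉ P) (hlQ : ∀ x ∈ a :: (l₁ ++ y :: l₂), x ∉ Q)
    (h1 : ∃ x ∈ l₁, ∃ k ∈ P, H.Adj x k) (h2 : ∃ x ∈ l₂, ∃ k ∈ P, H.Adj x k)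
    (ha : ∃ k ∈ Q, H.Adj a k) (hy : ∃ k ∈ Q, H.Adj y k) :
    IsMinor (completeBipartiteGraph (Fin 3) (Fin 3)) H := by
  have hn1 : l₁ ≠ [] := by
    rintro rfl
    simp at h1
  have hn2 : l₂ ≠ [] := by
    rintro rfl
    simp at h2
  have hc1 : Conn H {v | v ∈ l₁} := conn_segment (A := [a]) (C := y :: l₂ ++ [a])
    (by simpa using hch) hn1
  have hc2 : Conn H {v | v ∈ l₂} := conn_segment (A := a :: (l₁ ++ [y])) (C := [a])
    (by simpa using hch) hn2
  have ha1 : Touch H {a} {v | v ∈ l₁} := by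
    have := touch_of_isChain (A := []) (l₁ := [a]) (l₂ := l₁) (C := y :: l₂ ++ [a])
      (by simpa using hch) (by simp) hn1
    simpa using this
  have ha2 : Touch H {a} {v | v ∈ l₂} := by
    have := touch_of_isChain (A := a :: (l₁ ++ [y])) (l₁ := l₂) (l₂ := [a]) (C := [])
      (by simpa using hch) hn2 (by simp)
    simpa using this.symm
  have hy1 : Touch H {y} {v | v ∈ l₁} := by
    have := touch_of_isChain (A := [a]) (l₁ := l₁) (l₂ := [y]) (C := l₂ ++ [a])
      (by simpa using hch) hn1 (by simp)
    simpa using this.symm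
  have hy2 : Touch H {y} {v | v ∈ l₂} := by
    have := touch_of_isChain (A := a :: l₁) (l₁ := [y]) (l₂ := l₂) (C := [a])
      (by simpa using hch) (by simp) hn2
    simpa using this
  simp only [List.nodup_cons, List.nodup_append, List.mem_append, List.mem_cons] at hnd hlP hlQ
  refine isMinor_completeBipartiteGraph_three (D := ![P, {a}, {y}])
    (E := ![Q, {v | v ∈ l₁}, {v | v ∈ l₂}]) ?_ ?_ ?_ ?_ ?_ ?_
  · simp [Fin.forall_fin_succ, hP, conn_singleton]
  · simp [Fin.forall_fin_succ, hQ, hc1, hc2]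
  · simp only [Set.disjoint_left, Fin.forall_fin_succ]
    simp
    grind
  · simp only [Set.disjoint_left, Fin.forall_fin_succ]
    simp
    grind
  · simp only [Fin.forall_fin_succ]
    simp only [Set.disjoint_left] at hPQ ⊢
    simp
    grind
  · simp only [← touch_singleton_left] at ha hy
    have hP1 : Touch H P {v | v ∈ l₁} := Touch.symm h1
    have hP2 : Touch H P {v | v ∈ l₂} := Touch.symm h2
    simp only [Fin.forall_fin_succ]
    simp [hPQt, hP1, hP2, ha, hy, ha1, ha2, hy1, hy2]

lemma isMinor_of_double_attachment {a : V} {l₁ l₂ : List V} {P Q : Set V}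
    (hnd : (a :: (l₁ ++ l₂)).Nodup) (hch : (a :: (l₁ ++ l₂ ++ [a])).IsChain H.Adj)
    (hP : Conn H P) (hQ : Conn H Q) (hPQ : Disjoint P Q) (hPQt : Touch H P Q)
    (hlP : ∀ x ∈ a :: (l₁ ++ l₂), x ∉ P) (hlQ : ∀ x ∈ a :: (l₁ ++ l₂), x ∉ Q)
    (hP1 : ∃ x ∈ l₁, ∃ k ∈ P, H.Adj x k) (hP2 : ∃ x ∈ l₂, ∃ k ∈ P, H.Adj x k)
    (hQ1 : ∃ x ∈ l₁, ∃ k ∈ Q, H.Adj x k) (hQ2 : ∃ x ∈ l₂, ∃ k ∈ Q, H.Adj x k)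
    (haP : ∃ k ∈ P, H.Adj a k) (haQ : ∃ k ∈ Q, H.Adj a k) :
    IsMinor (⊤ : SimpleGraph (Fin 5)) H := by
  have hn1 : l₁ ≠ [] := by
    rintro rfl
    simp at hP1
  have hn2 : l₂ ≠ [] := by
    rintro rfl
    simp at hP2
  have hc1 : Conn H {v | v ∈ l₁} := conn_segment (A := [a]) (C := l₂ ++ [a])
    (by simpa using hch) hn1
  have hc2 : Conn H {v | v ∈ l₂} := conn_segment (A := a :: l₁) (C := [a])
    (by simpa using hch) hn2
  have ha1 : Touch H {a} {v | v ∈ l₁} := by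
    have := touch_of_isChain (A := []) (l₁ := [a]) (l₂ := l₁) (C := l₂ ++ [a])
      (by simpa using hch) (by simp) hn1
    simpa using this
  have ha2 : Touch H {a} {v | v ∈ l₂} := by
    have := touch_of_isChain (A := a :: l₁) (l₁ := l₂) (l₂ := [a]) (C := [])
      (by simpa using hch) hn2 (by simp)
    simpa using this.symm
  have h12 : Touch H {v | v ∈ l₁} {v | v ∈ l₂} :=
    touch_of_isChain (A := [a]) (C := [a]) (by simpa using hch) hn1 hn2
  simp only [List.nodup_cons, List.nodup_append, List.mem_append, List.mem_cons] at hnd hlP hlQ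
  refine isMinor_completeGraph_five (D := ![P, Q, {a}, {v | v ∈ l₁}, {v | v ∈ l₂}]) ?_ ?_ ?_
  · simp [Fin.forall_fin_succ, hP, hQ, conn_singleton, hc1, hc2]
  · simp only [Fin.forall_fin_succ]
    simp only [Set.disjoint_left] at hPQ ⊢
    simp
    grind
  · rw [← touch_singleton_left] at haP haQ
    have h1 : Touch H P {v | v ∈ l₁} := Touch.symm hP1
    have h2 : Touch H P {v | v ∈ l₂} := Touch.symm hP2
    have h3 : Touch H Q {v | v ∈ l₁} := Touch.symm hQ1
    have h4 : Touch H Q {v | v ∈ l₂} := Touch.symm hQ2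
    simp only [Fin.forall_fin_succ]
    simp [hPQt, h1, h2, h3, h4, h12, ha1, ha2, haP.symm, haQ.symm]

end Obstructions

section Frontier

variable {V : Type*} {H : SimpleGraph V}

lemma exists_first {α : Type*} {p : α → Prop} {l : List α} (h : ∃ x ∈ l, p x) :
    ∃ A x C, l = A ++ x :: C ∧ p x ∧ ∀ y ∈ A, ¬ p y := by
  induction l with
  | nil => simp at h
  | cons z l ih =>
    by_cases hz : p z
    · exact ⟨[], z, l, rfl, hz, by simp⟩
    · obtain ⟨A, x, C, rfl, hx, hA⟩ := ih (by
        obtain ⟨x, hx, hpx⟩ := h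
        rcases List.mem_cons.1 hx with rfl | hx
        · exact (hz hpx).elim
        · exact ⟨x, hx, hpx⟩)
      exact ⟨z :: A, x, C, rfl, hx, by simpa [hz] using hA⟩

lemma exists_last {α : Type*} {p : α → Prop} {l : List α} (h : ∃ x ∈ l, p x) :
    ∃ A x C, l = A ++ x :: C ∧ p x ∧ ∀ y ∈ C, ¬ p y := by
  obtain ⟨A, x, C, hl, hx, hA⟩ := exists_first (l := l.reverse) (by simpa using h)
  refine ⟨C.reverse, x, A.reverse, ?_, hx, by simpa using hA⟩
  rw [← List.reverse_reverse l, hl]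
  simp

/-- The ends of a segment of the cyclic frontier, with the frontiers obtained by replacing its
interior. -/
structure IsArc (a : V) (l : List V) (A : List V) (p : V) (M : List V) (q : V) (C : List V) :
    Prop where
  ne : p ≠ q
  left_mem : p ∈ a :: l
  right_mem : q ∈ a :: l
  eq : a :: (l ++ [a]) = A ++ p :: (M ++ q :: C)
  replace : ∀ us : List V, us.Nodup → (∀ v ∈ us, v ∉ a :: l) → ∃ l', (a :: l').Nodup ∧
    a :: (l' ++ [a]) = A ++ p :: (us ++ q :: C) ∧ (∀ x ∈ us, x ∈ a :: l') ∧
    ∀ x ∈ a :: l, x ∉ M → x ∈ a :: l'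

lemma isArc_inner {a p q : V} {A M C : List V} (h : (a :: (A ++ p :: (M ++ q :: C))).Nodup) :
    IsArc a (A ++ p :: (M ++ q :: C)) (a :: A) p M q (C ++ [a]) where
  ne := by
    rintro rfl
    simp [List.nodup_append] at h
  left_mem := by simp
  right_mem := by simp
  eq := by simp
  replace us hus hd := by
    refine ⟨A ++ p :: (us ++ q :: C), ?_, by simp, by simp +contextual, by simp; grind⟩
    simp only [List.nodup_cons, List.nodup_append, List.mem_append, List.mem_cons] at h hd ⊢
    grind

lemma isArc_left {a q : V} {M C : List V} (h : (a :: (M ++ q :: C)).Nodup) :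
    IsArc a (M ++ q :: C) [] a M q (C ++ [a]) where
  ne := by
    rintro rfl
    simp at h
  left_mem := by simp
  right_mem := by simp
  eq := by simp
  replace us hus hd := by
    refine ⟨us ++ q :: C, ?_, by simp, by simp +contextual, by simp; grind⟩
    simp only [List.nodup_cons, List.nodup_append, List.mem_append, List.mem_cons] at h hd ⊢
    grind

lemma isArc_right {a p : V} {A M : List V} (h : (a :: (A ++ p :: M)).Nodup) :
    IsArc a (A ++ p :: M) (a :: A) p M a [] where
  ne := by
    rintro rfl
    simp at h
  left_mem := by simp
  right_mem := by simp
  eq := by simp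
  replace us hus hd := by
    refine ⟨A ++ p :: us, ?_, by simp, by simp +contextual, by simp; grind⟩
    simp only [List.nodup_cons, List.nodup_append, List.mem_append, List.mem_cons] at h hd ⊢
    grind

/-- The neighbours of `P` on the frontier lie on an arc whose interior avoids the neighbours
of `Q`. -/
lemma exists_isArc {a : V} {l : List V} {P Q : Set V}
    (hK5 : ¬ IsMinor (⊤ : SimpleGraph (Fin 5)) H)
    (hK33 : ¬ IsMinor (completeBipartiteGraph (Fin 3) (Fin 3)) H)
    (hnd : (a :: l).Nodup) (hch : (a :: (l ++ [a])).IsChain H.Adj)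
    (hP : Conn H P) (hQ : Conn H Q) (hPQ : Disjoint P Q) (hPQt : Touch H P Q)
    (hlP : ∀ x ∈ a :: l, x ∉ P) (hlQ : ∀ x ∈ a :: l, x ∉ Q) (haQ : ∃ k ∈ Q, H.Adj a k)
    (htwo : ∃ p ∈ a :: l, ∃ q ∈ a :: l, p ≠ q ∧ (∃ k ∈ P, H.Adj p k) ∧ ∃ k ∈ P, H.Adj q k) :
    ∃ A p M q C, IsArc a l A p M q C ∧ (∃ k ∈ P, H.Adj p k) ∧ (∃ k ∈ P, H.Adj q k) ∧
      (∀ u ∈ a :: l, (∃ k ∈ P, H.Adj u k) → u ∈ p :: (M ++ [q])) ∧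
      ∀ y ∈ M, ¬ ∃ k ∈ Q, H.Adj y k := by
  have cross : ∀ l₁ y l₂, l = l₁ ++ y :: l₂ → (∃ x ∈ l₁, ∃ k ∈ P, H.Adj x k) →
      (∃ x ∈ l₂, ∃ k ∈ P, H.Adj x k) → ¬ ∃ k ∈ Q, H.Adj y k := by
    rintro l₁ y l₂ rfl h1 h2 hy
    exact hK33 (isMinor_of_crossing hnd (by simpa using hch) hP hQ hPQ hPQt hlP hlQ h1 h2 haQ hy)
  obtain ⟨x, hxl, hx⟩ : ∃ x ∈ l, ∃ k ∈ P, H.Adj x k := by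
    obtain ⟨p, hp, q, hq, hpq, hpP, hqP⟩ := htwo
    rcases List.mem_cons.1 hp with rfl | hp
    · rcases List.mem_cons.1 hq with rfl | hq
      · exact (hpq rfl).elim
      · exact ⟨q, hq, hqP⟩
    · exact ⟨p, hp, hpP⟩
  obtain ⟨L, q, C, rfl, hq, hC⟩ := exists_last (p := fun x => ∃ k ∈ P, H.Adj x k) ⟨x, hxl, hx⟩
  by_cases haP : ∃ k ∈ P, H.Adj a k
  · by_cases hLQ : ∃ y ∈ L, ∃ k ∈ Q, H.Adj y k
    swap
    · refine ⟨_, _, _, _, _, isArc_left hnd, haP, hq, fun u hu huP => ?_,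
        fun y hy hyQ => hLQ ⟨y, hy, hyQ⟩⟩
      have := hC u
      grind
    by_cases hLP : ∃ y ∈ L, ∃ k ∈ P, H.Adj y k
    · obtain ⟨A, p, M, rfl, hp, hA⟩ := exists_first hLP
      by_cases hMQ : ∃ y ∈ M ++ q :: C, ∃ k ∈ Q, H.Adj y k
      swap
      · refine ⟨a :: A, p, M ++ q :: C, a, [], ?_, hp, haP, fun u hu huP => ?_,
          fun y hy hyQ => hMQ ⟨y, hy, hyQ⟩⟩
        · have := isArc_right (a := a) (p := p) (A := A) (M := M ++ q :: C) (by simpa using hnd)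
          simpa using this
        · have := hA u
          grind
      exfalso
      have hM : ∀ y ∈ M, ¬ ∃ k ∈ Q, H.Adj y k := by
        intro y hy
        obtain ⟨M₁, M₂, rfl⟩ := List.append_of_mem hy
        exact cross (A ++ p :: M₁) y (M₂ ++ q :: C) (by simp) ⟨p, by simp, hp⟩ ⟨q, by simp, hq⟩
      refine hK5 (isMinor_of_double_attachment (l₁ := A ++ [p]) (l₂ := M ++ q :: C)
        (by simpa using hnd) (by simpa using hch) hP hQ hPQ hPQt (by simpa using hlP)
        (by simpa using hlQ) ⟨p, by simp, hp⟩ ⟨q, by simp, hq⟩ ?_ hMQ haP haQ)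
      obtain ⟨y, hy, hyQ⟩ := hLQ
      refine ⟨y, ?_, hyQ⟩
      have := hM y
      grind
    · by_cases hCQ : ∃ y ∈ C, ∃ k ∈ Q, H.Adj y k
      · exact (hK33 (isMinor_of_crossing hnd (by simpa using hch) hQ hP hPQ.symm hPQt.symm hlQ hlP
          hLQ hCQ haP hq)).elim
      · refine ⟨_, _, _, _, _, isArc_right hnd, hq, haP, fun u hu huP => ?_,
          fun y hy hyQ => hCQ ⟨y, hy, hyQ⟩⟩
        have : u ∉ L := fun h => hLP ⟨u, h, huP⟩
        grind
  · have hLP : ∃ y ∈ L, ∃ k ∈ P, H.Adj y k := by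
      by_contra hL
      have : ∀ u ∈ a :: (L ++ q :: C), (∃ k ∈ P, H.Adj u k) → u = q := by
        intro u hu huP
        have h1 : u ∉ L := fun h => hL ⟨u, h, huP⟩
        have h2 : u ≠ a := fun h => haP (h ▸ huP)
        have := hC u
        grind
      obtain ⟨p, hp, q', hq', hpq, hpP, hqP⟩ := htwo
      exact hpq ((this p hp hpP).trans (this q' hq' hqP).symm)
    obtain ⟨A, p, M, rfl, hp, hA⟩ := exists_first hLP
    refine ⟨a :: A, p, M, q, C ++ [a], ?_, hp, hq, fun u hu huP => ?_, fun y hy => ?_⟩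
    · have := isArc_inner (a := a) (p := p) (A := A) (M := M) (q := q) (C := C)
        (by simpa using hnd)
      simpa using this
    · have h1 := hA u
      have h2 := hC u
      have h3 : u ≠ a := fun h => haP (h ▸ huP)
      grind
    · obtain ⟨M₁, M₂, rfl⟩ := List.append_of_mem hy
      exact cross (A ++ p :: M₁) y (M₂ ++ q :: C) (by simp) ⟨p, by simp, hp⟩ ⟨q, by simp, hq⟩

end Frontier

section ThreeConnected

variable {V : Type*} {H : SimpleGraph V}

/-- A sweep of `U` with cyclic frontier `a :: l` enclosing the rest of `B`. -/
structure IsFrontier (H : SimpleGraph V) (B : Set V) (a t : V) (U : Set V) (l : List V) :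
    Prop where
  sweep : Sweep H a (a :: (l ++ [a])) U
  nodup : (a :: l).Nodup
  chain : (a :: (l ++ [a])).IsChain H.Adj
  ne_nil : l ≠ []
  subset : U ⊆ B
  conn : Conn H (B \ U)
  mem : t ∈ B \ U
  letters : ∀ u ∈ U, (∃ o ∈ B \ U, H.Adj u o) → u ∈ a :: l

lemma IsFrontier.mem_of_mem {B U : Set V} {a t : V} {l : List V} (h : IsFrontier H B a t U l) :
    ∀ x ∈ a :: l, x ∈ U :=
  fun x hx => h.sweep.mem_of_mem x (by simp only [List.mem_cons, List.mem_append] at hx ⊢; tauto)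

lemma IsFrontier.advance [Finite V] (hK5 : ¬ IsMinor (⊤ : SimpleGraph (Fin 5)) H)
    (hK33 : ¬ IsMinor (completeBipartiteGraph (Fin 3) (Fin 3)) H) {B U : Set V} {a t : V}
    {l : List V} (h3 : ThreeConn H B) (hat : H.Adj a t) (h : IsFrontier H B a t U l)
    (hne : ((B \ U) \ {t}).Nonempty) : ∃ U' l', IsFrontier H B a t U' l' ∧ U ⊂ U' := by
  have hB : B = U ∪ B \ U := (union_sdiff_cancel h.subset).symm
  have hlU := h.mem_of_mem
  obtain ⟨P, hPO, hP, hOP, p, hp, q, hq, hpq, hpP, hqP, hcase⟩ :=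
    h3.exists_ear hB disjoint_sdiff_right h.conn h.mem hne (by
      obtain ⟨y, l₁, hl⟩ := List.exists_cons_of_ne_nil h.ne_nil
      refine ⟨a, hlU a (by simp), y, hlU y (by simp [hl]), ?_⟩
      rintro rfl
      have := h.nodup
      simp [hl] at this)
  have hPO' : P ⊆ B \ U := hPO.trans sdiff_subset
  have htP : t ∉ P := fun h => (hPO h).2 rfl
  have hPletters : ∀ u ∈ U, (∃ k ∈ P, H.Adj u k) → u ∈ a :: l := by
    rintro u hu ⟨k, hk, huk⟩
    exact h.letters u hu ⟨k, hPO' hk, huk⟩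
  have hPQt : Touch H P ((B \ U) \ P) := by
    obtain ⟨x, -, hx, y, hy, hy', hxy⟩ := h.conn.exists_adj P
      (hP.1.mono fun x hx => ⟨hPO' hx, hx⟩) ⟨t, h.mem, htP⟩
    exact ⟨x, hx, y, ⟨hy, hy'⟩, hxy⟩
  obtain ⟨A, p', M, q', C, harc, hp', hq', hPM, hMQ⟩ := exists_isArc hK5 hK33 h.nodup h.chain hP hOP
    disjoint_sdiff_right hPQt (fun x hx hxP => (hPO' hxP).2 (hlU x hx))
    (fun x hx hxO => hxO.1.2 (hlU x hx)) ⟨t, ⟨h.mem, htP⟩, hat⟩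
    ⟨p, hPletters p hp hpP, q, hPletters q hq hqP, hpq, hpP, hqP⟩
  obtain ⟨us, hus, husP, husc, hsw⟩ := Sweep.replace (O := B \ U) h3 (harc.eq ▸ h.sweep) hB
    disjoint_sdiff_right hPO' hP hOP.1 hp' hq' (fun u hu hk => hPM u (hPletters u hu hk) hk)
    (hcase.imp id fun hc =>
      hc p' (hlU _ harc.left_mem) q' (hlU _ harc.right_mem) harc.ne hp' hq')
  obtain ⟨l', hnd, heq, husl, hkeep⟩ := harc.replace us hus fun v hv hvl =>
    (hPO' ((husP v).1 hv)).2 (hlU v hvl)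
  obtain ⟨x, hx⟩ := hP.1
  have hd : B \ (U ∪ P) = (B \ U) \ P := sdiff_sdiff.symm
  refine ⟨U ∪ P, l', ⟨heq ▸ hsw, hnd, ?_, ?_, ?_, hd ▸ hOP, hd ▸ ⟨h.mem, htP⟩, ?_⟩,
    subset_union_left, fun hs => (hPO' hx).2 (hs (Or.inr hx))⟩
  · have h1 := harc.eq ▸ h.chain
    rw [heq]
    rw [List.isChain_split] at h1 ⊢
    refine ⟨h1.1, ?_⟩
    have h2 := h1.2
    rw [← List.cons_append, List.isChain_split] at h2 ⊢
    exact ⟨by simpa using husc, h2.2⟩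
  · rintro rfl
    have := husl x ((husP x).2 hx)
    have hxa : x = a := by simpa using this
    exact (hPO' hx).2 (hlU x (by simp [hxa]))
  · exact union_subset h.subset (hPO'.trans sdiff_subset)
  · rintro u (hu | hu) ⟨o, ho, huo⟩
    · rw [hd] at ho
      exact hkeep u (h.letters u hu ⟨o, ho.1, huo⟩) fun hM => hMQ u hM ⟨o, ho, huo⟩
    · exact husl u ((husP u).2 hu)

lemma IsFrontier.sweepable [Finite V] (hK5 : ¬ IsMinor (⊤ : SimpleGraph (Fin 5)) H)
    (hK33 : ¬ IsMinor (completeBipartiteGraph (Fin 3) (Fin 3)) H) {B U : Set V} {a t : V}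
    {l : List V} (h3 : ThreeConn H B) (hat : H.Adj a t) (h : IsFrontier H B a t U l) :
    Sweepable H B a t := by
  induction hn : (B \ U).ncard using Nat.strong_induction_on generalizing U l with
  | _ n ih =>
  subst hn
  by_cases hne : ((B \ U) \ {t}).Nonempty
  · obtain ⟨U', l', h', hU⟩ := h.advance hK5 hK33 h3 hat hne
    refine ih _ (ncard_lt_ncard ⟨sdiff_subset_sdiff_right hU.1, fun hs => hU.2 fun x hx => ?_⟩) h'
      rfl
    by_contra hxU
    exact (hs ⟨h'.subset hx, hxU⟩).2 hx
  · rw [Set.not_nonempty_iff_eq_empty, sdiff_eq_empty] at hne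
    have hU : U = B \ {t} := by
      ext x
      constructor
      · exact fun hx => ⟨h.subset hx, fun e => h.mem.2 (e ▸ hx)⟩
      · rintro ⟨hx, hxt⟩
        by_contra hxU
        exact hxt (hne ⟨hx, hxU⟩)
    refine ⟨_, hU ▸ h.sweep, fun v hv hvt => ?_⟩
    have := h.letters v (hU ▸ ⟨hv, fun e => hvt.ne e⟩) ⟨t, h.mem, hvt⟩
    simp only [List.mem_cons, List.mem_append] at this ⊢
    tauto

lemma sweepable_of_threeConn [Finite V] (hK5 : ¬ IsMinor (⊤ : SimpleGraph (Fin 5)) H)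
    (hK33 : ¬ IsMinor (completeBipartiteGraph (Fin 3) (Fin 3)) H) {B : Set V} {a t : V}
    (h3 : ThreeConn H B) (ha : a ∈ B) (ht : t ∈ B) (hat : H.Adj a t) : Sweepable H B a t := by
  by_cases hw : ∃ w ∈ B, w ≠ t ∧ H.Adj a w
  · obtain ⟨w, hw, hwt, haw⟩ := hw
    have htO : t ∈ B \ {w, a} := ⟨ht, by simp [hwt.symm, hat.ne']⟩
    have hc : B \ {w, a} ⊆ reachIn H (B \ {w, a}) t := by
      rintro x ⟨hx, hxn⟩
      have := h3 (reachIn H (B \ {w, a}) t) ((reachIn_subset t).trans sdiff_subset)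
        ⟨t, mem_reachIn_self htO⟩ w a (fun u hu huJ v hv hvu => by
          by_contra hne
          exact huJ (reachIn_closed hv ⟨hu, hne⟩ hvu)) x hx
      exact this.resolve_right hxn
    have h0 : Sweep H a [a, a] {a} := Sweep.dup (A := []) (C := []) Sweep.init
    have h1 : Sweep H a [a, a, a] {a} := Sweep.dup (A := []) (C := [a]) h0
    have h2 : Sweep H a [a, w, a] {w, a} := Sweep.cover (A := [a]) (B := [a]) (C := [a]) (v := w)
      h1 (by simpa using haw.ne') (by simp) (by simp)
    refine IsFrontier.sweepable (U := {w, a}) (l := [w]) hK5 hK33 h3 hat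
      ⟨h2, ?_, ?_, by simp, ?_, ?_, htO, ?_⟩
    · simpa using haw.ne
    · simp [haw, haw.symm]
    · rintro x (rfl | rfl)
      · exact hw
      · exact ha
    · rw [subset_antisymm hc (reachIn_subset t)]
      exact conn_reachIn htO
    · rintro u (rfl | rfl) - <;> simp
  · push Not at hw
    have hB : B \ {t} = {a} := by
      ext x
      constructor
      · rintro ⟨hx, hxt⟩
        have := h3 {a} (singleton_subset_iff.2 ha) (singleton_nonempty a) t t (by
          rintro u hu - v rfl hvu
          by_contra hne
          exact hw u hu (fun e => hne (Or.inl e)) hvu) x hx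
        simpa [show x ≠ t from hxt] using this
      · rintro rfl
        exact ⟨ha, hat.ne⟩
    refine ⟨[a], hB ▸ Sweep.init, fun v hv hvt => ?_⟩
    have : v ∈ B \ {t} := ⟨hv, hvt.ne⟩
    rw [hB] at this
    simpa using this

end ThreeConnected

section CliqueSum

variable {V : Type*} {X : Type*} {H : SimpleGraph V} {K : SimpleGraph X}

/-- `K` is a minor of `H[S]`. -/
def MinorIn (K : SimpleGraph X) (H : SimpleGraph V) (S : Set V) : Prop :=
  ∃ D : X → Set V, (∀ w, Conn H (D w)) ∧ (∀ w, D w ⊆ S) ∧ (∀ w w', w ≠ w' → Disjoint (D w) (D w')) ∧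
    ∀ w w', K.Adj w w' → Touch H (D w) (D w')

lemma minorIn_univ : MinorIn K H univ ↔ IsMinor K H := by
  rw [isMinor_iff]
  constructor
  · rintro ⟨D, h1, -, h2, h3⟩
    exact ⟨D, h1, h2, h3⟩
  · rintro ⟨D, h1, h2, h3⟩
    exact ⟨D, h1, fun w => subset_univ _, h2, h3⟩

lemma MinorIn.isMinor {S : Set V} {H' : SimpleGraph V} (h : MinorIn K H S)
    (hS : ∀ x ∈ S, ∀ y ∈ S, H.Adj x y → H'.Adj x y) : IsMinor K H' := by
  obtain ⟨D, h1, h2, h3, h4⟩ := h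
  refine isMinor_iff.2 ⟨D, fun w => (h1 w).mono_adj fun x hx y hy => hS x (h2 w hx) y (h2 w hy), h3,
    fun w w' hw => ?_⟩
  obtain ⟨x, hx, y, hy, hxy⟩ := h4 w w' hw
  exact ⟨x, hx, y, hy, hS x (h2 _ hx) y (h2 _ hy) hxy⟩

/-- A graph with at least four vertices that stays connected when two vertices are deleted. -/
structure Tough (K : SimpleGraph X) : Prop where
  conn : ∀ p q, Conn K {w | w ≠ p ∧ w ≠ q}
  exists_adj : ∀ p q, ∃ w, w ≠ p ∧ w ≠ q ∧ K.Adj p w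
  exists_four : ∃ f : Fin 4 → X, Function.Injective f

lemma tough_of_common_adj (hne : ∀ p q : X, ∃ w, w ≠ p ∧ w ≠ q)
    (hcom : ∀ p q x y, y ≠ p → y ≠ q → x = y ∨ K.Adj x y ∨
      ∃ z, z ≠ p ∧ z ≠ q ∧ K.Adj x z ∧ K.Adj z y)
    (hf : ∃ f : Fin 4 → X, Function.Injective f) : Tough K := by
  refine ⟨fun p q => conn_of_closed (hne p q) ?_, fun p q => ?_, hf⟩
  · rintro P ⟨x, hx, hxP⟩ hP y hy
    rcases hcom p q x y hy.1 hy.2 with rfl | h | ⟨z, hzp, hzq, hxz, hzy⟩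
    · exact hxP
    · exact hP x hx hxP y hy h
    · exact hP z ⟨hzp, hzq⟩ (hP x hx hxP z ⟨hzp, hzq⟩ hxz) y hy hzy
  · obtain ⟨w, hwp, hwq⟩ := hne p q
    rcases hcom p q p w hwp hwq with h | h | ⟨z, hzp, hzq, hxz, -⟩
    · exact (hwp h.symm).elim
    · exact ⟨w, hwp, hwq, h⟩
    · exact ⟨z, hzp, hzq, hxz⟩

lemma tough_top_fin_five : Tough (⊤ : SimpleGraph (Fin 5)) :=
  tough_of_common_adj (by decide) (fun p q x y _ _ => by
    by_cases h : x = y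
    · exact Or.inl h
    · exact Or.inr (Or.inl h)) ⟨Fin.castLE (by norm_num), Fin.castLE_injective _⟩

lemma tough_completeBipartiteGraph :
    Tough (completeBipartiteGraph (Fin 3) (Fin 3)) := by
  have hl : ∀ p q : Fin 3 ⊕ Fin 3, ∃ z : Fin 3, Sum.inl z ≠ p ∧ Sum.inl z ≠ q := by decide
  have hr : ∀ p q : Fin 3 ⊕ Fin 3, ∃ z : Fin 3, Sum.inr z ≠ p ∧ Sum.inr z ≠ q := by decide
  refine tough_of_common_adj (fun p q => ?_) (fun p q x y _ _ => ?_)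
    ⟨fun i => if h : i.1 < 3 then Sum.inl ⟨i.1, h⟩ else Sum.inr 0, by decide⟩
  · obtain ⟨z, hz⟩ := hl p q
    exact ⟨_, hz⟩
  · rcases x with x | x <;> rcases y with y | y
    · obtain ⟨z, hz⟩ := hr p q
      exact Or.inr (Or.inr ⟨_, hz.1, hz.2, by simp, by simp⟩)
    · exact Or.inr (Or.inl (by simp))
    · exact Or.inr (Or.inl (by simp))
    · obtain ⟨z, hz⟩ := hl p q
      exact Or.inr (Or.inr ⟨_, hz.1, hz.2, by simp, by simp⟩)

lemma Tough.not_minorIn (hK : Tough K) {x y z : V} {S : Set V}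
    (hS : ∀ u ∈ S, u = x ∨ u = y ∨ u = z) : ¬ MinorIn K H S := by
  rintro ⟨D, h1, h2, h3, -⟩
  obtain ⟨f, hf⟩ := hK.exists_four
  choose g hg using fun i => (h1 (f i)).nonempty
  have hgi : Function.Injective g := by
    intro i j hij
    by_contra hne
    exact Set.disjoint_left.1 (h3 _ _ fun e => hne (hf e)) (hg i) (hij ▸ hg j)
  classical
  have hsub : Finset.univ.image g ⊆ {x, y, z} := by
    intro u hu
    obtain ⟨i, -, rfl⟩ := Finset.mem_image.1 hu
    simpa using hS _ (h2 _ (hg i))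
  have := Finset.card_le_card hsub
  rw [Finset.card_image_of_injective _ hgi, Finset.card_univ, Fintype.card_fin] at this
  have h4 := Finset.card_le_three (a := x) (b := y) (c := z)
  omega

/-- There are no edges between `A \ B` and `B \ A`. -/
def NoCross (H : SimpleGraph V) (A B : Set V) : Prop :=
  ∀ u ∈ A, u ∉ B → ∀ v ∈ B, v ∉ A → ¬ H.Adj u v

lemma NoCross.symm {A B : Set V} (h : NoCross H A B) : NoCross H B A :=
  fun u hu hu' v hv hv' huv => h v hv hv' u hu hu' huv.symm

lemma minorIn_inter {A B : Set V} (hno : NoCross H A B)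
    (hcl : ∀ u ∈ A, u ∈ B → ∀ v ∈ A, v ∈ B → u ≠ v → H.Adj u v) {D : X → Set V}
    (h1 : ∀ w, Conn H (D w)) (h2 : ∀ w, D w ⊆ A ∪ B)
    (h3 : ∀ w w', w ≠ w' → Disjoint (D w) (D w'))
    (h4 : ∀ w w', K.Adj w w' → Touch H (D w) (D w')) (h5 : ∀ w, (D w ∩ A).Nonempty) :
    MinorIn K H A := by
  refine ⟨fun w => D w ∩ A, fun w => conn_of_closed (h5 w) ?_, fun w => inter_subset_right,
    fun w w' hw => (h3 w w' hw).mono inter_subset_left inter_subset_left, ?_⟩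
  · rintro P ⟨z, ⟨hz, hzA⟩, hzP⟩ hP
    have : D w ⊆ {z | z ∈ P ∧ z ∈ A ∨ z ∉ A ∧ ∃ s ∈ D w, s ∈ A ∧ s ∈ B ∧ s ∈ P} := by
      refine (h1 w).subset_of_closed ⟨z, hz, Or.inl ⟨hzP, hzA⟩⟩ ?_
      rintro u hu (⟨huP, huA⟩ | ⟨huA, s, hs, hsA, hsB, hsP⟩) v hv huv
      · by_cases hvA : v ∈ A
        · exact Or.inl ⟨hP u ⟨hu, huA⟩ huP v ⟨hv, hvA⟩ huv, hvA⟩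
        · refine Or.inr ⟨hvA, u, hu, huA, ?_, huP⟩
          by_contra huB
          exact hno u huA huB v ((h2 w hv).resolve_left hvA) hvA huv
      · by_cases hvA : v ∈ A
        · refine Or.inl ⟨?_, hvA⟩
          have hvB : v ∈ B := by
            by_contra hvB
            exact hno v hvA hvB u ((h2 w hu).resolve_left huA) huA huv.symm
          by_cases hsv : s = v
          · exact hsv ▸ hsP
          · exact hP s ⟨hs, hsA⟩ hsP v ⟨hv, hvA⟩ (hcl s hsA hsB v hvA hvB hsv)
        · exact Or.inr ⟨hvA, s, hs, hsA, hsB, hsP⟩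
    rintro u ⟨hu, huA⟩
    rcases this hu with h | h
    · exact h.1
    · exact (h.1 huA).elim
  · intro w w' hw
    obtain ⟨x, hx, y, hy, hxy⟩ := h4 w w' hw
    by_cases hxy' : x ∈ A ∧ y ∈ A
    · exact ⟨x, ⟨hx, hxy'.1⟩, y, ⟨hy, hxy'.2⟩, hxy⟩
    have hB : x ∈ B ∧ y ∈ B := by
      have := h2 _ hx
      have := h2 _ hy
      have := hno x
      have := hno.symm x
      simp only [mem_union] at *
      by_contra hc
      grind
    have key : ∀ w, (D w ∩ B).Nonempty → ∃ s ∈ D w, s ∈ A ∧ s ∈ B := by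
      intro w hB
      by_contra hc
      push Not at hc
      obtain ⟨z, hz, hzA⟩ := h5 w
      have := (h1 w).subset_of_closed (P := A) ⟨z, hz, hzA⟩ (by
        intro u hu huA v hv huv
        by_contra hvA
        exact hno u huA (hc u hu huA) v ((h2 w hv).resolve_left hvA) hvA huv)
      obtain ⟨b, hb, hbB⟩ := hB
      exact hc b hb (this hb) hbB
    obtain ⟨s, hs, hsA, hsB⟩ := key w ⟨x, hx, hB.1⟩
    obtain ⟨t, ht, htA, htB⟩ := key w' ⟨y, hy, hB.2⟩
    exact ⟨s, ⟨hs, hsA⟩, t, ⟨ht, htA⟩, hcl s hsA hsB t htA htB fun e =>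
      Set.disjoint_left.1 (h3 w w' hw.ne) hs (e ▸ ht)⟩

/-- A minor model of a tough graph in a clique sum lives in one of the summands. -/
lemma MinorIn.cliqueSum (hK : Tough K) {A B : Set V} {x y : V} (hno : NoCross H A B)
    (hmeet : ∀ u ∈ A, u ∈ B → u = x ∨ u = y)
    (hcl : ∀ u ∈ A, u ∈ B → ∀ v ∈ A, v ∈ B → u ≠ v → H.Adj u v) (h : MinorIn K H (A ∪ B)) :
    MinorIn K H A ∨ MinorIn K H B := by
  obtain ⟨D, h1, h2, h3, h4⟩ := h
  have hX : Nonempty X := ⟨hK.exists_four.choose 0⟩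
  have hex : ∀ x, ∃ p, ∀ w, x ∈ D w → w = p := by
    intro x
    by_cases hx : ∃ p, x ∈ D p
    · obtain ⟨p, hp⟩ := hx
      refine ⟨p, fun w hw => ?_⟩
      by_contra hne
      exact Set.disjoint_left.1 (h3 w p hne) hw hp
    · exact ⟨hX.some, fun w hw => (hx ⟨w, hw⟩).elim⟩
  obtain ⟨p, hp⟩ := hex x
  obtain ⟨q, hq⟩ := hex y
  have hspec : ∀ w, w ≠ p → w ≠ q → ∀ z ∈ D w, z ∈ A → z ∉ B := by
    intro w hwp hwq z hz hzA hzB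
    rcases hmeet z hzA hzB with rfl | rfl
    · exact hwp (hp w hz)
    · exact hwq (hq w hz)
  have hside : ∀ w, w ≠ p → w ≠ q → ∀ A' B' : Set V, NoCross H A' B' → D w ⊆ A' ∪ B' →
      (∀ z ∈ D w, z ∈ A' → z ∉ B') → (D w ∩ A').Nonempty → D w ⊆ B'ᶜ := by
    rintro w hwp hwq A' B' hno hsub hs ⟨z, hz, hzA⟩
    refine (h1 w).subset_of_closed ⟨z, hz, hs z hz hzA⟩ ?_
    intro u hu huB v hv huv hvB
    exact hno u ((hsub hu).resolve_right huB) huB v hvB (fun hvA => hs v hv hvA hvB) huv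
  have hstep : ∀ w, w ≠ p → w ≠ q → ∀ A' B' : Set V, NoCross H A' B' → (∀ w, D w ⊆ A' ∪ B') →
      (∀ z ∈ D w, z ∈ A' → z ∉ B') → (D w ∩ A').Nonempty → ∀ w', K.Adj w' w →
      (D w' ∩ A').Nonempty := by
    intro w hwp hwq A' B' hno hsub hs hne w' hadj
    have hB := hside w hwp hwq A' B' hno (hsub w) hs hne
    obtain ⟨u, hu, v, hv, huv⟩ := h4 w' w hadj
    refine ⟨u, hu, ?_⟩
    by_contra huA
    exact hno v ((hsub w hv).resolve_right (hB hv)) (hB hv) u ((hsub w' hu).resolve_left huA) huA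
      huv.symm
  have hall : ∀ A' B' : Set V, NoCross H A' B' → (∀ w, D w ⊆ A' ∪ B') →
      (∀ w, w ≠ p → w ≠ q → ∀ z ∈ D w, z ∈ A' → z ∉ B') →
      (∀ w, w ≠ p → w ≠ q → (D w ∩ A').Nonempty) → ∀ w, (D w ∩ A').Nonempty := by
    intro A' B' hno hsub hs hne w
    by_cases hwp : w = p
    · subst hwp
      obtain ⟨w', h1, h2, hadj⟩ := hK.exists_adj w q
      exact hstep w' h1 h2 A' B' hno hsub (hs w' h1 h2) (hne w' h1 h2) w hadj
    by_cases hwq : w = q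
    · subst hwq
      obtain ⟨w', h1, h2, hadj⟩ := hK.exists_adj w p
      exact hstep w' h2 h1 A' B' hno hsub (hs w' h2 h1) (hne w' h2 h1) w hadj
    · exact hne w hwp hwq
  by_cases hA : ∃ w, w ≠ p ∧ w ≠ q ∧ (D w ∩ A).Nonempty
  · obtain ⟨w, hwp, hwq, hw⟩ := hA
    have := (hK.conn p q).subset_of_closed (P := {w | (D w ∩ A).Nonempty}) ⟨w, ⟨hwp, hwq⟩, hw⟩
      fun u hu huA v _ huv => hstep u hu.1 hu.2 A B hno h2 (hspec u hu.1 hu.2) huA v huv.symm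
    exact Or.inl (minorIn_inter hno hcl h1 h2 h3 h4
      (hall A B hno h2 hspec fun w hwp hwq => this ⟨hwp, hwq⟩))
  · push Not at hA
    have h2' : ∀ w, D w ⊆ B ∪ A := fun w => union_comm A B ▸ h2 w
    refine Or.inr (minorIn_inter hno.symm (fun u hu hu' v hv hv' => hcl u hu' hu v hv' hv) h1
      h2' h3 h4 (hall B A hno.symm h2'
        (fun w hwp hwq z hz hzB hzA => hspec w hwp hwq z hz hzA hzB) fun w hwp hwq => ?_))
    obtain ⟨z, hz⟩ := (h1 w).nonempty
    refine ⟨z, hz, (h2 w hz).resolve_left fun hzA => ?_⟩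
    have : z ∈ D w ∩ A := ⟨hz, hzA⟩
    rw [hA w hwp hwq] at this
    exact this

/-- Adding an edge between the two sides of a separation of order at most one, next to the
cut vertex, does not create a tough minor. -/
lemma isMinor_of_sup_edge (hK : Tough K) {A B : Set V} {s u v : V} (hun : A ∪ B = univ)
    (hno : NoCross H A B) (hmeet : ∀ z ∈ A, z ∈ B → z = s) (huA : u ∈ A) (huB : u ∉ B)
    (hvB : v ∈ B) (hvA : v ∉ A) (hu : ∀ z ∈ A, z ∈ B → H.Adj z u)
    (hv : ∀ z ∈ A, z ∈ B → H.Adj z v) (h : IsMinor K (H ⊔ edge u v)) : IsMinor K H := by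
  have huv : u ≠ v := fun e => huB (e ▸ hvB)
  have hadj : ∀ a b, (H ⊔ edge u v).Adj a b → H.Adj a b ∨ a = u ∧ b = v ∨ a = v ∧ b = u := by
    intro a b hab
    rw [sup_adj, edge_adj] at hab
    tauto
  have hle : ∀ a b, H.Adj a b → (H ⊔ edge u v).Adj a b := fun a b hab => Or.inl hab
  have huv' : (H ⊔ edge u v).Adj u v := by
    rw [sup_adj, edge_adj]
    exact Or.inr ⟨Or.inl ⟨rfl, rfl⟩, huv⟩
  rw [← minorIn_univ, show univ = (A ∪ {v}) ∪ B by
    rw [union_right_comm, hun, univ_union]] at h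
  rcases MinorIn.cliqueSum hK (x := s) (y := v) (by
    rintro a (ha | rfl) haB b hb hbA hab
    · rcases hadj a b hab with h | ⟨-, rfl⟩ | ⟨rfl, -⟩
      · exact hno a ha haB b hb (fun h => hbA (Or.inl h)) h
      · exact hbA (Or.inr rfl)
      · exact haB hvB
    · exact haB hvB) (by
    rintro a (ha | rfl) haB
    · exact Or.inl (hmeet a ha haB)
    · exact Or.inr rfl) (by
    rintro a (ha | rfl) haB b (hb | rfl) hbB hne
    · exact (hne ((hmeet a ha haB).trans (hmeet b hb hbB).symm)).elim
    · exact hle _ _ (hv a ha haB)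
    · exact hle _ _ (hv b hb hbB).symm
    · exact (hne rfl).elim) h with h | h
  · rw [show A ∪ {v} = A ∪ {z | z ∈ A ∧ z ∈ B ∨ z = u ∨ z = v} by
      ext z
      simp only [mem_union, mem_singleton_iff, mem_ofPred_eq]
      constructor
      · tauto
      · rintro (h | h | rfl | h) <;> tauto] at h
    rcases MinorIn.cliqueSum hK (x := s) (y := u) (by
      rintro a ha haB b (hb | rfl | rfl) hbA hab
      · exact hbA hb.1
      · exact hbA huA
      · rcases hadj a b hab with h | ⟨rfl, -⟩ | ⟨rfl, -⟩
        · refine hno a ha (fun h => haB (Or.inl ⟨ha, h⟩)) b hvB hvA h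
        · exact haB (Or.inr (Or.inl rfl))
        · exact haB (Or.inr (Or.inr rfl))) (by
      rintro a ha (h | h | rfl)
      · exact Or.inl (hmeet a ha h.2)
      · exact Or.inr h
      · exact (hvA ha).elim) (by
      rintro a ha (h | h | rfl) b hb (h' | h' | rfl) hne
      · exact (hne ((hmeet a ha h.2).trans (hmeet b hb h'.2).symm)).elim
      · exact h' ▸ hle _ _ (hu a ha h.2)
      · exact (hvA hb).elim
      · exact h ▸ hle _ _ (hu b hb h'.2).symm
      · exact (hne (h.trans h'.symm)).elim
      · exact (hvA hb).elim
      all_goals exact (hvA ha).elim) h with h | h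
    · refine h.isMinor fun a ha b hb hab => ?_
      rcases hadj a b hab with h | ⟨-, rfl⟩ | ⟨rfl, -⟩
      · exact h
      · exact (hvA hb).elim
      · exact (hvA ha).elim
    · refine (hK.not_minorIn (x := s) (y := u) (z := v) ?_ h).elim
      rintro z (h | h | h)
      · exact Or.inl (hmeet z h.1 h.2)
      · exact Or.inr (Or.inl h)
      · exact Or.inr (Or.inr h)
  · refine h.isMinor fun a ha b hb hab => ?_
    rcases hadj a b hab with h | ⟨rfl, -⟩ | ⟨-, rfl⟩
    · exact h
    · exact (huB ha).elim
    · exact (huB hb).elim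

/-- An added edge can be replaced by a connected set outside of the model. -/
lemma MinorIn.isMinor_of_bridge {A J : Set V} {x y : V}
    (h : MinorIn K (H ⊔ edge x y) A) (hJ : Conn H J) (hJA : Disjoint J A)
    (hx : ∃ j ∈ J, H.Adj x j) (hy : ∃ j ∈ J, H.Adj y j) : IsMinor K H := by
  obtain ⟨D, h1, h2, h3, h4⟩ := h
  have hadj : ∀ a b, (H ⊔ edge x y).Adj a b → H.Adj a b ∨ a = x ∧ b = y ∨ a = y ∧ b = x := by
    intro a b hab
    rw [sup_adj, edge_adj] at hab
    tauto
  obtain ⟨i, hi, hxi⟩ := hx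
  obtain ⟨j, hj, hyj⟩ := hy
  refine isMinor_iff.2 ⟨fun w => {z | z ∈ D w ∨ z ∈ J ∧ x ∈ D w}, fun w => ?_, ?_, ?_⟩
  · by_cases hxD : x ∈ D w
    · refine conn_of_closed ⟨x, Or.inl hxD⟩ ?_
      intro P hne hP
      have hJP : ∀ z ∈ J, z ∈ P → J ⊆ P := fun z hz hzP =>
        hJ.subset_of_closed ⟨z, hz, hzP⟩ fun a ha haP b hb hab =>
          hP a (Or.inr ⟨ha, hxD⟩) haP b (Or.inr ⟨hb, hxD⟩) hab
      have hpart : ∀ z ∈ D w, ∀ k ∈ J, H.Adj z k → (z ∈ P ↔ J ⊆ P) := fun z hz k hk hzk =>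
        ⟨fun hzP => hJP k hk (hP z (Or.inl hz) hzP k (Or.inr ⟨hk, hxD⟩) hzk),
          fun h => hP k (Or.inr ⟨hk, hxD⟩) (h hk) z (Or.inl hz) hzk.symm⟩
      have hDP : ∀ z ∈ D w, z ∈ P → D w ⊆ P := fun z hz hzP =>
        (h1 w).subset_of_closed ⟨z, hz, hzP⟩ fun a ha haP b hb hab => by
          rcases hadj a b hab with h | ⟨rfl, rfl⟩ | ⟨rfl, rfl⟩
          · exact hP a (Or.inl ha) haP b (Or.inl hb) h
          · exact (hpart b hb j hj hyj).2 ((hpart a ha i hi hxi).1 haP)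
          · exact (hpart b hb i hi hxi).2 ((hpart a ha j hj hyj).1 haP)
      have hxJ := hpart x hxD i hi hxi
      have hxP : x ∈ P := by
        obtain ⟨z, hz | hz, hzP⟩ := hne
        · exact hDP z hz hzP hxD
        · exact hxJ.2 (hJP z hz.1 hzP)
      rintro z (hz | hz)
      · exact hDP x hxD hxP hz
      · exact hxJ.1 hxP hz.1
    · rw [show (fun w => {z | z ∈ D w ∨ z ∈ J ∧ x ∈ D w}) w = D w by ext z; simp [hxD]]
      refine (h1 w).mono_adj fun a ha b hb hab => ?_
      rcases hadj a b hab with h | ⟨rfl, -⟩ | ⟨-, rfl⟩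
      · exact h
      · exact (hxD ha).elim
      · exact (hxD hb).elim
  · intro w w' hw
    rw [Set.disjoint_left]
    rintro z (hz | hz) (hz' | hz')
    · exact Set.disjoint_left.1 (h3 w w' hw) hz hz'
    · exact Set.disjoint_left.1 hJA hz'.1 (h2 w hz)
    · exact Set.disjoint_left.1 hJA hz.1 (h2 w' hz')
    · exact Set.disjoint_left.1 (h3 w w' hw) hz.2 hz'.2
  · intro w w' hw
    obtain ⟨a, ha, b, hb, hab⟩ := h4 w w' hw
    rcases hadj a b hab with h | ⟨rfl, rfl⟩ | ⟨rfl, rfl⟩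
    · exact ⟨a, Or.inl ha, b, Or.inl hb, h⟩
    · exact ⟨j, Or.inr ⟨hj, ha⟩, b, Or.inl hb, hyj.symm⟩
    · exact ⟨a, Or.inl ha, j, Or.inr ⟨hj, hb⟩, hyj⟩

/-- An edge-maximal graph without `K₅` and `K₃,₃` minors. -/
structure Saturated (H : SimpleGraph V) : Prop where
  isPlanar : IsPlanar H
  not_isPlanar_sup_edge : ∀ x y, x ≠ y → ¬ H.Adj x y → ¬ IsPlanar (H ⊔ edge x y)

lemma Saturated.false_of_sep (hH : Saturated H) {A B : Set V} {s u v : V} (hun : A ∪ B = univ)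
    (hno : NoCross H A B) (hmeet : ∀ z ∈ A, z ∈ B → z = s) (huA : u ∈ A) (huB : u ∉ B)
    (hvB : v ∈ B) (hvA : v ∉ A) (hu : ∀ z ∈ A, z ∈ B → H.Adj z u)
    (hv : ∀ z ∈ A, z ∈ B → H.Adj z v) : False := by
  refine hH.not_isPlanar_sup_edge u v (fun e => huB (e ▸ hvB)) (hno u huA huB v hvB hvA) ⟨?_, ?_⟩
  · exact fun h => hH.isPlanar.1
      (isMinor_of_sup_edge tough_top_fin_five hun hno hmeet huA huB hvB hvA hu hv h)
  · exact fun h => hH.isPlanar.2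
      (isMinor_of_sup_edge tough_completeBipartiteGraph hun hno hmeet huA huB hvB hvA hu hv h)

lemma Saturated.conn [Nonempty V] (hH : Saturated H) : Conn H univ := by
  refine conn_of_closed univ_nonempty ?_
  rintro P ⟨u, -, hu⟩ hP v -
  by_contra hv
  exact hH.false_of_sep (A := P) (B := Pᶜ) (s := u) (u := u) (v := v) (union_compl_self P)
    (fun a ha _ b _ hb hab => hb (hP a trivial ha b trivial hab)) (fun z hz hz' => (hz' hz).elim)
    hu (fun h => h hu) hv hv (fun z hz hz' => (hz' hz).elim) (fun z hz hz' => (hz' hz).elim)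

lemma Saturated.not_sep_one (hH : Saturated H) {A B : Set V} {s : V} (hun : A ∪ B = univ)
    (hno : NoCross H A B) (hmeet : ∀ z ∈ A, z ∈ B → z = s) (hA : (A \ B).Nonempty)
    (hB : (B \ A).Nonempty) : False := by
  have : Nonempty V := ⟨s⟩
  have key : ∀ A B : Set V, A ∪ B = univ → NoCross H A B → (∀ z ∈ A, z ∈ B → z = s) →
      (A \ B).Nonempty → (B \ A).Nonempty → ∃ u ∈ A, u ∉ B ∧ ∀ z ∈ A, z ∈ B → H.Adj z u := by
    intro A B hun hno hmeet hA hB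
    obtain ⟨a, -, ha, b, -, hb, hab⟩ := hH.conn.exists_adj (A \ B)
      (by simpa using hA) (by
        obtain ⟨b, hb⟩ := hB
        exact ⟨b, trivial, fun h => h.2 hb.1⟩)
    have hbA : b ∈ A ∧ b ∈ B := by
      have : b ∈ A ∪ B := hun ▸ trivial
      have := hno a
      simp only [mem_union, mem_sdiff] at *
      grind
    refine ⟨a, ha.1, ha.2, fun z hz hz' => ?_⟩
    rw [hmeet z hz hz', ← hmeet b hbA.1 hbA.2]
    exact hab.symm
  obtain ⟨u, huA, huB, hu⟩ := key A B hun hno hmeet hA hB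
  obtain ⟨v, hvB, hvA, hv⟩ := key B A (union_comm A B ▸ hun) hno.symm
    (fun z hz hz' => hmeet z hz' hz) hB hA
  exact hH.false_of_sep hun hno hmeet huA huB hvB hvA hu fun z hz hz' => hv z hz' hz

lemma Saturated.exists_bridge (hH : Saturated H) {A B : Set V} {x y : V} (hun : A ∪ B = univ)
    (hno : NoCross H A B) (hmeet : ∀ z ∈ A, z ∈ B → z = x ∨ z = y) (hx : x ∈ A ∧ x ∈ B)
    (hy : y ∈ A ∧ y ∈ B) (hA : (A \ B).Nonempty) (hB : (B \ A).Nonempty) :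
    ∃ J, Conn H J ∧ Disjoint J A ∧ (∃ j ∈ J, H.Adj x j) ∧ ∃ j ∈ J, H.Adj y j := by
  obtain ⟨v, hv⟩ := hB
  obtain ⟨u, huA, huB⟩ := hA
  have hJB : ∀ z ∈ reachIn H (B \ A) v, z ∈ B ∧ z ∉ A := fun z hz => reachIn_subset v hz
  have key : ∀ x y, (∀ z ∈ A, z ∈ B → z = x ∨ z = y) → y ∈ B →
      ∃ j ∈ reachIn H (B \ A) v, H.Adj x j := by
    intro x y hmeet hyB
    by_contra hc
    push Not at hc
    refine hH.not_sep_one (A := {z | z ∈ reachIn H (B \ A) v ∨ z = y})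
      (B := (reachIn H (B \ A) v)ᶜ) (s := y) ?_ ?_ ?_
      ⟨v, Or.inl (mem_reachIn_self hv), fun h => h (mem_reachIn_self hv)⟩
      ⟨u, fun h => (hJB u h).2 huA, ?_⟩
    · ext z
      simp only [mem_union, mem_ofPred_eq, mem_compl_iff, mem_univ, iff_true]
      tauto
    · intro a _ ha b hb hbA hab
      have ha : a ∈ reachIn H (B \ A) v := not_not.1 ha
      have hbB : b ∈ B := by
        by_contra hbB
        have : b ∈ A ∪ B := hun ▸ trivial
        exact hno b (this.resolve_right hbB) hbB a (hJB a ha).1 (hJB a ha).2 hab.symm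
      by_cases hb' : b ∈ A
      · rcases hmeet b hb' hbB with rfl | rfl
        · exact hc a ha hab.symm
        · exact hbA (Or.inr rfl)
      · exact hb (reachIn_closed ha ⟨hbB, hb'⟩ hab)
    · rintro z (hz | hz) hz'
      · exact (hz' hz).elim
      · exact hz
    · rintro (h | rfl)
      · exact (hJB u h).2 huA
      · exact huB hyB
  exact ⟨reachIn H (B \ A) v, conn_reachIn hv, Set.disjoint_left.2 fun z hz => (hJB z hz).2,
    key x y hmeet hy.2, key y x (fun z hz hz' => (hmeet z hz hz').symm) hx.2⟩

lemma Saturated.isMinor_of_sep_two (hH : Saturated H) (hK : Tough K) {A B : Set V} {x y : V}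
    (hun : A ∪ B = univ) (hno : NoCross H A B) (hmeet : ∀ z ∈ A, z ∈ B → z = x ∨ z = y)
    (hx : x ∈ A ∧ x ∈ B) (hy : y ∈ A ∧ y ∈ B) (hxy : x ≠ y) (hA : (A \ B).Nonempty)
    (hB : (B \ A).Nonempty) (h : IsMinor K (H ⊔ edge x y)) : IsMinor K H := by
  have hadj : (H ⊔ edge x y).Adj x y := by
    rw [sup_adj, edge_adj]
    exact Or.inr ⟨Or.inl ⟨rfl, rfl⟩, hxy⟩
  rw [← minorIn_univ, ← hun] at h
  rcases MinorIn.cliqueSum hK (x := x) (y := y) (by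
    intro a ha haB b hb hbA hab
    rw [sup_adj, edge_adj] at hab
    rcases hab with h | ⟨⟨rfl, -⟩ | ⟨rfl, -⟩, -⟩
    · exact hno a ha haB b hb hbA h
    · exact haB hx.2
    · exact haB hy.2) hmeet (by
    intro a ha haB b hb hbB hne
    rcases hmeet a ha haB with rfl | rfl <;> rcases hmeet b hb hbB with rfl | rfl
    · exact (hne rfl).elim
    · exact hadj
    · exact hadj.symm
    · exact (hne rfl).elim) h with h | h
  · obtain ⟨J, hJ, hJA, h1, h2⟩ := hH.exists_bridge hun hno hmeet hx hy hA hB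
    exact h.isMinor_of_bridge hJ hJA h1 h2
  · obtain ⟨J, hJ, hJA, h1, h2⟩ := hH.exists_bridge (union_comm A B ▸ hun) hno.symm
      (fun z hz hz' => hmeet z hz' hz) hx.symm hy.symm hB hA
    exact h.isMinor_of_bridge hJ hJA h1 h2

theorem Saturated.edgeSeparated (hH : Saturated H) : EdgeSeparated H univ := by
  intro A B x y hun hA hB hno hmeet
  have hx : x ∈ A ∧ x ∈ B := by
    by_contra hx
    exact hH.not_sep_one (s := y) hun hno (fun z hz hz' =>
      (hmeet z hz hz').resolve_left fun e => hx ⟨e ▸ hz, e ▸ hz'⟩) hA hB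
  have hy : y ∈ A ∧ y ∈ B := by
    by_contra hy
    exact hH.not_sep_one (s := x) hun hno (fun z hz hz' =>
      (hmeet z hz hz').resolve_right fun e => hy ⟨e ▸ hz, e ▸ hz'⟩) hA hB
  have hxy : x ≠ y := by
    rintro rfl
    exact hH.not_sep_one (s := x) hun hno (fun z hz hz' => (hmeet z hz hz').elim id id) hA hB
  refine ⟨?_, hx.1, hx.2, hy.1, hy.2⟩
  by_contra hadj
  exact hH.not_isPlanar_sup_edge x y hxy hadj
    ⟨fun h => hH.isPlanar.1
      (hH.isMinor_of_sep_two tough_top_fin_five hun hno hmeet hx hy hxy hA hB h),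
    fun h => hH.isPlanar.2
      (hH.isMinor_of_sep_two tough_completeBipartiteGraph hun hno hmeet hx hy hxy hA hB h)⟩

lemma exists_saturated [Finite V] (hH : IsPlanar H) : ∃ H', H ≤ H' ∧ Saturated H' := by
  obtain ⟨H', hle, hmax⟩ := (Set.toFinite {H' : SimpleGraph V | IsPlanar H'}).exists_le_maximal hH
  refine ⟨H', hle, hmax.1, fun x y hxy hadj hpl => hadj ?_⟩
  refine hmax.2 hpl le_sup_left ?_
  rw [sup_adj, edge_adj]
  exact Or.inr ⟨Or.inl ⟨rfl, rfl⟩, hxy⟩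

end CliqueSum

section Grid

variable {V : Type*} {H : SimpleGraph V}

lemma Saturated.exists_sweep [Finite V] [Nonempty V] (hH : Saturated H) :
    ∃ a w, Sweep H a w univ := by
  obtain ⟨a⟩ := ‹Nonempty V›
  rcases eq_or_ne ({a} : Set V) univ with h | h
  · exact ⟨a, [a], h ▸ Sweep.init⟩
  obtain ⟨b, -, rfl, t, -, -, hat⟩ := hH.conn.exists_adj {a} ⟨a, trivial, rfl⟩ (by
    rw [Set.ne_univ_iff_exists_notMem] at h
    obtain ⟨t, ht⟩ := h
    exact ⟨t, trivial, ht⟩)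
  obtain ⟨w, hw, ht⟩ := sweepable_of_edgeSeparated
    (fun B a t h3 ha ht hat => sweepable_of_threeConn hH.isPlanar.1 hH.isPlanar.2 h3 ha ht hat)
    univ hH.edgeSeparated b t trivial trivial hat
  refine ⟨b, [t], ?_⟩
  have := Sweep.cover (A := []) (B := w) (C := []) (v := t) (by simpa using hw) (by simp)
    (List.ne_nil_of_mem (ht b trivial hat)) fun u _ hu => ht u trivial hu
  simpa using this

/-- Every finite planar graph is a minor of a grid. -/
theorem exists_isMinor_gridGraph [Finite V] (hH : IsPlanar H) :
    ∃ r t, IsMinor H (gridGraph r t) := by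
  rcases isEmpty_or_nonempty V with hV | hV
  · exact ⟨0, 0, isMinor_iff.2 ⟨isEmptyElim, isEmptyElim, isEmptyElim, isEmptyElim⟩⟩
  obtain ⟨H', hle, hH'⟩ := exists_saturated hH
  obtain ⟨a, w, hw⟩ := hH'.exists_sweep
  obtain ⟨r, t, hrt⟩ := hw.model.isMinor
  exact ⟨r, t, isMinor_trans (isMinor_of_embedding id Function.injective_id fun _ _ h => hle h) hrt⟩

end Grid

end ClusterExt

/-- **Corollary.** For every planar graph `H` and all positive integers `Δ` and `N₀`,
there exists a positive integer `N` such that for every `H`-minor free graph `G` with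
maximum degree at most `Δ`, every 2-list-assignment `L` of `G`, and every pre-`L`-coloring
`c₀` of `G` with weak diameter in `G` at most `N₀`, `c₀` can be extended to an `L`-coloring
of `G` with clustering at most `N`. -/
theorem planar_minor_free_precoloring_extension_clustering
    {W : Type v} [Fintype W] (H : SimpleGraph W) (hH : IsPlanar H)
    (Δ N₀ : ℕ) (hΔ : 0 < Δ) (hN₀ : 0 < N₀) :
    ∃ N : ℕ, 0 < N ∧
      ∀ (V : Type u) [Fintype V] (G : SimpleGraph V),
        ¬ IsMinor H G →
        MaxDegreeLE G Δ →
        ∀ L : V → Finset ℕ,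
          (∀ x, (L x).Nonempty) →
          (∀ x, (L x).card = 2) →
          ∀ (S : Set V) (c₀ : V → ℕ),
            (∀ x ∈ S, c₀ x ∈ L x) →
            HasWeakDiamLE G S c₀ N₀ →
            ∃ c : V → ℕ, (∀ x, c x ∈ L x) ∧ (∀ x ∈ S, c x = c₀ x) ∧
              HasClusteringLE G Set.univ c N := by
  obtain ⟨r, t, hrt⟩ := ClusterExt.exists_isMinor_gridGraph hH
  obtain ⟨M, hM⟩ := ClusterExt.exists_tree_partition.{u} H hrt hΔ
  obtain ⟨N, hN, h⟩ := ClusterExt.exists_clustered_extension.{u} M Δ N₀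
  refine ⟨N, hN, fun V _ G hG hd L _ hL S c₀ hc₀ hdiam => ?_⟩
  obtain ⟨b, hb, hbM⟩ := hM V G hG hd
  exact h V G b hb hbM hd L hL S c₀ hc₀ hdiam
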